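/- arXiv:q-alg/9712003 — 7 statements merged into one kernel-verified Lean document; each statement's English description precedes it below -/
import Mathlib

section
/- For every natural number n, the number of crossingless matchings of 2n points equals the n-th Catalan number. -/
/-- A crossingless matching of `m` points: a fixed-point-free involution of `Fin m`
with no crossing pairs `a < b < c < d`, `f a = c`, `f b = d`. -/
def IsCrossinglessMatching {m : ℕ} (f : Fin m → Fin m) : Prop :=
  (∀ i, f (f i) = i) ∧ (∀ i, f i ≠ i) ∧
  ∀ a b c d : Fin m, a < b → b < c → c < d → f a = c → f b = d → False

/-- A crossingless matching of the points `0, …, m - 1`, as a function on `ℕ` that fixes every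
`i ≥ m`. -/
structure IsNatMatching (m : ℕ) (f : ℕ → ℕ) : Prop where
  fix : ∀ i, m ≤ i → f i = i
  lt : ∀ i, i < m → f i < m
  invol : ∀ i, f (f i) = i
  ne : ∀ i, i < m → f i ≠ i
  noncrossing : ∀ a b, a < b → b < f a → f a < f b → False

/-- Crossingless matchings on `Fin m` extend uniquely to matchings on `ℕ` fixing all `i ≥ m`. -/
def crossinglessMatchingEquiv (m : ℕ) :
    {f : Fin m → Fin m // IsCrossinglessMatching f} ≃ {f : ℕ → ℕ // IsNatMatching m f} where
  toFun f := ⟨fun i => if h : i < m then f.1 ⟨i, h⟩ else i, by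
    obtain ⟨f, h1, h2, h3⟩ := f
    refine ⟨?_, ?_, ?_, ?_, ?_⟩
    · intro i hi
      simp [hi.not_gt]
    · intro i hi
      simp [hi]
    · intro i
      by_cases hi : i < m <;> simp [hi, h1]
    · intro i hi h
      simp only [hi, dite_true] at h
      exact h2 ⟨i, hi⟩ (Fin.ext h)
    · intro a b hab hba hf
      by_cases ha : a < m
      · simp only [ha, dite_true] at hba hf
        have hb : b < m := hba.trans (f ⟨a, ha⟩).2
        simp only [hb, dite_true] at hf
        exact h3 ⟨a, ha⟩ ⟨b, hb⟩ _ _ hab hba hf rfl rfl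
      · simp only [ha, dite_false] at hba
        omega⟩
  invFun f := ⟨fun i => ⟨f.1 i, f.2.lt i i.2⟩, by
    refine ⟨fun i => Fin.ext (f.2.invol i), fun i h => f.2.ne i i.2 (congrArg Fin.val h), ?_⟩
    rintro a b c d hab hbc hcd rfl rfl
    exact f.2.noncrossing a b hab hbc hcd⟩
  left_inv f := by
    ext i
    simp
  right_inv f := by
    ext i
    by_cases hi : i < m
    · simp [hi]
    · simp [hi, f.2.fix i (not_lt.1 hi)]

instance (m : ℕ) : Finite {f : ℕ → ℕ // IsNatMatching m f} :=
  Finite.of_equiv _ (crossinglessMatchingEquiv m)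

namespace IsNatMatching

variable {m k l : ℕ} {f g h : ℕ → ℕ}

/-- The matching with an arc from `0` to `k + 1`, with `g` below the arc and `h` to its right. -/
def join (k : ℕ) (g h : ℕ → ℕ) (i : ℕ) : ℕ :=
  if i = 0 then k + 1 else if i ≤ k then g (i - 1) + 1 else if i = k + 1 then 0
  else h (i - (k + 2)) + (k + 2)

/-- The part of `f` below an arc from `0` to `k + 1`. -/
def inside (k : ℕ) (f : ℕ → ℕ) (i : ℕ) : ℕ := if i < k then f (i + 1) - 1 else i

/-- The part of `f` to the right of an arc from `0` to `k + 1`. -/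
def outside (k : ℕ) (f : ℕ → ℕ) (i : ℕ) : ℕ := f (i + (k + 2)) - (k + 2)

theorem join_cases (k : ℕ) (g h : ℕ → ℕ) (i : ℕ) :
    (i = 0 ∧ join k g h i = k + 1) ∨
    (∃ j, j < k ∧ i = j + 1 ∧ join k g h i = g j + 1) ∨
    (i = k + 1 ∧ join k g h i = 0) ∨
    (∃ j, i = j + (k + 2) ∧ join k g h i = h j + (k + 2)) := by
  unfold join
  split_ifs with h1 h2 h3
  · simp [h1]
  · exact Or.inr (Or.inl ⟨i - 1, by omega, by omega, rfl⟩)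
  · simp [h3]
  · exact Or.inr (Or.inr (Or.inr ⟨i - (k + 2), by omega, rfl⟩))

theorem join_zero : join k g h 0 = k + 1 := by simp [join]

theorem join_add_one {i : ℕ} (hi : i < k) : join k g h (i + 1) = g i + 1 := by
  simp [join, hi]

theorem join_last : join k g h (k + 1) = 0 := by simp [join]

theorem join_add (i : ℕ) : join k g h (i + (k + 2)) = h i + (k + 2) := by
  unfold join
  rw [if_neg (by omega), if_neg (by omega), if_neg (by omega), Nat.add_sub_cancel]

theorem isNatMatching_join (hg : IsNatMatching k g) (hh : IsNatMatching l h) :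
    IsNatMatching (k + l + 2) (join k g h) where
  fix i hi := by
    obtain ⟨j, rfl⟩ : ∃ j, i = j + (k + 2) := ⟨i - (k + 2), by omega⟩
    rw [join_add, hh.fix j (by omega)]
  lt i hi := by
    rcases join_cases k g h i with ⟨rfl, e⟩ | ⟨j, hj, rfl, e⟩ | ⟨rfl, e⟩ | ⟨j, rfl, e⟩
    · omega
    · have := hg.lt j hj
      omega
    · omega
    · have := hh.lt j (by omega)
      omega
  invol i := by
    rcases join_cases k g h i with ⟨rfl, e⟩ | ⟨j, hj, rfl, e⟩ | ⟨rfl, e⟩ | ⟨j, rfl, e⟩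
    · rw [e, join_last]
    · rw [e, join_add_one (hg.lt j hj), hg.invol]
    · rw [e, join_zero]
    · rw [e, join_add, hh.invol]
  ne i hi := by
    rcases join_cases k g h i with ⟨rfl, e⟩ | ⟨j, hj, rfl, e⟩ | ⟨rfl, e⟩ | ⟨j, rfl, e⟩
    · omega
    · have := hg.ne j hj
      omega
    · omega
    · have := hh.ne j (by omega)
      omega
  noncrossing a b hab hba hf := by
    rcases join_cases k g h a with ⟨rfl, e⟩ | ⟨j, hj, rfl, e⟩ | ⟨rfl, e⟩ | ⟨j, rfl, e⟩ <;>
    rcases join_cases k g h b with ⟨rfl, e'⟩ | ⟨i, hi, rfl, e'⟩ | ⟨rfl, e'⟩ | ⟨i, rfl, e'⟩ <;>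
    simp only [e, e'] at hba hf <;> try omega
    · have := hg.lt i hi
      omega
    · exact hg.noncrossing j i (by omega) (by omega) (by omega)
    · have := hg.lt j hj
      omega
    · exact hh.noncrossing j i (by omega) (by omega) (by omega)

theorem apply_last (hf : IsNatMatching m f) (h0 : f 0 = k + 1) : f (k + 1) = 0 := by
  rw [← h0, hf.invol]

theorem apply_inside (hf : IsNatMatching m f) (h0 : f 0 = k + 1) {i : ℕ} (hi : i < k) :
    ∃ j, j < k ∧ f (i + 1) = j + 1 := by
  have h1 : ¬ f 0 < f (i + 1) := hf.noncrossing 0 (i + 1) (by omega) (by omega)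
  have h2 := hf.invol (i + 1)
  have h3 := hf.apply_last h0
  have h4 : f (i + 1) ≠ 0 := fun h => by rw [h] at h2; omega
  have h5 : f (i + 1) ≠ k + 1 := fun h => by rw [h] at h2; omega
  exact ⟨f (i + 1) - 1, by omega, by omega⟩

theorem apply_outside (hf : IsNatMatching m f) (h0 : f 0 = k + 1) (i : ℕ) :
    ∃ j, f (i + (k + 2)) = j + (k + 2) := by
  refine ⟨f (i + (k + 2)) - (k + 2), ?_⟩
  by_contra hlt
  have h2 := hf.invol (i + (k + 2))
  have h3 := hf.apply_last h0
  have h4 : f (i + (k + 2)) ≠ 0 := fun h => by rw [h] at h2; omega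
  have h5 : f (i + (k + 2)) ≠ k + 1 := fun h => by rw [h] at h2; omega
  obtain ⟨j, hj, e⟩ : ∃ j, j < k ∧ f (i + (k + 2)) = j + 1 :=
    ⟨f (i + (k + 2)) - 1, by omega, by omega⟩
  obtain ⟨j', hj', e'⟩ := hf.apply_inside h0 hj
  rw [e] at h2
  omega

theorem inside_add_one (hf : IsNatMatching m f) (h0 : f 0 = k + 1) {i : ℕ} (hi : i < k) :
    f (i + 1) = inside k f i + 1 := by
  obtain ⟨j, -, e⟩ := hf.apply_inside h0 hi
  simp [inside, hi, e]

theorem inside_of_le {i : ℕ} (hi : k ≤ i) : inside k f i = i := by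
  simp [inside, hi.not_gt]

theorem outside_add (hf : IsNatMatching m f) (h0 : f 0 = k + 1) (i : ℕ) :
    f (i + (k + 2)) = outside k f i + (k + 2) := by
  obtain ⟨j, e⟩ := hf.apply_outside h0 i
  simp [outside, e]

theorem isNatMatching_inside (hf : IsNatMatching m f) (h0 : f 0 = k + 1) (hm : k + 2 ≤ m) :
    IsNatMatching k (inside k f) := by
  have hlt : ∀ i, i < k → inside k f i < k := fun i hi => by
    obtain ⟨j, hj, e⟩ := hf.apply_inside h0 hi
    have := hf.inside_add_one h0 hi
    omega
  refine ⟨fun i hi => inside_of_le hi, hlt, fun i => ?_, fun i hi h => ?_, fun a b hab hba h => ?_⟩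
  · rcases lt_or_ge i k with hi | hi
    · have h1 := hf.inside_add_one h0 hi
      have h2 := hf.inside_add_one h0 (hlt i hi)
      rw [← h1, hf.invol] at h2
      omega
    · rw [inside_of_le hi, inside_of_le hi]
  · have h1 := hf.inside_add_one h0 hi
    exact hf.ne (i + 1) (by omega) (by omega)
  · rcases lt_or_ge a k with ha | ha
    · have hb : b < k := hba.trans (hlt a ha)
      have h1 := hf.inside_add_one h0 ha
      have h2 := hf.inside_add_one h0 hb
      exact hf.noncrossing (a + 1) (b + 1) (by omega) (by omega) (by omega)
    · rw [inside_of_le ha] at hba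
      omega

theorem isNatMatching_outside (hf : IsNatMatching (k + l + 2) f) (h0 : f 0 = k + 1) :
    IsNatMatching l (outside k f) := by
  have key := hf.outside_add h0
  refine ⟨fun i hi => ?_, fun i hi => ?_, fun i => ?_, fun i hi h => ?_, fun a b hab hba h => ?_⟩
  · have := hf.fix (i + (k + 2)) (by omega)
    have := key i
    omega
  · have := hf.lt (i + (k + 2)) (by omega)
    have := key i
    omega
  · have h2 := key (outside k f i)
    rw [← key i, hf.invol] at h2
    omega
  · have := key i
    exact hf.ne (i + (k + 2)) (by omega) (by omega)
  · have := key a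
    have := key b
    exact hf.noncrossing (a + (k + 2)) (b + (k + 2)) (by omega) (by omega) (by omega)

/-- Matchings in which `0` is joined to `k + 1` are pairs of smaller matchings. -/
def splitEquiv (k l : ℕ) :
    {f : ℕ → ℕ // IsNatMatching (k + l + 2) f ∧ f 0 = k + 1} ≃
      {g : ℕ → ℕ // IsNatMatching k g} × {h : ℕ → ℕ // IsNatMatching l h} where
  toFun f := (⟨inside k f.1, f.2.1.isNatMatching_inside f.2.2 (by omega)⟩,
    ⟨outside k f.1, f.2.1.isNatMatching_outside f.2.2⟩)
  invFun p := ⟨join k p.1.1 p.2.1, isNatMatching_join p.1.2 p.2.2, join_zero⟩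
  left_inv := by
    rintro ⟨f, hf, h0⟩
    ext i
    change join k (inside k f) (outside k f) i = f i
    rcases join_cases k (inside k f) (outside k f) i with
      ⟨rfl, e⟩ | ⟨j, hj, rfl, e⟩ | ⟨rfl, e⟩ | ⟨j, rfl, e⟩ <;> rw [e]
    · exact h0.symm
    · exact (hf.inside_add_one h0 hj).symm
    · exact (hf.apply_last h0).symm
    · exact (hf.outside_add h0 j).symm
  right_inv := by
    rintro ⟨⟨g, hg⟩, ⟨h, hh⟩⟩
    refine Prod.ext (Subtype.ext (funext fun i => ?_)) (Subtype.ext (funext fun i => ?_))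
    · change inside k (join k g h) i = g i
      unfold inside
      split_ifs with hi
      · rw [join_add_one hi, Nat.add_sub_cancel]
      · exact (hg.fix i (not_lt.1 hi)).symm
    · change join k g h (i + (k + 2)) - (k + 2) = h i
      rw [join_add, Nat.add_sub_cancel]

theorem card_add_two (m : ℕ) :
    Nat.card {f : ℕ → ℕ // IsNatMatching (m + 2) f} =
      ∑ k ∈ Finset.range (m + 1), Nat.card {g : ℕ → ℕ // IsNatMatching k g} *
        Nat.card {h : ℕ → ℕ // IsNatMatching (m - k) h} := by
  have hzero (f : {f : ℕ → ℕ // IsNatMatching (m + 2) f}) : 0 < f.1 0 ∧ f.1 0 < m + 2 :=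
    ⟨Nat.pos_of_ne_zero (f.2.ne 0 (by omega)), f.2.lt 0 (by omega)⟩
  let φ (f : {f : ℕ → ℕ // IsNatMatching (m + 2) f}) : Fin (m + 1) :=
    ⟨f.1 0 - 1, by have := hzero f; omega⟩
  rw [← Nat.card_congr (Equiv.sigmaFiberEquiv φ), Nat.card_sigma, Finset.sum_range]
  refine Finset.sum_congr rfl fun k _ => ?_
  rw [← Nat.card_prod, ← Nat.card_congr (splitEquiv k (m - k))]
  have hk : (k : ℕ) + (m - k) + 2 = m + 2 := by omega
  rw [hk]
  refine Nat.card_congr ((Equiv.subtypeEquivRight fun f => ?_).trans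
    (Equiv.subtypeSubtypeEquivSubtypeInter _ (fun f : ℕ → ℕ => f 0 = k + 1)))
  have := hzero f
  simp only [φ, Fin.ext_iff]
  omega

theorem card_zero : Nat.card {f : ℕ → ℕ // IsNatMatching 0 f} = 1 := by
  rw [Nat.card_eq_one_iff_unique]
  exact ⟨⟨fun f g => Subtype.ext (funext fun i => by
    rw [f.2.fix i i.zero_le, g.2.fix i i.zero_le])⟩,
    ⟨⟨id, fun _ _ => rfl, by simp, fun _ => rfl, by simp, by simp; omega⟩⟩⟩

theorem card_odd (n : ℕ) : Nat.card {f : ℕ → ℕ // IsNatMatching (2 * n + 1) f} = 0 := by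
  induction n using Nat.strong_induction_on with
  | _ n ih =>
    rcases n with _ | n
    · have : IsEmpty {f : ℕ → ℕ // IsNatMatching (2 * 0 + 1) f} :=
        ⟨fun f => f.2.ne 0 (by omega) (by have := f.2.lt 0 (by omega); omega)⟩
      exact Nat.card_of_isEmpty
    · rw [show 2 * (n + 1) + 1 = 2 * n + 1 + 2 by ring, card_add_two]
      refine Finset.sum_eq_zero fun k hk => ?_
      rw [Finset.mem_range] at hk
      rcases Nat.even_or_odd' k with ⟨j, rfl | rfl⟩
      · rw [show 2 * n + 1 - 2 * j = 2 * (n - j) + 1 by omega, ih (n - j) (by omega), mul_zero]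
      · rw [ih j (by omega), zero_mul]

theorem card_even (n : ℕ) :
    Nat.card {f : ℕ → ℕ // IsNatMatching (2 * n) f} = catalan n := by
  have sum_even (F : ℕ → ℕ) (hF : ∀ i, F (2 * i + 1) = 0) (N : ℕ) :
      ∑ k ∈ Finset.range (2 * N + 1), F k = ∑ i ∈ Finset.range (N + 1), F (2 * i) := by
    induction N with
    | zero => simp
    | succ N ih =>
      rw [show 2 * (N + 1) + 1 = 2 * N + 1 + 1 + 1 by ring, Finset.sum_range_succ,
        Finset.sum_range_succ, ih, hF, Finset.sum_range_succ _ (N + 1)]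
      rfl
  induction n using Nat.strong_induction_on with
  | _ n ih =>
    rcases n with _ | n
    · rw [catalan_zero]
      exact card_zero
    · rw [show 2 * (n + 1) = 2 * n + 2 by ring, card_add_two,
        sum_even _ (fun i => by rw [card_odd, zero_mul]), catalan_succ, Finset.sum_range]
      refine Finset.sum_congr rfl fun i _ => ?_
      rw [ih i (by omega), show 2 * n - 2 * (i : ℕ) = 2 * (n - i) by omega,
        ih (n - i) (by omega)]

end IsNatMatching

theorem card_crossinglessMatchings_eq_catalan (n : ℕ) :
    Nat.card {f : Fin (2 * n) → Fin (2 * n) // IsCrossinglessMatching f} = catalan n := by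
  rw [Nat.card_congr (crossinglessMatchingEquiv (2 * n))]
  exact IsNatMatching.card_even n
end

section
/- Let N = (n₁, …, n_k) be a list of positive integers. For each natural number n, let P_n denote the ℂ-vector space of homogeneous polynomials of degree n in two variables X, Y, on which SL(2,ℂ) acts by linear substitution of the variables: for g = (a b; c d) in SL(2,ℂ), the polynomial g·p is obtained from p by substituting X ↦ aX + bY and Y ↦ cX + dY. Then the dimension of the ℂ-vector space of multilinear maps F : P_{n₁} × ⋯ × P_{n_k} → ℂ satisfying F(g·p₁, …, g·p_k) = F(p₁, …, p_k) for all g ∈ SL(2,ℂ) equals the cardinality of the clasped basis set B(N). -/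
/-- Membership of `f` in the clasped basis set `B(N)`: `f` is a crossingless matching
of `N.sum` points such that no point is matched to a point of the same block, where the
blocks are the consecutive intervals of sizes `N.get 0, N.get 1, …`. -/
def InClaspedBasis (N : List ℕ) (f : Fin N.sum → Fin N.sum) : Prop :=
  IsCrossinglessMatching f ∧
  ∀ (i : Fin N.sum) (b : ℕ),
    (N.take b).sum ≤ (i : ℕ) → (i : ℕ) < (N.take (b + 1)).sum →
    (N.take b).sum ≤ (f i : ℕ) → (f i : ℕ) < (N.take (b + 1)).sum → False

/-- The substitution action of `g ∈ SL(2,ℂ)` on polynomials in two variables: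
each variable `Xᵢ` is replaced by the linear form `∑ⱼ g i j • Xⱼ`. -/
noncomputable def sl2Subst (g : Matrix.SpecialLinearGroup (Fin 2) ℂ) :
    MvPolynomial (Fin 2) ℂ →ₐ[ℂ] MvPolynomial (Fin 2) ℂ :=
  MvPolynomial.aeval (fun i => ∑ j,
    MvPolynomial.C ((g : Matrix (Fin 2) (Fin 2) ℂ) i j) * MvPolynomial.X j)

/-- The space of multilinear forms on `P_{n₁} × ⋯ × P_{n_k}` (the spaces of homogeneous
polynomials of degrees `n₁, …, n_k` in two variables) invariant under the simultaneous
substitution action of `SL(2,ℂ)`. -/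
noncomputable def invariantClaspedForms (N : List ℕ) :
    Submodule ℂ (MultilinearMap ℂ
      (fun i : Fin N.length => MvPolynomial.homogeneousSubmodule (Fin 2) ℂ (N.get i)) ℂ) where
  carrier := {F | ∀ (g : Matrix.SpecialLinearGroup (Fin 2) ℂ)
      (p q : ∀ i : Fin N.length, MvPolynomial.homogeneousSubmodule (Fin 2) ℂ (N.get i)),
      (∀ i, (q i : MvPolynomial (Fin 2) ℂ) = sl2Subst g (p i)) → F q = F p}
  add_mem' := by
    intro F G hF hG g p q h
    rw [MultilinearMap.add_apply, MultilinearMap.add_apply, hF g p q h, hG g p q h]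
  zero_mem' := by
    intro g p q h
    rw [MultilinearMap.zero_apply, MultilinearMap.zero_apply]
  smul_mem' := by
    intro c F hF g p q h
    rw [MultilinearMap.smul_apply, MultilinearMap.smul_apply, hF g p q h]

theorem IsNatMatching.nested {m : ℕ} {f : ℕ → ℕ} (hf : IsNatMatching m f) {a b : ℕ}
    (h₁ : a < b) (h₂ : b < f a) : a < f b ∧ f b < f a := by
  have e₁ := hf.invol a
  have e₂ := hf.invol b
  have c₁ : ¬ f a < f b := hf.noncrossing a b h₁ h₂
  have c₂ := hf.noncrossing (f b) a
  have n₁ : f b ≠ f a := fun h => by rw [h, e₁] at e₂; omega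
  have n₂ : f b ≠ a := fun h => by rw [h] at e₂; omega
  rw [e₂] at c₂
  refine ⟨?_, by omega⟩
  by_contra h
  exact c₂ (by omega) h₁ h₂

/-- No point is matched inside its own block, the blocks being the consecutive intervals of sizes
given by the list, starting at the point `o`. -/
def BlockFree : ℕ → List ℕ → (ℕ → ℕ) → Prop
  | _, [], _ => True
  | o, n :: N, f => (∀ i, o ≤ i → i < o + n → o ≤ f i → f i < o + n → False) ∧
      BlockFree (o + n) N f

theorem blockFree_iff (N : List ℕ) (o : ℕ) (f : ℕ → ℕ) :
    BlockFree o N f ↔ ∀ i b, o + (N.take b).sum ≤ i → i < o + (N.take (b + 1)).sum →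
      o + (N.take b).sum ≤ f i → f i < o + (N.take (b + 1)).sum → False := by
  induction N generalizing o with
  | nil => simp only [BlockFree, List.take_nil, List.sum_nil, true_iff]; intros; omega
  | cons n N ih =>
    rw [BlockFree, ih]
    constructor
    · rintro ⟨h₀, h⟩ i (_ | b)
      · simpa using h₀ i
      · simpa [add_assoc] using h i b
    · intro h
      refine ⟨fun i => by simpa using h i 0, fun i b => ?_⟩
      simpa [add_assoc] using h i (b + 1)

/-- The clasped basis set, with matchings regarded as functions on `ℕ`. -/
def natClaspedBasis (N : List ℕ) : Set (ℕ → ℕ) :=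
  {f | IsNatMatching N.sum f ∧ BlockFree 0 N f}

theorem extend_mem_natClaspedBasis {N : List ℕ} {f : Fin N.sum → Fin N.sum}
    (hf : InClaspedBasis N f) :
    (fun i => if h : i < N.sum then (f ⟨i, h⟩ : ℕ) else i) ∈ natClaspedBasis N := by
  obtain ⟨⟨hinv, hne, hnc⟩, hb⟩ := hf
  refine ⟨⟨fun i hi => by simp [hi], fun i hi => by simp [hi], fun i => ?_, fun i hi => ?_,
    fun a b hab hba hab' => ?_⟩, ?_⟩
  · by_cases hi : i < N.sum <;> simp [hi, hinv]
  · simpa [hi, Fin.ext_iff] using hne ⟨i, hi⟩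
  · by_cases ha : a < N.sum
    · simp only [ha, dif_pos] at hba hab'
      have hb : b < N.sum := by omega
      simp only [hb, dif_pos] at hab'
      exact hnc ⟨a, ha⟩ ⟨b, hb⟩ (f ⟨a, ha⟩) (f ⟨b, hb⟩) hab hba hab' rfl rfl
    · simp only [ha, dif_neg, not_false_eq_true] at hba
      omega
  · rw [blockFree_iff]
    intro i b h₁ h₂ h₃ h₄
    have hi : i < N.sum := by
      have := (List.take_sublist (b + 1) N).sum_le_sum (by simp)
      omega
    simp only [hi, dif_pos, zero_add] at h₁ h₂ h₃ h₄
    exact hb ⟨i, hi⟩ b h₁ h₂ h₃ h₄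

theorem restrict_inClaspedBasis {N : List ℕ} {f : ℕ → ℕ} (hf : f ∈ natClaspedBasis N) :
    InClaspedBasis N (fun i => ⟨f i, hf.1.lt i i.2⟩) := by
  obtain ⟨hm, hb⟩ := hf
  refine ⟨⟨fun i => Fin.ext (hm.invol i), fun i h => hm.ne i i.2 (Fin.ext_iff.1 h), ?_⟩, ?_⟩
  · rintro a b c d hab hbc hcd rfl rfl
    exact hm.noncrossing a b hab hbc hcd
  · intro i b
    simpa using (blockFree_iff N 0 f).1 hb i b

/-- The two descriptions of the clasped basis set agree. -/
def claspedBasisEquiv (N : List ℕ) :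
    {f : Fin N.sum → Fin N.sum // InClaspedBasis N f} ≃ natClaspedBasis N where
  toFun f := ⟨_, extend_mem_natClaspedBasis f.2⟩
  invFun f := ⟨_, restrict_inClaspedBasis f.2⟩
  left_inv f := by ext i; simp
  right_inv f := by
    ext i
    by_cases hi : i < N.sum
    · simp [hi]
    · simp [hi, f.2.1.fix i (by omega)]

theorem finite_natClaspedBasis (N : List ℕ) : (natClaspedBasis N).Finite :=
  have := Finite.of_equiv _ (claspedBasisEquiv N)
  Set.toFinite _

theorem card_claspedBasis (N : List ℕ) :
    Nat.card {f : Fin N.sum → Fin N.sum // InClaspedBasis N f} = (natClaspedBasis N).ncard :=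
  Nat.card_congr (claspedBasisEquiv N)

theorem natClaspedBasis_zero_cons (N : List ℕ) :
    natClaspedBasis (0 :: N) = natClaspedBasis N := by
  ext f
  simp only [natClaspedBasis, Set.mem_ofPred_eq, BlockFree, List.sum_cons, zero_add]
  exact and_congr_right fun _ => and_iff_right fun i _ h => by omega

theorem natClaspedBasis_cons_zero_cons (n : ℕ) (N : List ℕ) :
    natClaspedBasis (n :: 0 :: N) = natClaspedBasis (n :: N) := by
  ext f
  simp only [natClaspedBasis, Set.mem_ofPred_eq, BlockFree, List.sum_cons, zero_add, add_zero]
  exact and_congr_right fun _ => and_congr_right fun _ => and_iff_right fun i _ h => by omega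

theorem ncard_natClaspedBasis_nil : (natClaspedBasis []).ncard = 1 := by
  rw [Set.ncard_eq_one]
  refine ⟨id, Set.eq_singleton_iff_unique_mem.2 ⟨⟨⟨?_, ?_, ?_, ?_, ?_⟩, trivial⟩, ?_⟩⟩
  · simp
  · simp
  · simp
  · simp
  · intro a b h₁ h₂; simp at h₂; omega
  · rintro f ⟨hf, -⟩
    exact funext fun i => hf.fix i (by simp)

theorem natClaspedBasis_singleton_succ (n : ℕ) : natClaspedBasis [n + 1] = ∅ := by
  ext f
  simp only [Set.mem_empty_iff_false, iff_false]
  rintro ⟨hf, hb, -⟩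
  have := hf.lt 0 (by simp)
  exact hb 0 le_rfl (by omega) (by omega) (by simpa using this)

/-- If the last point of the first block is not matched to the first point of the second, no arc
joins the two blocks, so they can be merged. -/
theorem natClaspedBasis_merge (p q : ℕ) (N : List ℕ) :
    natClaspedBasis ((p + 1) :: (q + 1) :: N) \ {f | f p = p + 1} =
      natClaspedBasis ((p + 1 + (q + 1)) :: N) := by
  ext f
  simp only [natClaspedBasis, Set.mem_sdiff, Set.mem_ofPred_eq, BlockFree, List.sum_cons, zero_add,
    ← add_assoc]
  constructor
  · rintro ⟨⟨hf, h₁, h₂, h₃⟩, hp⟩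
    have key : ∀ d i, i + d = p → p < f i → f i < p + 1 + q + 1 → False := by
      intro d
      induction d using Nat.strong_induction_on with
      | _ d ih =>
        intro i hi hl hr
        rcases Nat.eq_zero_or_pos d with rfl | hd
        · obtain rfl : i = p := by omega
          have := hf.nested (a := i) (b := i + 1) (by omega) (by omega)
          exact h₂ (i + 1) (by omega) (by omega) (by omega) (by omega)
        · have := hf.nested (a := i) (b := p) (by omega) (by omega)
          have : ¬ f p < p + 1 := h₁ p (by omega) (by omega) (by omega)
          exact ih 0 hd p rfl (by omega) (by omega)
    refine ⟨hf, fun i _ hi _ hfi => ?_, h₃⟩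
    rcases Nat.lt_or_ge i (p + 1) with hip | hip
    · rcases Nat.lt_or_ge (f i) (p + 1) with hfp | hfp
      · exact h₁ i (by omega) hip (by omega) hfp
      · exact key (p - i) i (by omega) (by omega) hfi
    · rcases Nat.lt_or_ge (f i) (p + 1) with hfp | hfp
      · exact key (p - f i) (f i) (by omega) (by rw [hf.invol]; omega) (by rw [hf.invol]; omega)
      · exact h₂ i (by omega) (by omega) (by omega) hfi
  · rintro ⟨hf, h₁, h₃⟩
    refine ⟨⟨hf, fun i _ hi _ hfi => h₁ i (by omega) (by omega) (by omega) (by omega),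
      fun i _ hi _ hfi => h₁ i (by omega) (by omega) (by omega) (by omega), h₃⟩, fun hp => ?_⟩
    exact h₁ p (by omega) (by omega) (by omega) (by omega)

/-- The order embedding of `ℕ` missing `p` and `p + 1`. -/
def skipTwo (p i : ℕ) : ℕ := if i < p then i else i + 2

/-- A left inverse of `skipTwo p`. -/
def unskipTwo (p i : ℕ) : ℕ := if i < p then i else i - 2

/-- Insert an arc joining `p` and `p + 1`. -/
def insertArc (p : ℕ) (g : ℕ → ℕ) (i : ℕ) : ℕ :=
  if i = p then p + 1 else if i = p + 1 then p else skipTwo p (g (unskipTwo p i))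

theorem insertArc_skipTwo (p : ℕ) (g : ℕ → ℕ) (i : ℕ) :
    insertArc p g (skipTwo p i) = skipTwo p (g i) := by
  have : unskipTwo p (skipTwo p i) = i := by grind [skipTwo, unskipTwo]
  rw [insertArc, this, if_neg (by grind [skipTwo]), if_neg (by grind [skipTwo])]

theorem eq_or_exists_skipTwo (p i : ℕ) : i = p ∨ i = p + 1 ∨ ∃ j, i = skipTwo p j := by
  by_cases h : i < p
  · exact .inr (.inr ⟨i, by simp [skipTwo, h]⟩)
  · by_cases h' : i < p + 2
    · omega
    · exact .inr (.inr ⟨i - 2, by grind [skipTwo]⟩)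

theorem skipTwo_lt_skipTwo {p i j : ℕ} : skipTwo p i < skipTwo p j ↔ i < j := by
  grind [skipTwo]

theorem skipTwo_inj {p i j : ℕ} : skipTwo p i = skipTwo p j ↔ i = j := by
  grind [skipTwo]

theorem insertArc_injective (p : ℕ) : Function.Injective (insertArc p) := by
  intro f g h
  ext i
  have := congrFun h (skipTwo p i)
  rwa [insertArc_skipTwo, insertArc_skipTwo, skipTwo_inj] at this

theorem isNatMatching_insertArc {p m : ℕ} (hp : p ≤ m) {g : ℕ → ℕ} :
    IsNatMatching (m + 2) (insertArc p g) ↔ IsNatMatching m g := by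
  have e₀ : insertArc p g p = p + 1 := by simp [insertArc]
  have e₁ : insertArc p g (p + 1) = p := by simp [insertArc]
  have e₂ := insertArc_skipTwo p g
  have hm : ∀ i, skipTwo p i < m + 2 ↔ i < m := by intro i; grind [skipTwo]
  constructor
  · intro hf
    refine ⟨fun i hi => ?_, fun i hi => ?_, fun i => ?_, fun i hi h => ?_, fun a b h₁ h₂ h₃ => ?_⟩
    · have := hf.fix (skipTwo p i) (by have := hm i; omega)
      rwa [e₂, skipTwo_inj] at this
    · have := hf.lt (skipTwo p i) ((hm i).2 hi)
      rwa [e₂, hm] at this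
    · have := hf.invol (skipTwo p i)
      rwa [e₂, e₂, skipTwo_inj] at this
    · exact hf.ne (skipTwo p i) ((hm i).2 hi) (by rw [e₂, h])
    · exact hf.noncrossing (skipTwo p a) (skipTwo p b) (skipTwo_lt_skipTwo.2 h₁)
        (by rwa [e₂, skipTwo_lt_skipTwo]) (by rwa [e₂, e₂, skipTwo_lt_skipTwo])
  · intro hg
    refine ⟨fun i hi => ?_, fun i hi => ?_, fun i => ?_, fun i hi h => ?_, fun a b h₁ h₂ h₃ => ?_⟩
    · rcases eq_or_exists_skipTwo p i with rfl | rfl | ⟨j, rfl⟩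
      · omega
      · omega
      · rw [e₂, hg.fix j (by have := hm j; omega)]
    · rcases eq_or_exists_skipTwo p i with rfl | rfl | ⟨j, rfl⟩
      · omega
      · omega
      · rw [e₂, hm]
        exact hg.lt j ((hm j).1 hi)
    · rcases eq_or_exists_skipTwo p i with rfl | rfl | ⟨j, rfl⟩
      · rw [e₀, e₁]
      · rw [e₁, e₀]
      · rw [e₂, e₂, hg.invol]
    · rcases eq_or_exists_skipTwo p i with rfl | rfl | ⟨j, rfl⟩
      · omega
      · omega
      · rw [e₂, skipTwo_inj] at h
        exact hg.ne j ((hm j).1 hi) h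
    · rcases eq_or_exists_skipTwo p a with rfl | rfl | ⟨a, rfl⟩
      · omega
      · omega
      · rcases eq_or_exists_skipTwo p b with rfl | rfl | ⟨b, rfl⟩
        · rw [e₀, e₂] at h₃
          rw [e₂] at h₂
          grind [skipTwo]
        · rw [e₁] at h₃
          omega
        · rw [e₂] at h₂
          rw [e₂, e₂] at h₃
          rw [skipTwo_lt_skipTwo] at h₁ h₂ h₃
          exact hg.noncrossing a b h₁ h₂ h₃

theorem blockFree_insertArc {p : ℕ} {g : ℕ → ℕ} (N : List ℕ) {o : ℕ} (ho : p ≤ o) :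
    BlockFree (o + 2) N (insertArc p g) ↔ BlockFree o N g := by
  induction N generalizing o with
  | nil => simp [BlockFree]
  | cons n N ih =>
    rw [BlockFree, BlockFree, show o + 2 + n = o + n + 2 by omega, ih (by omega)]
    refine and_congr_left fun _ => ⟨fun h i h₁ h₂ h₃ h₄ => ?_, fun h i h₁ h₂ h₃ h₄ => ?_⟩
    · have := h (skipTwo p i)
      rw [insertArc_skipTwo] at this
      grind [skipTwo]
    · rcases eq_or_exists_skipTwo p i with rfl | rfl | ⟨j, rfl⟩
      · omega
      · omega
      · rw [insertArc_skipTwo] at h₃ h₄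
        have := h j
        grind [skipTwo]

theorem insertArc_mem_natClaspedBasis {p q : ℕ} {N : List ℕ} {g : ℕ → ℕ} :
    insertArc p g ∈ natClaspedBasis ((p + 1) :: (q + 1) :: N) ↔
      g ∈ natClaspedBasis (p :: q :: N) := by
  have hs : ((p + 1) :: (q + 1) :: N).sum = (p :: q :: N).sum + 2 := by simp; omega
  have e₀ : insertArc p g p = p + 1 := by simp [insertArc]
  have e₁ : insertArc p g (p + 1) = p := by simp [insertArc]
  simp only [natClaspedBasis, Set.mem_ofPred_eq]
  rw [hs, isNatMatching_insertArc (by simp)]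
  simp only [BlockFree]
  rw [show 0 + (p + 1) + (q + 1) = 0 + p + q + 2 by omega, blockFree_insertArc N (by omega)]
  refine and_congr_right fun hg => and_congr ?_ (and_congr_left fun _ => ?_)
  · constructor
    · intro h i h₁ h₂ h₃ h₄
      have := h (skipTwo p i)
      rw [insertArc_skipTwo] at this
      grind [skipTwo]
    · intro h i h₁ h₂ h₃ h₄
      rcases eq_or_exists_skipTwo p i with rfl | rfl | ⟨j, rfl⟩
      · omega
      · omega
      · rw [insertArc_skipTwo] at h₃ h₄
        have := h j
        grind [skipTwo]
  · constructor
    · intro h i h₁ h₂ h₃ h₄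
      have := h (skipTwo p i)
      rw [insertArc_skipTwo] at this
      grind [skipTwo]
    · intro h i h₁ h₂ h₃ h₄
      rcases eq_or_exists_skipTwo p i with rfl | rfl | ⟨j, rfl⟩
      · omega
      · omega
      · rw [insertArc_skipTwo] at h₃ h₄
        have := h j
        grind [skipTwo]

theorem exists_insertArc {m p : ℕ} {f : ℕ → ℕ} (hf : IsNatMatching m f) (h : f p = p + 1) :
    ∃ g, insertArc p g = f := by
  have h' : f (p + 1) = p := by rw [← h, hf.invol]
  refine ⟨fun i => unskipTwo p (f (skipTwo p i)), funext fun i => ?_⟩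
  rcases eq_or_exists_skipTwo p i with rfl | rfl | ⟨j, rfl⟩
  · simp [insertArc, h]
  · simp [insertArc, h']
  · rw [insertArc_skipTwo]
    have e := hf.invol (skipTwo p j)
    rcases eq_or_exists_skipTwo p (f (skipTwo p j)) with h₁ | h₁ | ⟨k, h₁⟩
    · rw [h₁] at e
      grind [skipTwo]
    · rw [h₁] at e
      grind [skipTwo]
    · rw [h₁]
      grind [skipTwo, unskipTwo]

theorem ncard_natClaspedBasis_succ_succ (p q : ℕ) (N : List ℕ) :
    (natClaspedBasis ((p + 1) :: (q + 1) :: N)).ncard =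
      (natClaspedBasis (p :: q :: N)).ncard + (natClaspedBasis ((p + 1 + (q + 1)) :: N)).ncard := by
  have h : natClaspedBasis ((p + 1) :: (q + 1) :: N) ∩ {f | f p = p + 1} =
      insertArc p '' natClaspedBasis (p :: q :: N) := by
    ext f
    constructor
    · rintro ⟨hf, hp⟩
      obtain ⟨g, rfl⟩ := exists_insertArc hf.1 hp
      exact ⟨g, insertArc_mem_natClaspedBasis.1 hf, rfl⟩
    · rintro ⟨g, hg, rfl⟩
      exact ⟨insertArc_mem_natClaspedBasis.2 hg, by simp [insertArc]⟩
  rw [← Set.ncard_inter_add_ncard_sdiff_eq_ncard _ {f | f p = p + 1} (finite_natClaspedBasis _),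
    natClaspedBasis_merge, h, Set.ncard_image_of_injective _ (insertArc_injective p)]

/-- The number of tuples `m` with `m i ≤ N i` and `∑ i, (N i - 2 * m i) = t`. -/
def weightCount : List ℕ → ℤ → ℕ
  | [], t => if t = 0 then 1 else 0
  | n :: N, t => ∑ a ∈ Finset.range (n + 1), weightCount N (t - n + 2 * a)

theorem sum_range_sum_range_add (G : ℕ → ℕ) (p q : ℕ) :
    ∑ a ∈ Finset.range (p + 2), ∑ b ∈ Finset.range (q + 2), G (a + b) =
      ∑ a ∈ Finset.range (p + 1), ∑ b ∈ Finset.range (q + 1), G (a + b + 1) +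
        ∑ c ∈ Finset.range (q + 2 + (p + 1)), G c := by
  have h : ∀ a, ∑ b ∈ Finset.range (q + 2), G (a + 1 + b) =
      ∑ b ∈ Finset.range (q + 1), G (a + b + 1) + G (q + 2 + a) := by
    intro a
    rw [Finset.sum_range_succ, show a + 1 + (q + 1) = q + 2 + a by omega]
    exact congrArg (· + _) (Finset.sum_congr rfl fun b _ => congrArg G (by omega))
  rw [Finset.sum_range_succ' _ (p + 1), Finset.sum_range_add _ (q + 2) (p + 1),
    Finset.sum_congr rfl fun a _ => h a, Finset.sum_add_distrib]
  simp only [zero_add]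
  ring

theorem weightCount_succ_succ (p q : ℕ) (N : List ℕ) (t : ℤ) :
    weightCount ((p + 1) :: (q + 1) :: N) t =
      weightCount (p :: q :: N) t + weightCount ((p + 1 + (q + 1)) :: N) t := by
  have h := sum_range_sum_range_add
    (fun c => weightCount N (t - (p + 1 + (q + 1) : ℕ) + 2 * (c : ℤ))) p q
  simp only [weightCount]
  convert h using 1
  · refine Finset.sum_congr rfl fun a _ => Finset.sum_congr rfl fun b _ => congrArg _ ?_
    push_cast
    ring
  · congr 1
    · refine Finset.sum_congr rfl fun a _ => Finset.sum_congr rfl fun b _ => congrArg _ ?_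
      push_cast
      ring
    · exact Finset.sum_congr (congrArg _ (by omega)) fun _ _ => rfl

theorem weightCount_zero_cons (N : List ℕ) (t : ℤ) :
    weightCount (0 :: N) t = weightCount N t := by
  simp [weightCount]

theorem weightCount_cons_zero_cons (n : ℕ) (N : List ℕ) (t : ℤ) :
    weightCount (n :: 0 :: N) t = weightCount (n :: N) t := by
  simp [weightCount]

theorem weightCount_singleton_succ (n : ℕ) :
    weightCount [n + 1] 0 = weightCount [n + 1] 2 := by
  simp only [weightCount.eq_2 _ (n + 1)]
  rw [Finset.sum_range_succ', Finset.sum_range_succ _ (n + 1)]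
  congr 1
  · refine Finset.sum_congr rfl fun a _ => congrArg _ ?_
    push_cast
    ring
  · rw [weightCount, weightCount, if_neg (by push_cast; omega), if_neg (by push_cast; omega)]

theorem ncard_natClaspedBasis_add (N : List ℕ) :
    (natClaspedBasis N).ncard + weightCount N 2 = weightCount N 0 := by
  rcases N with _ | ⟨n, N⟩
  · rw [ncard_natClaspedBasis_nil]
    simp [weightCount]
  · induction N generalizing n with
    | nil =>
      cases n with
      | zero =>
        rw [natClaspedBasis_zero_cons, ncard_natClaspedBasis_nil]
        simp [weightCount]
      | succ n => rw [natClaspedBasis_singleton_succ, weightCount_singleton_succ]; simp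
    | cons q N ih =>
      induction n generalizing q with
      | zero =>
        rw [natClaspedBasis_zero_cons, weightCount_zero_cons, weightCount_zero_cons]
        exact ih q
      | succ p ihp =>
        cases q with
        | zero =>
          rw [natClaspedBasis_cons_zero_cons, weightCount_cons_zero_cons,
            weightCount_cons_zero_cons]
          exact ih (p + 1)
        | succ q =>
          rw [ncard_natClaspedBasis_succ_succ, weightCount_succ_succ, weightCount_succ_succ,
            ← ihp q, ← ih (p + 1 + (q + 1))]
          ring

theorem card_weight_eq_weightCount (N : List ℕ) (t : ℤ) :
    Nat.card {m : ∀ i : Fin N.length, Fin (N.get i + 1) //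
      ∑ i, ((N.get i : ℤ) - 2 * (m i : ℕ)) = t} = weightCount N t := by
  induction N generalizing t with
  | nil =>
    rw [weightCount]
    split_ifs with h
    · subst h
      rw [Nat.card_eq_one_iff_unique]
      refine ⟨⟨fun a b => Subtype.ext (funext fun i => i.elim0)⟩, ⟨⟨fun i => i.elim0, by simp⟩⟩⟩
    · have : IsEmpty {m : ∀ i : Fin ([] : List ℕ).length, Fin (([] : List ℕ).get i + 1) //
        ∑ i, ((([] : List ℕ).get i : ℤ) - 2 * (m i : ℕ)) = t} :=
        ⟨fun m => h (by simpa using m.2.symm)⟩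
      exact Nat.card_of_isEmpty
  | cons n N ih =>
    rw [weightCount, Finset.sum_range]
    simp_rw [← ih]
    rw [← Nat.card_sigma]
    have key : ∀ m : ∀ i : Fin (N.length + 1), Fin ((n :: N).get i + 1),
        ∑ i : Fin (N.length + 1), (((n :: N).get i : ℤ) - 2 * (m i : ℕ)) =
          (n - 2 * (m 0 : ℕ)) + ∑ i : Fin N.length, ((N.get i : ℤ) - 2 * (m i.succ : ℕ)) :=
      fun m => Fin.sum_univ_succ _
    refine Nat.card_congr
      ⟨fun m => ⟨m.1 0, fun i => m.1 i.succ, ?_⟩, fun m => ⟨Fin.cons m.1 m.2.1, ?_⟩, ?_, ?_⟩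
    · have h₁ := key m.1
      have h₂ := m.2
      dsimp only [List.length_cons] at h₁ h₂ ⊢
      linarith
    · have h₁ := m.2.2
      refine (key _).trans ?_
      change ((n : ℤ) - 2 * (m.1 : ℕ)) +
        ∑ i : Fin N.length, ((N.get i : ℤ) - 2 * (m.2.1 i : ℕ)) = t
      linarith
    · intro m
      exact Subtype.ext (Fin.cons_self_tail m.1)
    · intro m
      rfl

section SlTwoTriple

variable {W : Type*} [AddCommGroup W] [Module ℂ W]

theorem eq_zero_of_lowering_raising_eq_neg {E F H : Module.End ℂ W} {M : ℤ}
    (hEF : ∀ v, E (F v) - F (E v) = H v) (hHE : ∀ v, H (E v) - E (H v) = (2 : ℂ) • E v)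
    (hM : ∀ (s : ℤ) v, M < s → H v = (s : ℂ) • v → v = 0)
    {s c : ℤ} (hs : 0 < s) (hc : 0 < c) {v : W} (hv : H v = (s : ℂ) • v)
    (hFE : F (E v) = -(c : ℂ) • v) : v = 0 := by
  obtain ⟨d, hd⟩ : ∃ d : ℕ, M < s + d := ⟨(M - s).toNat + 1, by omega⟩
  induction d generalizing s c v with
  | zero => exact hM s v (by simpa using hd) hv
  | succ d ih =>
    have hHEv : H (E v) = ((s + 2 : ℤ) : ℂ) • E v := by
      rw [eq_add_of_sub_eq (hHE v), hv, map_smul]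
      push_cast
      module
    have hEv : E v = 0 := by
      refine ih (s := s + 2) (c := c + s + 2) (by omega) (by omega) hHEv ?_
        (by push_cast at hd; omega)
      have h := hEF (E v)
      rw [hFE, map_smul, hHEv, sub_eq_iff_eq_add] at h
      rw [eq_sub_of_add_eq' h.symm]
      push_cast
      module
    rw [hEv, map_zero, eq_comm, smul_eq_zero] at hFE
    exact hFE.resolve_left (by simpa using hc.ne')

variable {E F H : Module.End ℂ W} {M : ℤ}

theorem lowering_eq_zero_of_raising_eq_zero (hEF : ∀ v, E (F v) - F (E v) = H v)
    (hHF : ∀ v, H (F v) - F (H v) = (-2 : ℂ) • F v)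
    (hM : ∀ (s : ℤ) v, M < |s| → H v = (s : ℂ) • v → v = 0) {v : W}
    (hv : H v = 0) (hE : E v = 0) : F v = 0 := by
  refine eq_zero_of_lowering_raising_eq_neg (E := F) (F := E) (H := -H) (M := M) (s := 2) (c := 2)
    (fun w => ?_) (fun w => ?_) (fun s w hs hw => ?_) (by omega) (by omega) ?_ ?_
  · rw [LinearMap.neg_apply, ← hEF]
    abel
  · have := hHF w
    rw [LinearMap.neg_apply, LinearMap.neg_apply, map_neg, sub_neg_eq_add, neg_add_eq_sub,
      ← neg_sub, this]
    module
  · refine hM (-s) w (by rw [abs_neg]; exact hs.trans_le (le_abs_self s)) ?_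
    rw [LinearMap.neg_apply, neg_eq_iff_eq_neg] at hw
    rw [hw]
    push_cast
    module
  · rw [LinearMap.neg_apply, eq_add_of_sub_eq (hHF v), hv]
    simp
  · have h : E (F v) = 0 := by
      rw [eq_add_of_sub_eq (hEF v), hv, hE]
      simp
    rw [eq_add_of_sub_eq (hEF (F v)), h, eq_add_of_sub_eq (hHF v), hv]
    simp

theorem finrank_highest_weight_zero_add [FiniteDimensional ℂ W]
    (hEF : ∀ v, E (F v) - F (E v) = H v)
    (hHE : ∀ v, H (E v) - E (H v) = (2 : ℂ) • E v)
    (hHF : ∀ v, H (F v) - F (H v) = (-2 : ℂ) • F v)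
    (hM : ∀ (s : ℤ) v, M < |s| → H v = (s : ℂ) • v → v = 0) :
    Module.finrank ℂ ↥(H.eigenspace 0 ⊓ LinearMap.ker E) + Module.finrank ℂ (H.eigenspace 2) =
      Module.finrank ℂ (H.eigenspace 0) := by
  have hE : ∀ v ∈ H.eigenspace 0, E v ∈ H.eigenspace 2 := by
    intro v hv
    rw [Module.End.mem_eigenspace_iff] at hv ⊢
    rw [eq_add_of_sub_eq (hHE v), hv]
    simp
  have hF : ∀ v ∈ H.eigenspace 2, F v ∈ H.eigenspace 0 := by
    intro v hv
    rw [Module.End.mem_eigenspace_iff] at hv ⊢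
    rw [eq_add_of_sub_eq (hHF v), hv, map_smul]
    module
  let e := E.restrict hE
  let f := F.restrict hF
  have hinj : Function.Injective (e ∘ₗ f) := by
    rw [← LinearMap.ker_eq_bot, LinearMap.ker_eq_bot']
    rintro ⟨v, hv⟩ h
    have h : E (F v) = 0 := congrArg Subtype.val h
    rw [Module.End.mem_eigenspace_iff] at hv
    refine Subtype.ext (eq_zero_of_lowering_raising_eq_neg (M := M) hEF hHE
      (fun s w hs => hM s w (hs.trans_le (le_abs_self s))) (s := 2) (c := 2) (by omega) (by omega)
      (by simpa using hv) ?_)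
    have h' := hEF v
    rw [h, hv, zero_sub, neg_eq_iff_eq_neg] at h'
    rw [h']
    push_cast
    module
  have hsurj : Function.Surjective e := by
    have := LinearMap.surjective_of_injective hinj
    rw [LinearMap.coe_comp] at this
    exact this.of_comp
  have hker : LinearMap.ker e =
      (H.eigenspace 0 ⊓ LinearMap.ker E).submoduleOf (H.eigenspace 0) := by
    ext ⟨v, hv⟩
    simp [Submodule.submoduleOf, e, Subtype.ext_iff]
  have hrank := LinearMap.finrank_range_add_finrank_ker e
  rw [LinearMap.range_eq_top.2 hsurj, finrank_top, hker,
    (Submodule.submoduleOfEquivOfLe inf_le_left).finrank_eq] at hrank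
  omega

end SlTwoTriple

section Multilinear

variable {ι : Type*} [Fintype ι] [DecidableEq ι] {V : ι → Type*} [∀ i, AddCommGroup (V i)]
  [∀ i, Module ℂ (V i)]

/-- The Leibniz extension of endomorphisms `D i` of the factors to multilinear forms:
`p ↦ ∑ i, T (p₁, …, D i pᵢ, …, pₖ)`. -/
noncomputable def leibnizExtension (D : ∀ i, Module.End ℂ (V i)) :
    Module.End ℂ (MultilinearMap ℂ V ℂ) :=
  ∑ i, MultilinearMap.compLinearMapₗ (Function.update (fun _ => LinearMap.id) i (D i))

theorem leibnizExtension_apply (D : ∀ i, Module.End ℂ (V i)) (T : MultilinearMap ℂ V ℂ)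
    (p : ∀ i, V i) :
    leibnizExtension D T p = ∑ i, T (Function.update p i (D i (p i))) := by
  simp only [leibnizExtension, LinearMap.sum_apply, sum_apply,
    MultilinearMap.compLinearMapₗ_apply, MultilinearMap.compLinearMap_apply]
  refine Finset.sum_congr rfl fun i _ => congrArg T (funext fun j => ?_)
  rcases eq_or_ne j i with rfl | h
  · simp
  · simp [h]

theorem leibnizExtension_commutator (D D' : ∀ i, Module.End ℂ (V i)) (T : MultilinearMap ℂ V ℂ) :
    leibnizExtension D (leibnizExtension D' T) - leibnizExtension D' (leibnizExtension D T) =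
      leibnizExtension (fun i => D' i * D i - D i * D' i) T := by
  ext p
  rw [sub_apply]
  have h : ∀ D D' : ∀ i, Module.End ℂ (V i), leibnizExtension D (leibnizExtension D' T) p =
      ∑ i, ∑ j, T (Function.update (Function.update p i (D i (p i))) j
        (D' j (Function.update p i (D i (p i)) j))) := by
    intro D D'
    rw [leibnizExtension_apply]
    exact Finset.sum_congr rfl fun i _ => leibnizExtension_apply _ _ _
  rw [h, h, leibnizExtension_apply, sub_eq_iff_eq_add', Finset.sum_comm,
    ← sub_eq_iff_eq_add', ← Finset.sum_sub_distrib]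
  refine Finset.sum_congr rfl fun i _ => ?_
  rw [← Finset.sum_sub_distrib, Finset.sum_eq_single i]
  · simp [MultilinearMap.map_update_sub]
  · intro j _ hj
    rw [Function.update_of_ne hj.symm, Function.update_of_ne hj, Function.update_comm hj, sub_self]
  · simp

theorem leibnizExtension_smul (c : ℂ) (D : ∀ i, Module.End ℂ (V i)) (T : MultilinearMap ℂ V ℂ) :
    leibnizExtension (fun i => c • D i) T = c • leibnizExtension D T := by
  ext p
  simp [leibnizExtension_apply, Finset.mul_sum]

variable {κ : ι → Type*} (b : ∀ i, Module.Basis (κ i) ℂ (V i))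

variable {H : ∀ i, Module.End ℂ (V i)} {w : ∀ i, κ i → ℤ}

theorem leibnizExtension_apply_basis (hH : ∀ i j, H i (b i j) = (w i j : ℂ) • b i j)
    (T : MultilinearMap ℂ V ℂ) (m : ∀ i, κ i) :
    leibnizExtension H T (fun i => b i (m i)) =
      ((∑ i, w i (m i) : ℤ) : ℂ) * T fun i => b i (m i) := by
  rw [leibnizExtension_apply]
  push_cast
  rw [Finset.sum_mul]
  refine Finset.sum_congr rfl fun i _ => ?_
  rw [hH, MultilinearMap.map_update_smul, Function.update_eq_self, smul_eq_mul]

theorem leibnizExtension_eq_smul_iff (hH : ∀ i j, H i (b i j) = (w i j : ℂ) • b i j)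
    (T : MultilinearMap ℂ V ℂ) (s : ℤ) :
    leibnizExtension H T = (s : ℂ) • T ↔
      ∀ m : ∀ i, κ i, ∑ i, w i (m i) ≠ s → T (fun i => b i (m i)) = 0 := by
  constructor
  · intro h m hm
    have := leibnizExtension_apply_basis b hH T m
    rw [h, smul_apply, smul_eq_mul] at this
    rcases mul_eq_mul_right_iff.1 this with h' | h'
    · exact absurd (by exact_mod_cast h'.symm) hm
    · exact h'
  · intro h
    refine Module.Basis.ext_multilinear b fun m => ?_
    rw [leibnizExtension_apply_basis b hH, smul_apply, smul_eq_mul]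
    rcases eq_or_ne (∑ i, w i (m i)) s with h' | h'
    · rw [h']
    · rw [h m h', mul_zero, mul_zero]

variable [∀ i, Fintype (κ i)]

theorem finrank_eigenspace_leibnizExtension
    (hH : ∀ i j, H i (b i j) = (w i j : ℂ) • b i j) (s : ℤ) :
    Module.finrank ℂ ((leibnizExtension H).eigenspace (s : ℂ)) =
      Nat.card {m : ∀ i, κ i // ∑ i, w i (m i) = s} := by
  classical
  let φ : (leibnizExtension H).eigenspace (s : ℂ) →ₗ[ℂ]
      ({m : ∀ i, κ i // ∑ i, w i (m i) = s} → ℂ) :=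
    { toFun := fun T m => T.1 fun i => b i (m.1 i)
      map_add' := fun _ _ => rfl
      map_smul' := fun _ _ => rfl }
  have hφ : Function.Bijective φ := by
    constructor
    · rw [← LinearMap.ker_eq_bot, LinearMap.ker_eq_bot']
      rintro ⟨T, hT⟩ h
      refine Subtype.ext (Module.Basis.ext_multilinear b fun m => ?_)
      rcases eq_or_ne (∑ i, w i (m i)) s with h' | h'
      · exact congrFun h ⟨m, h'⟩
      · rw [Module.End.mem_eigenspace_iff, leibnizExtension_eq_smul_iff b hH] at hT
        exact hT m h'
    · intro x
      let S : (∀ i, κ i) → MultilinearMap ℂ V ℂ := fun m =>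
        (MultilinearMap.mkPiRing ℂ ι 1).compLinearMap fun i => (b i).coord (m i)
      have hS : ∀ m m', S m (fun i => b i (m' i)) = if m' = m then 1 else 0 := by
        intro m m'
        simp only [S, MultilinearMap.compLinearMap_apply, MultilinearMap.mkPiRing_apply,
          Module.Basis.coord_apply, Module.Basis.repr_self, smul_eq_mul, mul_one]
        split_ifs with h
        · subst h; simp
        · obtain ⟨i, hi⟩ := Function.ne_iff.1 h
          exact Finset.prod_eq_zero (Finset.mem_univ i) (by simp [hi])
      have hsum : ∀ m', (∑ m, x m • S m.1) (fun i => b i (m' i)) =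
          if h : ∑ i, w i (m' i) = s then x ⟨m', h⟩ else 0 := by
        intro m'
        rw [sum_apply]
        simp only [smul_apply, hS]
        split_ifs with h
        · rw [Finset.sum_eq_single ⟨m', h⟩]
          · simp
          · intro m _ hm
            rw [if_neg fun e => hm (Subtype.ext e.symm), smul_zero]
          · simp
        · exact Finset.sum_eq_zero fun m _ => by
            rw [if_neg fun e : m' = m.1 => h (by rw [e, m.2]), smul_zero]
      refine ⟨⟨∑ m, x m • S m.1, ?_⟩, ?_⟩
      · rw [Module.End.mem_eigenspace_iff, leibnizExtension_eq_smul_iff b hH]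
        intro m hm
        rw [hsum, dif_neg hm]
      · ext m
        exact (hsum m.1).trans (dif_pos m.2)
  rw [(LinearEquiv.ofBijective φ hφ).finrank_eq, Module.finrank_fintype_fun_eq_card,
    Nat.card_eq_fintype_card]

theorem multilinear_eq_sum_repr (T : MultilinearMap ℂ V ℂ) (p : ∀ i, V i) :
    T p = ∑ m : ∀ i, κ i, (∏ i, (b i).repr (p i) (m i)) * T fun i => b i (m i) := by
  conv_lhs => rw [show p = fun i => ∑ j, (b i).repr (p i) j • b i j from
    funext fun i => ((b i).sum_repr (p i)).symm]
  rw [MultilinearMap.map_sum]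
  simp only [MultilinearMap.map_smul_univ, smul_eq_mul]

theorem hasDerivAt_multilinear (T : MultilinearMap ℂ V ℂ) {p : ℂ → ∀ i, V i} {p' : ∀ i, V i} {t : ℂ}
    (h : ∀ i j, HasDerivAt (fun s => (b i).repr (p s i) j) ((b i).repr (p' i) j) t) :
    HasDerivAt (fun s => T (p s)) (∑ i, T (Function.update (p t) i (p' i))) t := by
  rw [funext fun s => multilinear_eq_sum_repr b T (p s),
    Finset.sum_congr rfl fun i _ => multilinear_eq_sum_repr b T (Function.update (p t) i (p' i)),
    Finset.sum_comm]
  refine HasDerivAt.fun_sum fun m _ => ?_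
  rw [← Finset.sum_mul]
  refine HasDerivAt.mul_const ?_ _
  refine (HasDerivAt.fun_finsetProd fun i _ => h i (m i)).congr_deriv ?_
  refine Finset.sum_congr rfl fun i _ => ?_
  rw [← Finset.mul_prod_erase _ _ (Finset.mem_univ i), smul_eq_mul, mul_comm]
  congr 1
  · simp
  · refine Finset.prod_congr rfl fun j hj => ?_
    rw [Function.update_of_ne (Finset.ne_of_mem_erase hj)]

/-- Invariance under a one-parameter family of substitutions is equivalent to being annihilated by
its infinitesimal generator. -/
theorem invariant_iff_leibnizExtension_eq_zero (T : MultilinearMap ℂ V ℂ)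
    {A : ℂ → ∀ i, Module.End ℂ (V i)} {D : ∀ i, Module.End ℂ (V i)} (hA : ∀ i, A 0 i = 1)
    (h : ∀ i j (p : V i) t,
      HasDerivAt (fun s => (b i).repr (A s i p) j) ((b i).repr (D i (A t i p)) j) t) :
    (∀ (t : ℂ) (p : ∀ i, V i), T (fun i => A t i (p i)) = T p) ↔ leibnizExtension D T = 0 := by
  have key : ∀ (p : ∀ i, V i) t, HasDerivAt (fun s => T (fun i => A s i (p i)))
      (leibnizExtension D T (fun i => A t i (p i))) t := by
    intro p t
    rw [leibnizExtension_apply]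
    exact hasDerivAt_multilinear b T fun i j => h i j (p i) t
  constructor
  · intro hT
    ext p
    have h₀ := key p 0
    simp only [hT, hA, Module.End.one_apply] at h₀
    exact h₀.unique (hasDerivAt_const _ _)
  · intro hT t p
    simp only [hT, zero_apply] at key
    have h₀ := is_const_of_deriv_eq_zero (fun t => (key p t).differentiableAt)
      (fun t => (key p t).deriv) t 0
    simpa [hA] using h₀

end Multilinear

section BinaryForms

open MvPolynomial Matrix.SpecialLinearGroup

/-- The space of binary forms of degree `n`. -/
noncomputable abbrev BinaryForm (n : ℕ) : Submodule ℂ (MvPolynomial (Fin 2) ℂ) :=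
  homogeneousSubmodule (Fin 2) ℂ n

/-- The exponent of the monomial `X ^ (n - j) * Y ^ j`. -/
noncomputable def formExponent (n : ℕ) (j : Fin (n + 1)) : Fin 2 →₀ ℕ :=
  Finsupp.single 0 (n - j) + Finsupp.single 1 (j : ℕ)

@[simp] theorem formExponent_zero (n : ℕ) (j : Fin (n + 1)) : formExponent n j 0 = n - j := by
  simp [formExponent]

@[simp] theorem formExponent_one (n : ℕ) (j : Fin (n + 1)) : formExponent n j 1 = j := by
  simp [formExponent]

theorem formExponent_eq_iff {n : ℕ} {j : Fin (n + 1)} {d : Fin 2 →₀ ℕ} (hd : d.degree = n) :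
    formExponent n j = d ↔ j = ⟨d 1, by rw [← hd, Finsupp.degree_eq_sum]; simp⟩ := by
  rw [Finsupp.degree_eq_sum, Fin.sum_univ_two] at hd
  have := j.2
  rw [Finsupp.ext_iff, Fin.forall_fin_two, formExponent_zero, formExponent_one, Fin.ext_iff]
  simp only
  omega

theorem degree_formExponent (n : ℕ) (j : Fin (n + 1)) : (formExponent n j).degree = n := by
  rw [Finsupp.degree_eq_sum, Fin.sum_univ_two, formExponent_zero, formExponent_one]
  have := j.2
  omega

/-- Coordinates of binary forms with respect to the monomials. -/
noncomputable def binaryFormEquiv (n : ℕ) : BinaryForm n ≃ₗ[ℂ] (Fin (n + 1) → ℂ) where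
  toFun p j := coeff (formExponent n j) (p : MvPolynomial (Fin 2) ℂ)
  map_add' _ _ := by ext; simp
  map_smul' _ _ := by ext; simp
  invFun c := ⟨∑ j, monomial (formExponent n j) (c j), Submodule.sum_mem _ fun j _ =>
    isHomogeneous_monomial _ (degree_formExponent n j)⟩
  left_inv p := by
    refine Subtype.ext (MvPolynomial.ext _ _ fun d => ?_)
    rw [coeff_sum]
    simp only [coeff_monomial]
    by_cases hd : d.degree = n
    · simp only [formExponent_eq_iff hd]
      rw [Finset.sum_ite_eq' Finset.univ, if_pos (Finset.mem_univ _)]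
      exact congrArg (coeff · _) ((formExponent_eq_iff hd).2 rfl)
    · rw [((mem_homogeneousSubmodule _ _).1 p.2).coeff_eq_zero hd]
      refine Finset.sum_eq_zero fun j _ => if_neg ?_
      rintro rfl
      exact hd (degree_formExponent n j)
  right_inv c := by
    ext k
    simp only [coeff_sum, coeff_monomial]
    rw [Finset.sum_eq_single k]
    · simp
    · intro j _ hj
      refine if_neg fun h => hj (Fin.ext ?_)
      simpa using DFunLike.congr_fun h 1
    · simp

/-- The monomial basis of the space of binary forms. -/
noncomputable def binaryFormBasis (n : ℕ) : Module.Basis (Fin (n + 1)) ℂ (BinaryForm n) :=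
  .ofEquivFun (binaryFormEquiv n)

theorem coe_binaryFormBasis (n : ℕ) (j : Fin (n + 1)) :
    (binaryFormBasis n j : MvPolynomial (Fin 2) ℂ) = monomial (formExponent n j) 1 := by
  rw [binaryFormBasis, Module.Basis.coe_ofEquivFun]
  change ∑ k, monomial (formExponent n k) (Pi.single (M := fun _ => ℂ) j 1 k) = _
  rw [Finset.sum_eq_single j]
  · simp
  · intro k _ hk
    simp [hk]
  · simp

/-- The polarization `X j * ∂/∂X i`. -/
noncomputable def polarization (i j : Fin 2) :
    Derivation ℂ (MvPolynomial (Fin 2) ℂ) (MvPolynomial (Fin 2) ℂ) :=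
  (X j : MvPolynomial (Fin 2) ℂ) • pderiv i

theorem polarization_apply (i j : Fin 2) (p : MvPolynomial (Fin 2) ℂ) :
    polarization i j p = X j * pderiv i p :=
  rfl

theorem polarization_X (i j k : Fin 2) :
    polarization i j (X k) = if k = i then X j else 0 := by
  rw [polarization_apply, pderiv_X]
  split_ifs with h
  · subst h; simp
  · simp [h]

theorem polarization_mem {n : ℕ} (i j : Fin 2) {p : MvPolynomial (Fin 2) ℂ}
    (hp : p ∈ BinaryForm n) : polarization i j p ∈ BinaryForm n := by
  rw [mem_homogeneousSubmodule] at hp ⊢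
  rw [polarization_apply]
  obtain _ | n := n
  · rw [← totalDegree_zero_iff_isHomogeneous, totalDegree_eq_zero_iff_eq_C] at hp
    rw [hp, pderiv_C, mul_zero]
    exact isHomogeneous_zero _ _ _
  · rw [add_comm]
    exact (isHomogeneous_X ℂ j).mul hp.pderiv

/-- The polarization `X j * ∂/∂X i` on binary forms. -/
noncomputable def formPolarization (n : ℕ) (i j : Fin 2) : Module.End ℂ (BinaryForm n) :=
  (polarization i j).toLinearMap.restrict fun _ => polarization_mem i j

theorem coe_formPolarization (n : ℕ) (i j : Fin 2) (p : BinaryForm n) :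
    (formPolarization n i j p : MvPolynomial (Fin 2) ℂ) = polarization i j p :=
  rfl

theorem formPolarization_commutator (n : ℕ) (i j k l : Fin 2) :
    formPolarization n i j * formPolarization n k l -
        formPolarization n k l * formPolarization n i j =
      (if l = i then formPolarization n k j else 0) -
        if j = k then formPolarization n i l else 0 := by
  have h : ⁅polarization i j, polarization k l⁆ =
      (if l = i then polarization k j else 0) - if j = k then polarization i l else 0 := by
    refine derivation_ext fun m => ?_
    rw [Derivation.commutator_apply, Derivation.sub_apply, polarization_X, polarization_X]
    simp only [apply_ite (polarization i j), apply_ite (polarization k l), polarization_X, map_zero]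
    congr 1
    · split_ifs <;> simp_all [polarization_X]
    · split_ifs <;> simp_all [polarization_X]
  ext p : 2
  have h' := congrArg (fun D : Derivation ℂ _ _ => D (p : MvPolynomial (Fin 2) ℂ)) h
  simp only [Derivation.commutator_apply, Derivation.sub_apply] at h'
  refine h'.trans ?_
  split_ifs <;> simp [coe_formPolarization]

theorem formPolarization_binaryFormBasis (n : ℕ) (i : Fin 2) (j : Fin (n + 1)) :
    formPolarization n i i (binaryFormBasis n j) =
      (formExponent n j i : ℂ) • binaryFormBasis n j := by
  ext1
  rw [coe_formPolarization, SetLike.val_smul, coe_binaryFormBasis, polarization_apply,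
    X_mul_pderiv_monomial, Nat.cast_smul_eq_nsmul]

theorem sl2Subst_X (g : Matrix.SpecialLinearGroup (Fin 2) ℂ) (i : Fin 2) :
    sl2Subst g (X i) = ∑ j, C ((g : Matrix (Fin 2) (Fin 2) ℂ) i j) * X j := by
  rw [sl2Subst, aeval_X]

theorem sl2Subst_mul (g h : Matrix.SpecialLinearGroup (Fin 2) ℂ) (p : MvPolynomial (Fin 2) ℂ) :
    sl2Subst (g * h) p = sl2Subst h (sl2Subst g p) := by
  have key : sl2Subst (g * h) = (sl2Subst h).comp (sl2Subst g) := by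
    refine MvPolynomial.algHom_ext fun i => ?_
    rw [AlgHom.comp_apply, sl2Subst_X, sl2Subst_X]
    simp only [Matrix.SpecialLinearGroup.coe_mul, Matrix.mul_apply, Fin.sum_univ_two, map_add,
      map_mul, sl2Subst_X, algHom_C, algebraMap_eq]
    ring
  exact DFunLike.congr_fun key p

theorem sl2Subst_one (p : MvPolynomial (Fin 2) ℂ) : sl2Subst 1 p = p := by
  have key : sl2Subst 1 = AlgHom.id ℂ _ := by
    refine MvPolynomial.algHom_ext fun i => ?_
    rw [AlgHom.id_apply, sl2Subst_X]
    fin_cases i <;> simp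
  exact DFunLike.congr_fun key p

theorem sl2Subst_mem {n : ℕ} (g : Matrix.SpecialLinearGroup (Fin 2) ℂ) {p : MvPolynomial (Fin 2) ℂ}
    (hp : p ∈ BinaryForm n) : sl2Subst g p ∈ BinaryForm n := by
  rw [mem_homogeneousSubmodule] at hp ⊢
  rw [← one_mul n]
  refine hp.aeval _ fun i => ?_
  exact IsHomogeneous.sum _ _ _ fun j _ => (isHomogeneous_X ℂ j).C_mul _

/-- The substitution action on binary forms. -/
noncomputable def formSubst (n : ℕ) (g : Matrix.SpecialLinearGroup (Fin 2) ℂ) :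
    Module.End ℂ (BinaryForm n) :=
  (sl2Subst g).toLinearMap.restrict fun _ => sl2Subst_mem g

theorem formSubst_mul (n : ℕ) (g h : Matrix.SpecialLinearGroup (Fin 2) ℂ) (p : BinaryForm n) :
    formSubst n (g * h) p = formSubst n h (formSubst n g p) :=
  Subtype.ext (sl2Subst_mul g h p)

theorem sl2Subst_transvection_X {i j : Fin 2} (hij : i ≠ j) (t : ℂ) (k : Fin 2) :
    sl2Subst (transvection hij t) (X k) = X k + C t * polarization i j (X k) := by
  rw [sl2Subst_X, polarization_X]
  change ∑ l, C (Matrix.transvection i j t k l) * X l = _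
  simp only [Matrix.transvection, Matrix.add_apply, map_add, add_mul, Finset.sum_add_distrib]
  congr 1
  · simp [Matrix.one_apply]
  · rw [Finset.sum_eq_single j]
    · split_ifs with h
      · subst h; simp
      · simp [Ne.symm h]
    · intro l _ hl
      simp [Ne.symm hl]
    · simp

theorem hasDerivAt_coeff_mul {P Q : ℂ → MvPolynomial (Fin 2) ℂ} {P' Q' : MvPolynomial (Fin 2) ℂ}
    {t : ℂ} (hP : ∀ d, HasDerivAt (fun s => coeff d (P s)) (coeff d P') t)
    (hQ : ∀ d, HasDerivAt (fun s => coeff d (Q s)) (coeff d Q') t) (d : Fin 2 →₀ ℕ) :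
    HasDerivAt (fun s => coeff d (P s * Q s)) (coeff d (P' * Q t + P t * Q')) t := by
  simp only [coeff_mul, coeff_add, ← Finset.sum_add_distrib]
  exact HasDerivAt.fun_sum fun x _ => (hP x.1).fun_mul (hQ x.2)

theorem hasDerivAt_coeff_sl2Subst_transvection {i j : Fin 2} (hij : i ≠ j)
    (p : MvPolynomial (Fin 2) ℂ) (t : ℂ) (d : Fin 2 →₀ ℕ) :
    HasDerivAt (fun s => coeff d (sl2Subst (transvection hij s) p))
      (coeff d (polarization i j (sl2Subst (transvection hij t) p))) t := by
  induction p using MvPolynomial.induction_on generalizing d with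
  | C a =>
    simp only [algHom_C, algebraMap_eq, derivation_C, coeff_zero]
    exact hasDerivAt_const _ _
  | add p q hp hq =>
    simp only [map_add, coeff_add]
    exact (hp d).fun_add (hq d)
  | mul_X p k hp =>
    simp only [map_mul]
    have hX : ∀ d, HasDerivAt (fun s => coeff d (sl2Subst (transvection hij s) (X k)))
        (coeff d (polarization i j (X k))) t := by
      intro d
      simp only [sl2Subst_transvection_X, coeff_add, coeff_C_mul]
      simpa using ((hasDerivAt_id t).mul_const (coeff d (polarization i j (X k)))).const_add
        (coeff d (X k))
    have h₂ : polarization i j (polarization i j (X k)) = 0 := by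
      rw [polarization_X]
      split_ifs with h
      · rw [polarization_X, if_neg hij.symm]
      · exact map_zero _
    refine (hasDerivAt_coeff_mul hp hX d).congr_deriv (congrArg _ ?_)
    rw [Derivation.leibniz, sl2Subst_transvection_X, map_add, Derivation.leibniz, h₂, derivation_C]
    simp only [smul_eq_mul]
    ring

end BinaryForms

section InvariantForms

open Matrix.SpecialLinearGroup

/-- The multilinear forms on the product of the spaces of binary forms of degrees `N`. -/
abbrev ClaspedForm (N : List ℕ) : Type :=
  MultilinearMap ℂ (fun i : Fin N.length => BinaryForm (N.get i)) ℂ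

/-- The action of the polarization `X j * ∂/∂X i` on multilinear forms. -/
noncomputable def polarizationOperator (N : List ℕ) (i j : Fin 2) : Module.End ℂ (ClaspedForm N) :=
  leibnizExtension fun a => formPolarization (N.get a) i j

/-- The weight operator on multilinear forms. -/
noncomputable def weightOperator (N : List ℕ) : Module.End ℂ (ClaspedForm N) :=
  leibnizExtension fun a => formPolarization (N.get a) 0 0 - formPolarization (N.get a) 1 1

instance (n : ℕ) : Module.Finite ℂ (BinaryForm n) :=
  .of_basis (binaryFormBasis n)

theorem polarizationOperator_commutator (N : List ℕ) (T : ClaspedForm N) :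
    polarizationOperator N 0 1 (polarizationOperator N 1 0 T) -
      polarizationOperator N 1 0 (polarizationOperator N 0 1 T) = weightOperator N T := by
  rw [polarizationOperator, polarizationOperator, leibnizExtension_commutator]
  simp only [formPolarization_commutator, if_true]
  rfl

theorem commutator_sub_right {R : Type*} [Ring R] (x a b : R) :
    x * (a - b) - (a - b) * x = (x * a - a * x) - (x * b - b * x) := by
  noncomm_ring

theorem weightOperator_commutator_raising (N : List ℕ) (T : ClaspedForm N) :
    weightOperator N (polarizationOperator N 0 1 T) -
      polarizationOperator N 0 1 (weightOperator N T) = (2 : ℂ) • polarizationOperator N 0 1 T := by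
  rw [polarizationOperator, weightOperator, leibnizExtension_commutator, ← leibnizExtension_smul]
  refine congrArg (fun D => leibnizExtension D T) (funext fun a => ?_)
  have h₀ := formPolarization_commutator (N.get a) 0 1 0 0
  have h₁ := formPolarization_commutator (N.get a) 0 1 1 1
  simp only [if_true, one_ne_zero, if_false] at h₀ h₁
  refine (commutator_sub_right (R := Module.End ℂ (BinaryForm (N.get a))) _ _ _).trans ?_
  rw [h₀, h₁]
  module

theorem weightOperator_commutator_lowering (N : List ℕ) (T : ClaspedForm N) :
    weightOperator N (polarizationOperator N 1 0 T) -
      polarizationOperator N 1 0 (weightOperator N T) =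
        (-2 : ℂ) • polarizationOperator N 1 0 T := by
  rw [polarizationOperator, weightOperator, leibnizExtension_commutator, ← leibnizExtension_smul]
  refine congrArg (fun D => leibnizExtension D T) (funext fun a => ?_)
  have h₀ := formPolarization_commutator (N.get a) 1 0 0 0
  have h₁ := formPolarization_commutator (N.get a) 1 0 1 1
  simp only [if_true, zero_ne_one, if_false] at h₀ h₁
  refine (commutator_sub_right (R := Module.End ℂ (BinaryForm (N.get a))) _ _ _).trans ?_
  rw [h₀, h₁]
  module

theorem weight_binaryFormBasis (n : ℕ) (j : Fin (n + 1)) :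
    (formPolarization n 0 0 - formPolarization n 1 1) (binaryFormBasis n j) =
      (((n : ℤ) - 2 * (j : ℕ) : ℤ) : ℂ) • binaryFormBasis n j := by
  rw [LinearMap.sub_apply, formPolarization_binaryFormBasis, formPolarization_binaryFormBasis,
    formExponent_zero, formExponent_one, Nat.cast_sub (Nat.le_of_lt_succ j.2)]
  push_cast
  module

theorem eq_zero_of_weight_lt (N : List ℕ) (s : ℤ) (T : ClaspedForm N)
    (hs : ∑ i : Fin N.length, (N.get i : ℤ) < |s|) (hT : weightOperator N T = (s : ℂ) • T) :
    T = 0 := by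
  rw [weightOperator, leibnizExtension_eq_smul_iff (fun a => binaryFormBasis (N.get a))
    fun a => weight_binaryFormBasis (N.get a)] at hT
  refine Module.Basis.ext_multilinear (fun a => binaryFormBasis (N.get a)) fun m => ?_
  rw [hT m, zero_apply]
  rintro rfl
  refine hs.not_ge ((Finset.abs_sum_le_sum_abs _ _).trans (Finset.sum_le_sum fun i _ => ?_))
  have := (m i).2
  rw [abs_le]
  omega

theorem finrank_eigenspace_weightOperator (N : List ℕ) (s : ℤ) :
    Module.finrank ℂ ((weightOperator N).eigenspace (s : ℂ)) = weightCount N s := by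
  rw [← card_weight_eq_weightCount, weightOperator]
  exact finrank_eigenspace_leibnizExtension (fun a => binaryFormBasis (N.get a))
    (fun a => weight_binaryFormBasis (N.get a)) s

theorem transvection_invariant_iff {N : List ℕ} (T : ClaspedForm N) {i j : Fin 2} (hij : i ≠ j) :
    (∀ (t : ℂ) (p : ∀ a : Fin N.length, BinaryForm (N.get a)),
      T (fun a => formSubst (N.get a) (transvection hij t) (p a)) = T p) ↔
      polarizationOperator N i j T = 0 := by
  refine invariant_iff_leibnizExtension_eq_zero (fun a => binaryFormBasis (N.get a)) T
    (A := fun t a => formSubst (N.get a) (transvection hij t)) (fun a => ?_) fun a k p t => ?_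
  · rw [transvection_coeff_zero]
    exact LinearMap.ext fun p => Subtype.ext (sl2Subst_one _)
  · exact hasDerivAt_coeff_sl2Subst_transvection hij _ t _

theorem mem_invariantClaspedForms_iff {N : List ℕ} (T : ClaspedForm N) :
    T ∈ invariantClaspedForms N ↔ ∀ (g : Matrix.SpecialLinearGroup (Fin 2) ℂ)
      (p : ∀ a : Fin N.length, BinaryForm (N.get a)),
      T (fun a => formSubst (N.get a) g (p a)) = T p := by
  constructor
  · intro h g p
    exact h g p _ fun _ => rfl
  · intro h g p q hq
    rw [← h g p]
    exact congrArg T (funext fun a => Subtype.ext (hq a))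

theorem mem_invariantClaspedForms_iff_polarizationOperator {N : List ℕ} (T : ClaspedForm N) :
    T ∈ invariantClaspedForms N ↔
      ∀ i j, i ≠ j → polarizationOperator N i j T = 0 := by
  rw [mem_invariantClaspedForms_iff]
  constructor
  · intro h i j hij
    exact (transvection_invariant_iff T hij).1 fun t => h _
  · intro h g
    refine Matrix.SL2.transvection_induction
      (fun g => ∀ p : ∀ a : Fin N.length, BinaryForm (N.get a),
      T (fun a => formSubst (N.get a) g (p a)) = T p) (fun i j hij =>
        (transvection_invariant_iff T hij).2 (h i j hij)) (fun g g' hg hg' p => ?_) g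
    simp only [formSubst_mul]
    exact (hg' _).trans (hg p)

theorem invariantClaspedForms_eq (N : List ℕ) :
    invariantClaspedForms N =
      (weightOperator N).eigenspace 0 ⊓ LinearMap.ker (polarizationOperator N 0 1) := by
  ext T
  rw [mem_invariantClaspedForms_iff_polarizationOperator, Submodule.mem_inf,
    Module.End.mem_eigenspace_iff, LinearMap.mem_ker, zero_smul]
  constructor
  · intro h
    refine ⟨?_, h 0 1 zero_ne_one⟩
    rw [← polarizationOperator_commutator, h 0 1 zero_ne_one, h 1 0 one_ne_zero, map_zero, map_zero,
      sub_zero]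
  · rintro ⟨hH, hE⟩
    have hF := lowering_eq_zero_of_raising_eq_zero (polarizationOperator_commutator N)
      (weightOperator_commutator_lowering N) (eq_zero_of_weight_lt N) hH hE
    intro i j hij
    fin_cases i <;> fin_cases j
    · exact absurd rfl hij
    · exact hE
    · exact hF
    · exact absurd rfl hij

theorem finrank_invariantClaspedForms_add (N : List ℕ) :
    Module.finrank ℂ (invariantClaspedForms N) + weightCount N 2 = weightCount N 0 := by
  have h := finrank_highest_weight_zero_add (polarizationOperator_commutator N)
    (weightOperator_commutator_raising N) (weightOperator_commutator_lowering N)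
    (eq_zero_of_weight_lt N)
  rw [← invariantClaspedForms_eq] at h
  rw [← finrank_eigenspace_weightOperator, ← finrank_eigenspace_weightOperator, Int.cast_zero,
    Int.cast_ofNat]
  exact h

end InvariantForms

theorem dim_invariantClaspedForms_eq_card_claspedBasis
    (N : List ℕ) (hN : ∀ x ∈ N, 0 < x) :
    Module.finrank ℂ (invariantClaspedForms N) =
      Nat.card {f : Fin N.sum → Fin N.sum // InClaspedBasis N f} := by
  rw [card_claspedBasis]
  exact Nat.add_right_cancel
    ((finrank_invariantClaspedForms_add N).trans (ncard_natClaspedBasis_add N).symm)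
end

section
/- Let N = (n₁, …, n_k) be a list of positive integers. Then the cardinality of the clasped basis set B(N) equals the number of sequences (m₀, m₁, …, m_k) of natural numbers with m₀ = 0 and m_k = 0 such that for every i with 1 ≤ i ≤ k the triple (m_{i−1}, n_i, m_i) satisfies the triangle inequalities m_{i−1} ≤ n_i + m_i, n_i ≤ m_{i−1} + m_i, m_i ≤ m_{i−1} + n_i, and the sum m_{i−1} + n_i + m_i is even. -/
open Finset in
/-- The number of arcs of `f` passing over the gap just before position `j`. -/
def arcHeight {m : ℕ} (f : Fin m → Fin m) (j : ℕ) : ℕ :=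
  #{x : Fin m | (x : ℕ) < j ∧ j ≤ (f x : ℕ)}

/-- The up-step at `i` and the down-step at `j` face each other under the height function `H`. -/
def Faces (H : ℕ → ℤ) (i j : ℕ) : Prop :=
  i < j ∧ H (j + 1) = H i ∧ ∀ k, i < k → k ≤ j → H i < H k

theorem Faces.right_unique {H : ℕ → ℤ} {i j j' : ℕ} (h : Faces H i j) (h' : Faces H i j') :
    j = j' := by
  obtain ⟨h1, h2, h3⟩ := h
  obtain ⟨h1', h2', h3'⟩ := h'
  rcases lt_trichotomy j j' with hlt | heq | hlt
  · have := h3' (j + 1) (by omega) (by omega)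
    omega
  · exact heq
  · have := h3 (j' + 1) (by omega) (by omega)
    omega

theorem Faces.left_unique {H : ℕ → ℤ} {i i' j : ℕ} (h : Faces H i j) (h' : Faces H i' j) :
    i = i' := by
  obtain ⟨h1, h2, h3⟩ := h
  obtain ⟨h1', h2', h3'⟩ := h'
  rcases lt_trichotomy i i' with hlt | heq | hlt
  · have := h3 i' (by omega) (by omega)
    omega
  · exact heq
  · have := h3' i (by omega) (by omega)
    omega

theorem Faces.not_chain {H : ℕ → ℤ} {i j k : ℕ} (h : Faces H i j) (h' : Faces H j k) : False := by
  have h1 := h.2.2 j h.1 le_rfl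
  have h2 := h'.2.2 (j + 1) (by omega) h'.1
  have h3 := h.2.1
  omega

theorem Faces.not_crossing {H : ℕ → ℤ} {a b c d : ℕ} (hab : a < b) (hbc : b < c) (hcd : c < d)
    (h : Faces H a c) (h' : Faces H b d) : False := by
  have h1 := h.2.2 b hab hbc.le
  have h2 := h'.2.2 (c + 1) (by omega) hcd
  have h3 := h.2.1
  omega

theorem partner_unique {H : ℕ → ℤ} {i j k : ℕ} (h : Faces H i j ∨ Faces H j i)
    (h' : Faces H i k ∨ Faces H k i) : j = k := by
  rcases h with h | h <;> rcases h' with h' | h'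
  · exact h.right_unique h'
  · exact (h'.not_chain h).elim
  · exact (h.not_chain h').elim
  · exact h.left_unique h'

section Height

variable {m : ℕ} {f : Fin m → Fin m}

theorem arcHeight_zero : arcHeight f 0 = 0 := by
  simp [arcHeight]

theorem arcHeight_of_le {j : ℕ} (hj : m ≤ j) : arcHeight f j = 0 := by
  simp only [arcHeight, Finset.card_eq_zero, Finset.filter_eq_empty_iff]
  intro x _ h
  have := (f x).2
  omega

theorem arcHeight_succ_of_lt (hf : ∀ i, f (f i) = i) {j : Fin m} (h : j < f j) :
    arcHeight f (j + 1) = arcHeight f j + 1 := by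
  classical
  unfold arcHeight
  rw [← Finset.card_insert_of_notMem (a := j) (by simp)]
  congr 1
  ext x
  simp only [Finset.mem_filter, Finset.mem_univ, true_and, Finset.mem_insert]
  rw [Fin.lt_def] at h
  constructor
  · rintro ⟨h1, h2⟩
    by_cases hx : x = j
    · exact Or.inl hx
    · right
      rw [Fin.ext_iff] at hx
      omega
  · rintro (rfl | ⟨h1, h2⟩)
    · omega
    · have : f x ≠ j := by
        rintro rfl
        rw [hf] at h
        omega
      rw [Ne, Fin.ext_iff] at this
      omega

theorem arcHeight_succ_of_gt (hf : ∀ i, f (f i) = i) {j : Fin m} (h : f j < j) :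
    arcHeight f (j + 1) + 1 = arcHeight f j := by
  classical
  unfold arcHeight
  rw [← Finset.card_insert_of_notMem (a := f j) (by simp [hf])]
  congr 1
  ext x
  simp only [Finset.mem_filter, Finset.mem_univ, true_and, Finset.mem_insert]
  rw [Fin.lt_def] at h
  constructor
  · rintro (rfl | ⟨h1, h2⟩)
    · rw [hf]
      omega
    · have : x ≠ j := by
        rintro rfl
        omega
      rw [Ne, Fin.ext_iff] at this
      omega
  · rintro ⟨h1, h2⟩
    by_cases hx : f x = j
    · left
      rw [← hx, hf]
    · right
      rw [Fin.ext_iff] at hx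
      omega

theorem IsCrossinglessMatching.faces (hf : IsCrossinglessMatching f) {i : Fin m} (h : i < f i) :
    Faces (fun j => (arcHeight f j : ℤ)) i (f i) := by
  classical
  obtain ⟨hinv, hfix, hcr⟩ := hf
  have key : ∀ x : Fin m, x < i → i ≤ f x → f i < f x := by
    intro x hx hfx
    rcases lt_trichotomy (f i) (f x) with h1 | h1 | h1
    · exact h1
    · have := congrArg f h1
      rw [hinv, hinv] at this
      exact absurd this hx.ne'
    · rcases hfx.eq_or_lt with h2 | h2
      · have := hinv x
        rw [← h2] at this
        exact absurd (this ▸ h) (not_lt.2 hx.le)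
      · exact (hcr x i (f x) (f i) hx h2 h1 rfl rfl).elim
  refine ⟨h, ?_, ?_⟩
  · simp only [arcHeight, Nat.cast_inj]
    congr 1
    ext x
    simp only [Finset.mem_filter, Finset.mem_univ, true_and]
    constructor
    · rintro ⟨h1, h2⟩
      have hxi : x ≠ i := by
        rintro rfl
        omega
      have hxf : x ≠ f i := by
        rintro rfl
        rw [hinv] at h2
        rw [Fin.lt_def] at h
        omega
      have hx : x < i := by
        by_contra hcon
        refine hcr i x (f i) (f x) (lt_of_le_of_ne (not_lt.1 hcon) hxi.symm)
          (lt_of_le_of_ne (Fin.le_def.2 (by omega)) hxf) (Fin.lt_def.2 (by omega)) rfl rfl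
      rw [Fin.lt_def] at h hx
      omega
    · rintro ⟨h1, h2⟩
      have := key x h1 h2
      rw [Fin.lt_def] at h this
      omega
  · intro k hik hkf
    simp only [arcHeight, Nat.cast_lt]
    apply Finset.card_lt_card
    rw [Finset.ssubset_iff]
    refine ⟨i, by simp, ?_⟩
    intro x hx
    simp only [Finset.mem_filter, Finset.mem_univ, true_and, Finset.mem_insert] at hx ⊢
    rcases hx with rfl | ⟨h1, h2⟩
    · exact ⟨hik, hkf⟩
    · have := key x h1 h2
      rw [Fin.lt_def] at this
      omega

theorem IsCrossinglessMatching.faces_or (hf : IsCrossinglessMatching f) (i : Fin m) :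
    Faces (fun j => (arcHeight f j : ℤ)) i (f i) ∨
      Faces (fun j => (arcHeight f j : ℤ)) (f i) i := by
  rcases lt_or_gt_of_ne (hf.2.1 i) with h | h
  · right
    have := hf.faces (i := f i) (by rwa [hf.1])
    rwa [hf.1] at this
  · exact Or.inl (hf.faces h)

theorem IsCrossinglessMatching.eq_of_arcHeight_eq {g : Fin m → Fin m}
    (hf : IsCrossinglessMatching f) (hg : IsCrossinglessMatching g)
    (h : ∀ j, arcHeight f j = arcHeight g j) : f = g := by
  funext i
  have h1 := hf.faces_or i
  simp only [h] at h1
  exact Fin.ext (partner_unique h1 (hg.faces_or i))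

end Height

section Construction

variable {M : ℕ} {H : ℕ → ℤ}

theorem exists_faces_of_up (hM : H M = 0) (hnn : ∀ p ≤ M, 0 ≤ H p)
    (hstep : ∀ p < M, H (p + 1) = H p + 1 ∨ H (p + 1) = H p - 1) {i : ℕ} (hi : i < M)
    (hup : H (i + 1) = H i + 1) : ∃ j < M, Faces H i j := by
  classical
  have hex : ∃ k, i < k ∧ k ≤ M ∧ H k ≤ H i := ⟨M, hi, le_rfl, hM ▸ hnn i hi.le⟩
  obtain ⟨h1, h2, h3⟩ := Nat.find_spec hex
  have hmin := fun q (hq : q < Nat.find hex) => Nat.find_min hex hq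
  generalize Nat.find hex = k at *
  obtain ⟨j, rfl⟩ : ∃ j, k = j + 1 := ⟨k - 1, by omega⟩
  have hij : i ≠ j := by
    rintro rfl
    omega
  have hlow : ∀ q, i < q → q ≤ j → H i < H q := by
    intro q hq hqj
    by_contra hcon
    exact hmin q (by omega) ⟨hq, by omega, not_lt.1 hcon⟩
  refine ⟨j, by omega, by omega, ?_, hlow⟩
  have := hlow j (by omega) le_rfl
  have := hstep j (by omega)
  omega

theorem exists_faces_of_down (h0 : H 0 = 0) (hnn : ∀ p ≤ M, 0 ≤ H p)
    (hstep : ∀ p < M, H (p + 1) = H p + 1 ∨ H (p + 1) = H p - 1) {j : ℕ} (hj : j < M)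
    (hdown : H (j + 1) = H j - 1) : ∃ i < M, Faces H i j := by
  classical
  have hex : H 0 ≤ H (j + 1) := h0 ▸ hnn _ hj
  have h1 := Nat.findGreatest_spec (P := fun k => H k ≤ H (j + 1)) (Nat.zero_le j) hex
  have h2 := Nat.findGreatest_le (P := fun k => H k ≤ H (j + 1)) j
  have h3 := fun q => Nat.findGreatest_is_greatest (P := fun k => H k ≤ H (j + 1)) (n := j) (k := q)
  generalize Nat.findGreatest (fun k => H k ≤ H (j + 1)) j = i at *
  have hij : i ≠ j := by
    rintro rfl
    omega
  have hlow : ∀ q, i < q → q ≤ j → H (j + 1) < H q := fun q hq hqj => not_le.1 (h3 q hq hqj)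
  have h4 := hlow (i + 1) (by omega) (by omega)
  have h5 := hstep i (by omega)
  have h6 : H (j + 1) = H i := by omega
  exact ⟨i, by omega, by omega, h6, fun q hq hqj => h6 ▸ hlow q hq hqj⟩

/-- Every Dyck path is the height function of a crossingless matching. -/
theorem exists_matching_of_dyckPath (h0 : H 0 = 0) (hM : H M = 0) (hnn : ∀ p ≤ M, 0 ≤ H p)
    (hstep : ∀ p < M, H (p + 1) = H p + 1 ∨ H (p + 1) = H p - 1) :
    ∃ f : Fin M → Fin M, IsCrossinglessMatching f ∧
      (∀ i : Fin M, Faces H i (f i) ∨ Faces H (f i) i) ∧ ∀ p ≤ M, (arcHeight f p : ℤ) = H p := by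
  have hex : ∀ i : Fin M, ∃ j : Fin M, Faces H i j ∨ Faces H j i := by
    intro i
    rcases hstep i i.2 with h | h
    · obtain ⟨j, hj, hij⟩ := exists_faces_of_up hM hnn hstep i.2 h
      exact ⟨⟨j, hj⟩, Or.inl hij⟩
    · obtain ⟨j, hj, hij⟩ := exists_faces_of_down h0 hnn hstep i.2 h
      exact ⟨⟨j, hj⟩, Or.inr hij⟩
  choose f hf using hex
  have hinv : ∀ i, f (f i) = i := fun i => Fin.ext (partner_unique (hf (f i)) (hf i).symm)
  have hlt : ∀ i, i < f i → Faces H i (f i) := fun i hi =>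
    (hf i).resolve_right fun h => absurd h.1 (not_lt.2 hi.le)
  refine ⟨f, ⟨hinv, ?_, ?_⟩, hf, ?_⟩
  · intro i hi
    have := hf i
    rw [hi] at this
    rcases this with h | h <;> exact absurd h.1 (lt_irrefl _)
  · intro a b c d hab hbc hcd hac hbd
    have h1 := hlt a (hac ▸ hab.trans hbc)
    have h2 := hlt b (hbd ▸ hbc.trans hcd)
    rw [hac] at h1
    rw [hbd] at h2
    exact h1.not_crossing hab hbc hcd h2
  · intro p
    induction p with
    | zero => simp [arcHeight_zero, h0]
    | succ p ih =>
      intro hp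
      have ih := ih (by omega)
      rcases hf ⟨p, hp⟩ with h | h
      · have h1 := arcHeight_succ_of_lt hinv (j := ⟨p, hp⟩) h.1
        have h2 := h.2.2 (p + 1) (Nat.lt_succ_self p) h.1
        have h3 := hstep p hp
        simp only at h1 h2
        omega
      · have h1 := arcHeight_succ_of_gt hinv (j := ⟨p, hp⟩) h.1
        have h2 := h.2.2 p h.1 le_rfl
        have h3 := h.2.1
        have h4 := hstep p hp
        simp only at h1 h2 h3
        omega

end Construction

section Clasped

variable {N : List ℕ} {f : Fin N.sum → Fin N.sum}

theorem sum_take_mono (N : List ℕ) : Monotone fun b => (N.take b).sum := by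
  refine monotone_nat_of_le_succ fun b => ?_
  by_cases hb : b < N.length
  · simp only [List.sum_take_succ N b hb]
    omega
  · simp [List.take_of_length_le (not_lt.1 hb), List.take_of_length_le (by omega : N.length ≤ b + 1)]

theorem sum_take_le (N : List ℕ) (b : ℕ) : (N.take b).sum ≤ N.sum := by
  rcases le_total b N.length with hb | hb
  · simpa using sum_take_mono N hb
  · rw [List.take_of_length_le hb]

theorem exists_block {p : ℕ} (hp : p < N.sum) :
    ∃ b < N.length, (N.take b).sum ≤ p ∧ p < (N.take (b + 1)).sum := by
  classical
  have hex : ∃ b, p < (N.take b).sum := ⟨N.length, by simpa using hp⟩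
  have h1 := Nat.find_spec hex
  have h2 := fun q (hq : q < Nat.find hex) => Nat.find_min hex hq
  have h3 : Nat.find hex ≤ N.length := Nat.find_min' hex (by simpa using hp)
  generalize Nat.find hex = k at *
  obtain ⟨b, rfl⟩ : ∃ b, k = b + 1 := by
    cases k with
    | zero => simp at h1
    | succ b => exact ⟨b, rfl⟩
  exact ⟨b, h3, not_lt.1 (h2 b (Nat.lt_succ_self b)), h1⟩

theorem block_unique {p b c : ℕ} (hb : (N.take b).sum ≤ p) (hb' : p < (N.take (b + 1)).sum)
    (hc : (N.take c).sum ≤ p) (hc' : p < (N.take (c + 1)).sum) : b = c := by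
  rcases lt_trichotomy b c with h | h | h
  · have := sum_take_mono N (show b + 1 ≤ c from h)
    simp only at this
    omega
  · exact h
  · have := sum_take_mono N (show c + 1 ≤ b from h)
    simp only at this
    omega

/-- A function with steps `±1` and no local maximum strictly inside `[s, s + n]` is V-shaped. -/
theorem eq_max_of_no_peak {H : ℕ → ℤ} {s n : ℕ}
    (hstep : ∀ p, s ≤ p → p < s + n → H (p + 1) = H p + 1 ∨ H (p + 1) = H p - 1)
    (hpeak : ∀ p q, s ≤ p → p < q → q < s + n → H (p + 1) = H p + 1 → H (q + 1) = H q + 1)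
    {t : ℕ} (ht : t ≤ n) : H (s + t) = max (H s - t) (H (s + n) - (n - t)) := by
  have lip1 : ∀ t ≤ n, H s - t ≤ H (s + t) := by
    intro t
    induction t with
    | zero => simp
    | succ t ih =>
      intro ht
      have := ih (by omega)
      have := hstep (s + t) (by omega) (by omega)
      rw [← add_assoc]
      push_cast
      omega
  have lip2 : ∀ u t, t + u = n → H (s + n) - u ≤ H (s + t) := by
    intro u
    induction u with
    | zero => rintro t rfl; simp
    | succ u ih =>
      intro t ht
      have := ih (t + 1) (by omega)
      have := hstep (s + t) (by omega) (by omega)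
      rw [← add_assoc] at *
      push_cast
      omega
  have h1 := lip1 t ht
  have h2 := lip2 (n - t) t (by omega)
  have h3 : H (s + t) ≤ H s - t ∨ H (s + t) ≤ H (s + n) - (n - t) := by
    by_cases hup : ∃ p, s ≤ p ∧ p < s + t ∧ H (p + 1) = H p + 1
    · right
      obtain ⟨p, hp, hpt, hpu⟩ := hup
      have : ∀ u, t + u ≤ n → H (s + t) + u ≤ H (s + t + u) := by
        intro u
        induction u with
        | zero => simp
        | succ u ih =>
          intro hu
          have := ih (by omega)
          have := hpeak p (s + t + u) hp (by omega) (by omega) hpu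
          rw [← add_assoc]
          push_cast
          omega
      have := this (n - t) (by omega)
      rw [show s + t + (n - t) = s + n by omega] at this
      omega
    · left
      push Not at hup
      have : ∀ u ≤ t, H (s + u) ≤ H s - u := by
        intro u
        induction u with
        | zero => simp
        | succ u ih =>
          intro hu
          have := ih (by omega)
          have := hup (s + u) (by omega) (by omega)
          have := hstep (s + u) (by omega) (by omega)
          rw [← add_assoc]
          push_cast
          omega
      exact this t le_rfl
  rcases max_cases (H s - (t : ℤ)) (H (s + n) - (n - t)) with h | h <;> omega

theorem arcHeight_step (hf : IsCrossinglessMatching f) {p : ℕ} (hp : p < N.sum) :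
    (arcHeight f (p + 1) : ℤ) = arcHeight f p + 1 ∨
      (arcHeight f (p + 1) : ℤ) = arcHeight f p - 1 := by
  rcases lt_or_gt_of_ne (hf.2.1 ⟨p, hp⟩) with h | h
  · have := arcHeight_succ_of_gt hf.1 h
    simp only at this
    omega
  · have := arcHeight_succ_of_lt hf.1 h
    simp only at this
    omega

theorem InClaspedBasis.arcHeight_eq_max (hf : InClaspedBasis N f) {b t : ℕ} (hb : b < N.length)
    (ht : t ≤ N[b]) :
    (arcHeight f ((N.take b).sum + t) : ℤ) =
      max (arcHeight f (N.take b).sum - t : ℤ)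
        (arcHeight f (N.take (b + 1)).sum - (N[b] - t)) := by
  have hS := List.sum_take_succ N b hb
  have hle := sum_take_le N (b + 1)
  rw [hS]
  refine eq_max_of_no_peak (H := fun p => (arcHeight f p : ℤ)) (s := (N.take b).sum) (n := N[b])
    (fun p _ hp => arcHeight_step hf.1 (by omega)) ?_ ht
  intro p q hp hpq hq hup
  have hpN : p < N.sum := by omega
  have hqN : q < N.sum := by omega
  have hfp : p < (f ⟨p, hpN⟩ : ℕ) := by
    by_contra hcon
    have hne := hf.1.2.1 ⟨p, hpN⟩
    rw [Ne, Fin.ext_iff] at hne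
    simp only at hne
    have h1 := arcHeight_succ_of_gt hf.1.1 (j := ⟨p, hpN⟩) (Fin.lt_def.2 (by simp only; omega))
    simp only at h1 hup
    omega
  have hfp' : q < (f ⟨p, hpN⟩ : ℕ) := by
    by_contra hcon
    exact hf.2 ⟨p, hpN⟩ b hp (by simp only; omega) (by omega) (by omega)
  have hfq : q < (f ⟨q, hqN⟩ : ℕ) := by
    by_contra hcon
    have hne := hf.1.2.1 ⟨q, hqN⟩
    rw [Ne, Fin.ext_iff] at hne
    simp only at hne
    have hlow : (f ⟨q, hqN⟩ : ℕ) < (N.take b).sum := by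
      by_contra hcon'
      exact hf.2 ⟨q, hqN⟩ b (by simp only; omega) (by simp only; omega) (by omega) (by omega)
    exact hf.1.2.2 (f ⟨q, hqN⟩) ⟨p, hpN⟩ ⟨q, hqN⟩ (f ⟨p, hpN⟩) (Fin.lt_def.2 (by simp only; omega))
      (Fin.lt_def.2 hpq) (Fin.lt_def.2 hfp') (hf.1.1 _) rfl
  have h1 := arcHeight_succ_of_lt hf.1.1 (j := ⟨q, hqN⟩) (Fin.lt_def.2 hfq)
  simp only at h1 ⊢
  omega

theorem arcHeight_parity (hf : IsCrossinglessMatching f) {s n : ℕ} (h : s + n ≤ N.sum) :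
    Even (arcHeight f s + n + arcHeight f (s + n)) := by
  induction n with
  | zero => simp
  | succ n ih =>
    have h1 := ih (by omega)
    have h2 := arcHeight_step hf (p := s + n) (by omega)
    rw [← add_assoc s n 1]
    rw [Nat.even_iff] at *
    omega

theorem InClaspedBasis.admissible (hf : InClaspedBasis N f) {b : ℕ} (hb : b < N.length) :
    arcHeight f (N.take b).sum ≤ N[b] + arcHeight f (N.take (b + 1)).sum ∧
    N[b] ≤ arcHeight f (N.take b).sum + arcHeight f (N.take (b + 1)).sum ∧
    arcHeight f (N.take (b + 1)).sum ≤ arcHeight f (N.take b).sum + N[b] ∧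
    Even (arcHeight f (N.take b).sum + N[b] + arcHeight f (N.take (b + 1)).sum) := by
  have hS := List.sum_take_succ N b hb
  have hle := sum_take_le N (b + 1)
  have hpar := arcHeight_parity hf.1 (s := (N.take b).sum) (n := N[b]) (by omega)
  rw [← hS] at hpar
  have h0 := hf.arcHeight_eq_max hb (t := 0) (by omega)
  have hn := hf.arcHeight_eq_max hb (t := N[b]) le_rfl
  rw [← hS] at hn
  rw [add_zero] at h0
  refine ⟨by omega, ?_, by omega, hpar⟩
  by_contra hcon
  rw [Nat.even_iff] at hpar
  have := hf.arcHeight_eq_max hb (t := arcHeight f (N.take b).sum + 1) (by omega)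
  push_cast at this
  omega

theorem exists_claspedBasis_of_latticePath (hN : ∀ x ∈ N, 0 < x) {m : ℕ → ℕ} (h0 : m 0 = 0)
    (hlast : m N.length = 0)
    (hm : ∀ (b : ℕ) (hb : b < N.length), m b ≤ N[b] + m (b + 1) ∧ N[b] ≤ m b + m (b + 1) ∧
      m (b + 1) ≤ m b + N[b] ∧ Even (m b + N[b] + m (b + 1))) :
    ∃ f : Fin N.sum → Fin N.sum, InClaspedBasis N f ∧
      ∀ b ≤ N.length, arcHeight f (N.take b).sum = m b := by
  classical
  have hblk : ∀ p, ∃ b, p < N.sum →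
      b < N.length ∧ (N.take b).sum ≤ p ∧ p < (N.take (b + 1)).sum := by
    intro p
    by_cases hp : p < N.sum
    · obtain ⟨b, hb⟩ := exists_block hp
      exact ⟨b, fun _ => hb⟩
    · exact ⟨0, fun h => absurd h hp⟩
  choose B hB using hblk
  obtain ⟨H, hH⟩ : ∃ H : ℕ → ℤ, ∀ p, H p = if p < N.sum then
      max (m (B p) - (p - (N.take (B p)).sum) : ℤ) (m (B p + 1) - ((N.take (B p + 1)).sum - p))
      else 0 := ⟨_, fun _ => rfl⟩
  have hpos : ∀ b (hb : b < N.length), 0 < N[b] := fun b hb => hN _ (List.getElem_mem hb)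
  have hHin : ∀ b p, b < N.length → (N.take b).sum ≤ p → p < (N.take (b + 1)).sum →
      H p = max (m b - (p - (N.take b).sum) : ℤ) (m (b + 1) - ((N.take (b + 1)).sum - p)) := by
    intro b p hb h1 h2
    have hp : p < N.sum := h2.trans_le (sum_take_le N _)
    obtain ⟨-, h4, h5⟩ := hB p hp
    rw [hH, if_pos hp, block_unique h4 h5 h1 h2]
  have hHS : ∀ b ≤ N.length, H (N.take b).sum = m b := by
    intro b hb
    rcases hb.eq_or_lt with rfl | hb
    · rw [hH]
      simp [hlast]
    · have hS := List.sum_take_succ N b hb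
      have := hpos b hb
      obtain ⟨h1, h2, h3, h4⟩ := hm b hb
      rw [hHin b _ hb le_rfl (by omega), hS]
      push_cast
      omega
  have hHV : ∀ b (hb : b < N.length) p, (N.take b).sum ≤ p → p ≤ (N.take b).sum + N[b] →
      H p = max (m b - (p - (N.take b).sum) : ℤ) (m (b + 1) - ((N.take b).sum + N[b] - p)) := by
    intro b hb p h1 h2
    have hS := List.sum_take_succ N b hb
    rcases h2.eq_or_lt with rfl | h2
    · have h3 := hHS (b + 1) hb
      rw [hS] at h3
      obtain ⟨h4, h5, h6, h7⟩ := hm b hb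
      rw [h3]
      push_cast
      omega
    · rw [hHin b p hb h1 (by omega), hS]
      push_cast
      rfl
  have hM : H N.sum = 0 := by rw [hH, if_neg (lt_irrefl _)]
  have hH0 : H 0 = 0 := by simpa [h0] using hHS 0 (Nat.zero_le _)
  have hnn : ∀ p ≤ N.sum, 0 ≤ H p := by
    intro p hp
    rcases hp.eq_or_lt with rfl | hp
    · exact hM.ge
    · obtain ⟨b, hb, h1, h2⟩ := exists_block hp
      have hS := List.sum_take_succ N b hb
      obtain ⟨h4, h5, h6, h7⟩ := hm b hb
      have := hHV b hb p h1 (by omega)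
      rw [Nat.even_iff] at h7
      omega
  have hstep : ∀ p < N.sum, H (p + 1) = H p + 1 ∨ H (p + 1) = H p - 1 := by
    intro p hp
    obtain ⟨b, hb, h1, h2⟩ := exists_block hp
    have hS := List.sum_take_succ N b hb
    obtain ⟨h4, h5, h6, h7⟩ := hm b hb
    have h8 := hHV b hb p h1 (by omega)
    have h9 := hHV b hb (p + 1) (by omega) (by omega)
    rw [Nat.even_iff] at h7
    omega
  obtain ⟨f, hf, hfaces, hheight⟩ := exists_matching_of_dyckPath hH0 hM hnn hstep
  have hno : ∀ i j b, Faces H i j → j < N.sum → (N.take b).sum ≤ i → j < (N.take (b + 1)).sum →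
      False := by
    intro i j b hij hj h1 h2
    have hb : b < N.length := by
      by_contra hcon
      rw [List.take_of_length_le (by omega)] at h1
      have := hij.1
      omega
    have hS := List.sum_take_succ N b hb
    have hlt := hij.1
    have e1 := hij.2.2 (i + 1) (by omega) (by omega)
    have e2 := hij.2.2 j (by omega) le_rfl
    have e3 := hij.2.1
    have a1 := hHV b hb i h1 (by omega)
    have a2 := hHV b hb (i + 1) (by omega) (by omega)
    have a3 := hHV b hb j (by omega) (by omega)
    have a4 := hHV b hb (j + 1) (by omega) (by omega)
    omega
  refine ⟨f, ⟨hf, ?_⟩, ?_⟩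
  · intro i b h1 h2 h3 h4
    rcases hfaces i with h | h
    · exact hno _ _ b h (f i).2 h1 h4
    · exact hno _ _ b h i.2 h3 h2
  · intro b hb
    have := hheight _ (sum_take_le N b)
    rw [hHS b hb] at this
    exact_mod_cast this

theorem InClaspedBasis.eq_of_arcHeight_eq {g : Fin N.sum → Fin N.sum} (hf : InClaspedBasis N f)
    (hg : InClaspedBasis N g)
    (h : ∀ b ≤ N.length, arcHeight f (N.take b).sum = arcHeight g (N.take b).sum) : f = g := by
  refine hf.1.eq_of_arcHeight_eq hg.1 fun p => ?_
  by_cases hp : p < N.sum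
  · obtain ⟨b, hb, h1, h2⟩ := exists_block hp
    have hS := List.sum_take_succ N b hb
    obtain ⟨t, rfl⟩ := Nat.exists_eq_add_of_le h1
    have e1 := hf.arcHeight_eq_max hb (t := t) (by omega)
    have e2 := hg.arcHeight_eq_max hb (t := t) (by omega)
    rw [h b hb.le, h (b + 1) hb, ← e2] at e1
    exact_mod_cast e1
  · rw [arcHeight_of_le (not_lt.1 hp), arcHeight_of_le (not_lt.1 hp)]

end Clasped

theorem card_claspedBasis_eq_card_latticePaths (N : List ℕ) (hN : ∀ x ∈ N, 0 < x) :
    Nat.card {f : Fin N.sum → Fin N.sum // InClaspedBasis N f} =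
      Nat.card {m : Fin (N.length + 1) → ℕ //
        m 0 = 0 ∧ m (Fin.last N.length) = 0 ∧
        ∀ i : Fin N.length,
          m i.castSucc ≤ N.get i + m i.succ ∧
          N.get i ≤ m i.castSucc + m i.succ ∧
          m i.succ ≤ m i.castSucc + N.get i ∧
          Even (m i.castSucc + N.get i + m i.succ)} := by
  refine Nat.card_eq_of_bijective (fun f => ⟨fun b => arcHeight f.1 (N.take b).sum, ?_, ?_, ?_⟩)
    ⟨?_, ?_⟩
  · simp [arcHeight_zero]
  · exact arcHeight_of_le (by simp)
  · intro i
    exact f.2.admissible i.2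
  · rintro ⟨f, hf⟩ ⟨g, hg⟩ hfg
    rw [Subtype.mk.injEq] at hfg ⊢
    exact hf.eq_of_arcHeight_eq hg fun b hb => congrFun hfg ⟨b, Nat.lt_succ_of_le hb⟩
  · rintro ⟨m, h0, hlast, hm⟩
    have hext : ∀ (b : ℕ) (hb : b < N.length + 1),
        (fun b => if h : b < N.length + 1 then m ⟨b, h⟩ else 0) b = m ⟨b, hb⟩ :=
      fun b hb => dif_pos hb
    generalize (fun b => if h : b < N.length + 1 then m ⟨b, h⟩ else 0) = m' at hext
    obtain ⟨f, hf, hfm⟩ := exists_claspedBasis_of_latticePath hN (m := m')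
      ((hext 0 (by omega)).trans h0) ((hext _ (by omega)).trans hlast) (by
        intro b hb
        rw [hext b (by omega), hext (b + 1) (by omega)]
        exact hm ⟨b, hb⟩)
    refine ⟨⟨f, hf⟩, Subtype.ext (funext fun b => ?_)⟩
    exact (hfm b (Nat.le_of_lt_succ b.2)).trans (hext b b.2)
end

section
/- Let J and K be lists of natural numbers, and let S be the sum of all entries of J and K. Then the cardinality of B(J ++ K) equals the sum over ℓ from 0 to S of the product |B(J ++ [ℓ])| · |B([ℓ] ++ K)|, where [ℓ] denotes the one-entry list (ℓ). (Equivalently, there is a bijection from B(J ++ K) to the disjoint union over ℓ of B(J ++ [ℓ]) × B([ℓ] ++ K).) -/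
/-- A fixed-point-free involution `f` which has no crossing with respect to `lt` and which
matches no two `r`-related points. -/
structure IsCrossinglessMatchingOn {α : Type*} (lt r : α → α → Prop) (f : α → α) : Prop where
  invol : ∀ i, f (f i) = i
  ne : ∀ i, f i ≠ i
  not_cross : ∀ a b c d, lt a b → lt b c → lt c d → f a = c → f b = d → False
  not_rel : ∀ i, ¬ r i (f i)

/-- A crossingless partial matching, encoded as an involution `g` whose fixed points are the
unmatched points, such that no unmatched point lies under an arc and no two `r`-related points
are matched. -/
structure IsHalfMatching {α : Type*} [LT α] (r : α → α → Prop) (g : α → α) : Prop where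
  invol : ∀ i, g (g i) = i
  not_cross : ∀ a b c d, a < b → b < c → c < d → g a = c → g b = d → False
  not_under : ∀ a b c, a < b → b < c → g a = c → g b = b → False
  not_rel : ∀ i, g i ≠ i → ¬ r i (g i)

section Halves

variable {α β : Type*}

/-- The restriction to the left summand; points matched to the right become fixed. -/
def leftHalf (f : α ⊕ β → α ⊕ β) (a : α) : α := (f (.inl a)).elim id fun _ => a

/-- The restriction to the right summand; points matched to the left become fixed. -/
def rightHalf (f : α ⊕ β → α ⊕ β) (b : β) : β := (f (.inr b)).elim (fun _ => b) id

lemma leftHalf_of_inl {f : α ⊕ β → α ⊕ β} {a a' : α} (h : f (.inl a) = .inl a') :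
    leftHalf f a = a' := by simp [leftHalf, h]

lemma leftHalf_of_inr {f : α ⊕ β → α ⊕ β} {a : α} {b : β} (h : f (.inl a) = .inr b) :
    leftHalf f a = a := by simp [leftHalf, h]

lemma rightHalf_of_inl {f : α ⊕ β → α ⊕ β} {a : α} {b : β} (h : f (.inr b) = .inl a) :
    rightHalf f b = b := by simp [rightHalf, h]

lemma rightHalf_of_inr {f : α ⊕ β → α ⊕ β} {b b' : β} (h : f (.inr b) = .inr b') :
    rightHalf f b = b' := by simp [rightHalf, h]

lemma apply_inl_of_leftHalf_ne {f : α ⊕ β → α ⊕ β} {a : α} (h : leftHalf f a ≠ a) :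
    f (.inl a) = .inl (leftHalf f a) := by
  rcases h' : f (.inl a) with a' | b
  · rw [leftHalf_of_inl h']
  · exact absurd (leftHalf_of_inr h') h

lemma apply_inr_of_rightHalf_ne {f : α ⊕ β → α ⊕ β} {b : β} (h : rightHalf f b ≠ b) :
    f (.inr b) = .inr (rightHalf f b) := by
  rcases h' : f (.inr b) with a | b'
  · exact absurd (rightHalf_of_inl h') h
  · rw [rightHalf_of_inr h']

variable [LinearOrder α] [LinearOrder β] {r : α → α → Prop} {s : β → β → Prop}

namespace IsCrossinglessMatchingOn

variable {f : α ⊕ β → α ⊕ β}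
  (hf : IsCrossinglessMatchingOn (Sum.Lex (· < ·) (· < ·)) (Sum.LiftRel r s) f)

include hf

lemma exists_apply_inl {a : α} (h : leftHalf f a = a) : ∃ b, f (.inl a) = .inr b := by
  rcases h' : f (.inl a) with a' | b
  · rw [leftHalf_of_inl h'] at h
    exact absurd (h ▸ h') (hf.ne _)
  · exact ⟨b, rfl⟩

lemma exists_apply_inr {b : β} (h : rightHalf f b = b) : ∃ a, f (.inr b) = .inl a := by
  rcases h' : f (.inr b) with a | b'
  · exact ⟨a, rfl⟩
  · rw [rightHalf_of_inr h'] at h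
    exact absurd (h ▸ h') (hf.ne _)

lemma isHalfMatching_leftHalf : IsHalfMatching r (leftHalf f) where
  invol a := by
    by_cases h : leftHalf f a = a
    · rw [h, h]
    · apply leftHalf_of_inl
      rw [← apply_inl_of_leftHalf_ne h, hf.invol]
  not_cross a b c d hab hbc hcd hac hbd := by
    have h1 := apply_inl_of_leftHalf_ne (a := a) (by rw [hac]; exact (hab.trans hbc).ne')
    have h2 := apply_inl_of_leftHalf_ne (a := b) (by rw [hbd]; exact (hbc.trans hcd).ne')
    exact hf.not_cross (.inl a) (.inl b) (.inl c) (.inl d) (by simpa) (by simpa) (by simpa)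
      (hac ▸ h1) (hbd ▸ h2)
  not_under a b c hab hbc hac hb := by
    have h1 := apply_inl_of_leftHalf_ne (a := a) (by rw [hac]; exact (hab.trans hbc).ne')
    obtain ⟨d, h2⟩ := hf.exists_apply_inl hb
    exact hf.not_cross (.inl a) (.inl b) (.inl c) (.inr d) (by simpa) (by simpa) (by simp)
      (hac ▸ h1) h2
  not_rel a h hr := hf.not_rel (.inl a) (by
    rw [apply_inl_of_leftHalf_ne h]
    exact .inl hr)

lemma isHalfMatching_rightHalf : IsHalfMatching s (rightHalf f) where
  invol b := by
    by_cases h : rightHalf f b = b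
    · rw [h, h]
    · apply rightHalf_of_inr
      rw [← apply_inr_of_rightHalf_ne h, hf.invol]
  not_cross a b c d hab hbc hcd hac hbd := by
    have h1 := apply_inr_of_rightHalf_ne (b := a) (by rw [hac]; exact (hab.trans hbc).ne')
    have h2 := apply_inr_of_rightHalf_ne (b := b) (by rw [hbd]; exact (hbc.trans hcd).ne')
    exact hf.not_cross (.inr a) (.inr b) (.inr c) (.inr d) (by simpa) (by simpa) (by simpa)
      (hac ▸ h1) (hbd ▸ h2)
  not_under a b c hab hbc hac hb := by
    have h1 := apply_inr_of_rightHalf_ne (b := a) (by rw [hac]; exact (hab.trans hbc).ne')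
    obtain ⟨d, h2⟩ := hf.exists_apply_inr hb
    exact hf.not_cross (.inl d) (.inr a) (.inr b) (.inr c) (by simp) (by simpa) (by simpa)
      (by rw [← h2, hf.invol]) (hac ▸ h1)
  not_rel b h hr := hf.not_rel (.inr b) (by
    rw [apply_inr_of_rightHalf_ne h]
    exact .inr hr)

lemma exists_orderIso :
    ∃ e : {a // leftHalf f a = a} ≃o {b // rightHalf f b = b}ᵒᵈ,
      ∀ a, f (.inl a.1) = .inr (OrderDual.ofDual (e a)).1 := by
  choose σ hσ using fun a : {a // leftHalf f a = a} => hf.exists_apply_inl a.2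
  have hσ' (a) : f (.inr (σ a)) = .inl a.1 := by rw [← hσ, hf.invol]
  let F : {a // leftHalf f a = a} → {b // rightHalf f b = b}ᵒᵈ :=
    fun a => OrderDual.toDual ⟨σ a, rightHalf_of_inl (hσ' a)⟩
  have mono : StrictMono F := by
    intro a b hab
    change σ b < σ a
    by_contra! h
    rcases h.lt_or_eq with h | h
    · exact hf.not_cross (.inl a) (.inl b) (.inr (σ a)) (.inr (σ b)) (by simpa) (by simp)
        (by simpa) (hσ a) (hσ b)
    · have := hσ' a
      rw [h, hσ' b] at this
      exact hab.ne' (Subtype.ext (Sum.inl_injective this))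
  have surj : Function.Surjective F := by
    intro b
    obtain ⟨a, ha⟩ := hf.exists_apply_inr (OrderDual.ofDual b).2
    have ha' : f (.inl a) = .inr (OrderDual.ofDual b).1 := by rw [← ha, hf.invol]
    refine ⟨⟨a, leftHalf_of_inr ha'⟩, ?_⟩
    apply OrderDual.ofDual.injective
    apply Subtype.ext
    have := hσ ⟨a, leftHalf_of_inr ha'⟩
    rw [ha'] at this
    exact (Sum.inr_injective this).symm
  exact ⟨mono.orderIsoOfSurjective F surj, hσ⟩

lemma eq_of_halves_eq [Finite α] {f' : α ⊕ β → α ⊕ β}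
    (hf' : IsCrossinglessMatchingOn (Sum.Lex (· < ·) (· < ·)) (Sum.LiftRel r s) f')
    (hl : leftHalf f = leftHalf f') (hr : rightHalf f = rightHalf f') : f = f' := by
  have key (a : α) : f (.inl a) = f' (.inl a) := by
    by_cases h : leftHalf f a = a
    · obtain ⟨e, he⟩ := hf.exists_orderIso
      have hex := hf'.exists_orderIso
      rw [← hl, ← hr] at hex
      obtain ⟨e', he'⟩ := hex
      rw [he ⟨a, h⟩, he' ⟨a, h⟩, Subsingleton.elim e e']
    · rw [apply_inl_of_leftHalf_ne h, apply_inl_of_leftHalf_ne (f := f') (hl ▸ h), hl]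
  funext x
  rcases x with a | b
  · exact key a
  · by_cases h : rightHalf f b = b
    · obtain ⟨a, ha⟩ := hf.exists_apply_inr h
      have ha' : f' (.inl a) = .inr b := by rw [← key, ← ha, hf.invol]
      rw [ha, ← ha', hf'.invol]
    · rw [apply_inr_of_rightHalf_ne h, apply_inr_of_rightHalf_ne (f := f') (hr ▸ h), hr]

end IsCrossinglessMatchingOn

lemma exists_isCrossinglessMatchingOn {g : α → α} {h : β → β}
    (hg : IsHalfMatching r g) (hh : IsHalfMatching s h)
    (e : {a // g a = a} ≃o {b // h b = b}ᵒᵈ) :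
    ∃ f : α ⊕ β → α ⊕ β,
      IsCrossinglessMatchingOn (Sum.Lex (· < ·) (· < ·)) (Sum.LiftRel r s) f ∧
      leftHalf f = g ∧ rightHalf f = h := by
  let σ (a : α) (ha : g a = a) : β := (OrderDual.ofDual (e ⟨a, ha⟩)).1
  let τ (b : β) (hb : h b = b) : α := (e.symm (OrderDual.toDual ⟨b, hb⟩)).1
  have hσ (a ha) : h (σ a ha) = σ a ha := (OrderDual.ofDual (e ⟨a, ha⟩)).2
  have hτ (b hb) : g (τ b hb) = τ b hb := (e.symm (OrderDual.toDual ⟨b, hb⟩)).2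
  have hτσ (a ha) : τ (σ a ha) (hσ a ha) = a := by simp [σ, τ]
  have hστ (b hb) : σ (τ b hb) (hτ b hb) = b := by simp [σ, τ]
  have anti (a a' ha ha') (hlt : a < a') : σ a' ha' < σ a ha :=
    e.strictMono (show (⟨a, ha⟩ : {a // g a = a}) < ⟨a', ha'⟩ from hlt)
  let f : α ⊕ β → α ⊕ β := Sum.elim
    (fun a => if ha : g a = a then .inr (σ a ha) else .inl (g a))
    (fun b => if hb : h b = b then .inl (τ b hb) else .inr (h b))
  have fl (a) (ha : g a = a) : f (.inl a) = .inr (σ a ha) := by simp [f, ha]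
  have fl' (a) (ha : g a ≠ a) : f (.inl a) = .inl (g a) := by simp [f, ha]
  have fr (b) (hb : h b = b) : f (.inr b) = .inl (τ b hb) := by simp [f, hb]
  have fr' (b) (hb : h b ≠ b) : f (.inr b) = .inr (h b) := by simp [f, hb]
  have fll (a a') (hf : f (.inl a) = .inl a') : g a = a' := by
    by_cases ha : g a = a
    · simp [fl a ha] at hf
    · simpa [fl' a ha] using hf
  have flr (a b) (hf : f (.inl a) = .inr b) : ∃ ha : g a = a, σ a ha = b := by
    by_cases ha : g a = a
    · exact ⟨ha, by simpa [fl a ha] using hf⟩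
    · simp [fl' a ha] at hf
  have frr (b b') (hf : f (.inr b) = .inr b') : h b = b' := by
    by_cases hb : h b = b
    · simp [fr b hb] at hf
    · simpa [fr' b hb] using hf
  refine ⟨f, ⟨?_, ?_, ?_, ?_⟩, ?_, ?_⟩
  · rintro (a | b)
    · by_cases ha : g a = a
      · rw [fl a ha, fr _ (hσ a ha), hτσ]
      · rw [fl' a ha, fl' _ (by rw [hg.invol]; exact Ne.symm ha), hg.invol]
    · by_cases hb : h b = b
      · rw [fr b hb, fl _ (hτ b hb), hστ]
      · rw [fr' b hb, fr' _ (by rw [hh.invol]; exact Ne.symm hb), hh.invol]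
  · rintro (a | b)
    · by_cases ha : g a = a
      · simp [fl a ha]
      · simpa [fl' a ha] using ha
    · by_cases hb : h b = b
      · simp [fr b hb]
      · simpa [fr' b hb] using hb
  · rintro (a | a) (b | b) (c | c) (d | d) hab hbc hcd hac hbd <;>
      simp only [Sum.lex_inl_inl, Sum.lex_inr_inr, Sum.lex_inr_inl] at hab hbc hcd
    · exact hg.not_cross a b c d hab hbc hcd (fll _ _ hac) (fll _ _ hbd)
    · exact hg.not_under a b c hab hbc (fll _ _ hac) (flr _ _ hbd).1
    · obtain ⟨ha, rfl⟩ := flr _ _ hac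
      obtain ⟨hb, rfl⟩ := flr _ _ hbd
      exact (anti a b ha hb hab).not_gt hcd
    · obtain ⟨ha, rfl⟩ := flr _ _ hac
      exact hh.not_under b _ d hbc hcd (frr _ _ hbd) (hσ a ha)
    · exact hh.not_cross a b c d hab hbc hcd (frr _ _ hac) (frr _ _ hbd)
  · rintro (a | b)
    · by_cases ha : g a = a
      · simp [fl a ha]
      · rw [fl' a ha, Sum.liftRel_inl_inl]
        exact hg.not_rel a ha
    · by_cases hb : h b = b
      · simp [fr b hb]
      · rw [fr' b hb, Sum.liftRel_inr_inr]
        exact hh.not_rel b hb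
  · funext a
    by_cases ha : g a = a
    · rw [leftHalf_of_inr (fl a ha), ha]
    · exact leftHalf_of_inl (fl' a ha)
  · funext b
    by_cases hb : h b = b
    · rw [rightHalf_of_inl (fr b hb), hb]
    · exact rightHalf_of_inr (fr' b hb)

/-- Cutting a crossingless matching of `α ⊕ β` between the two summands. -/
lemma card_isCrossinglessMatchingOn_sum [Finite α] [Finite β] :
    Nat.card {f : α ⊕ β → α ⊕ β //
      IsCrossinglessMatchingOn (Sum.Lex (· < ·) (· < ·)) (Sum.LiftRel r s) f} =
    Nat.card {p : (α → α) × (β → β) // (IsHalfMatching r p.1 ∧ IsHalfMatching s p.2) ∧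
      Nat.card {a // p.1 a = a} = Nat.card {b // p.2 b = b}} := by
  refine Nat.card_eq_of_bijective (fun f => ⟨(leftHalf f.1, rightHalf f.1),
    ⟨f.2.isHalfMatching_leftHalf, f.2.isHalfMatching_rightHalf⟩, ?_⟩) ⟨?_, ?_⟩
  · obtain ⟨e, -⟩ := f.2.exists_orderIso
    exact Nat.card_congr (e.toEquiv.trans OrderDual.ofDual)
  · intro f f' hff
    simp only [Subtype.mk.injEq, Prod.mk.injEq] at hff
    exact Subtype.ext (f.2.eq_of_halves_eq f'.2 hff.1 hff.2)
  · rintro ⟨⟨g, h⟩, ⟨hg, hh⟩, hc⟩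
    simp only at hg hh hc
    have := Fintype.ofFinite {a // g a = a}
    have := Fintype.ofFinite {b // h b = b}ᵒᵈ
    have e₁ := Fintype.orderIsoFinOfCardEq {a // g a = a} Nat.card_eq_fintype_card.symm
    have e₂ := Fintype.orderIsoFinOfCardEq {b // h b = b}ᵒᵈ
      (Nat.card_eq_fintype_card.symm.trans hc.symm)
    obtain ⟨f, hf, hl, hr⟩ := exists_isCrossinglessMatchingOn hg hh (e₁.symm.trans e₂)
    exact ⟨⟨f, hf⟩, Subtype.ext (Prod.ext hl hr)⟩

end Halves

lemma isCrossinglessMatchingOn_arrowCongr {γ δ : Type*} {lt r : γ → γ → Prop}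
    {lt' r' : δ → δ → Prop} (e : γ ≃ δ) (hlt : ∀ x y, lt' (e x) (e y) ↔ lt x y)
    (hr : ∀ x y, r' (e x) (e y) ↔ r x y) (f : γ → γ) :
    IsCrossinglessMatchingOn lt' r' (e.arrowCongr e f) ↔ IsCrossinglessMatchingOn lt r f := by
  have key (x) : e.arrowCongr e f (e x) = e (f x) := by simp
  constructor
  · rintro ⟨h1, h2, h3, h4⟩
    refine ⟨fun i => e.injective ?_, fun i hi => h2 (e i) ?_, fun a b c d hab hbc hcd hac hbd =>
      h3 (e a) (e b) (e c) (e d) ((hlt _ _).2 hab) ((hlt _ _).2 hbc) ((hlt _ _).2 hcd) ?_ ?_,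
      fun i hi => h4 (e i) ?_⟩
    · rw [← key, ← key, h1]
    · rw [key, hi]
    · rw [key, hac]
    · rw [key, hbd]
    · rwa [key, hr]
  · rintro ⟨h1, h2, h3, h4⟩
    refine ⟨e.surjective.forall.2 fun i => ?_, e.surjective.forall.2 fun i => ?_,
      e.surjective.forall.2 fun a => e.surjective.forall.2 fun b => e.surjective.forall.2 fun c =>
      e.surjective.forall.2 fun d => ?_, e.surjective.forall.2 fun i => ?_⟩
    · rw [key, key, h1]
    · rw [key]
      exact e.injective.ne (h2 i)
    · rw [key, key, hlt, hlt, hlt, e.apply_eq_iff_eq, e.apply_eq_iff_eq]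
      exact h3 a b c d
    · rw [key, hr]
      exact h4 i

/-- The points `i` and `j` lie in a common block of the partition of `ℕ` given by `N`. -/
def SameBlock (N : List ℕ) (i j : ℕ) : Prop :=
  ∃ b, (N.take b).sum ≤ i ∧ i < (N.take (b + 1)).sum ∧
    (N.take b).sum ≤ j ∧ j < (N.take (b + 1)).sum

lemma inClaspedBasis_iff (N : List ℕ) (f : Fin N.sum → Fin N.sum) :
    InClaspedBasis N f ↔
      IsCrossinglessMatchingOn (· < ·) (fun i j : Fin N.sum => SameBlock N i j) f := by
  constructor
  · rintro ⟨⟨h1, h2, h3⟩, h4⟩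
    exact ⟨h1, h2, h3, fun i ⟨b, hb1, hb2, hb3, hb4⟩ => h4 i b hb1 hb2 hb3 hb4⟩
  · rintro ⟨h1, h2, h3, h4⟩
    exact ⟨⟨h1, h2, h3⟩, fun i b hb1 hb2 hb3 hb4 => h4 i ⟨b, hb1, hb2, hb3, hb4⟩⟩

lemma SameBlock.comm {N : List ℕ} {i j : ℕ} : SameBlock N i j ↔ SameBlock N j i := by
  unfold SameBlock
  constructor <;> rintro ⟨b, h1, h2, h3, h4⟩ <;> exact ⟨b, h3, h4, h1, h2⟩

lemma sum_take_append_of_le (J K : List ℕ) {b : ℕ} (h : b ≤ J.length) :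
    ((J ++ K).take b).sum = (J.take b).sum := by
  rw [List.take_append_of_le_length h]

lemma sum_take_append_length_add (J K : List ℕ) (b : ℕ) :
    ((J ++ K).take (J.length + b)).sum = J.sum + (K.take b).sum := by
  rw [List.take_length_add_append, List.sum_append]

lemma sameBlock_append_left (J K : List ℕ) {i j : ℕ} (hi : i < J.sum) :
    SameBlock (J ++ K) i j ↔ SameBlock J i j := by
  refine exists_congr fun b => ?_
  rcases lt_or_ge b J.length with h | h
  · rw [sum_take_append_of_le J K h.le, sum_take_append_of_le J K h]
  · obtain ⟨c, rfl⟩ := Nat.exists_eq_add_of_le h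
    rw [sum_take_append_length_add,
      List.take_of_length_le (by omega : J.length ≤ J.length + c)]
    omega

lemma sameBlock_append_right (J K : List ℕ) {i j : ℕ} :
    SameBlock (J ++ K) (J.sum + i) (J.sum + j) ↔ SameBlock K i j := by
  constructor
  · rintro ⟨b, h⟩
    rcases lt_or_ge b J.length with hb | hb
    · have := J.sum_take_add_sum_drop (b + 1)
      rw [sum_take_append_of_le J K (show b + 1 ≤ J.length from hb)] at h
      omega
    · obtain ⟨c, rfl⟩ := Nat.exists_eq_add_of_le hb
      rw [add_assoc, sum_take_append_length_add, sum_take_append_length_add] at h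
      exact ⟨c, by omega⟩
  · rintro ⟨c, h⟩
    refine ⟨J.length + c, ?_⟩
    rw [add_assoc, sum_take_append_length_add, sum_take_append_length_add]
    omega

lemma SameBlock.lt_sum {N : List ℕ} {i j : ℕ} (h : SameBlock N i j) : j < N.sum := by
  obtain ⟨b, -, -, -, h⟩ := h
  have := N.sum_take_add_sum_drop (b + 1)
  omega

/-- The number of crossingless partial matchings with `ℓ` unmatched points which match no two
points of the same block. -/
noncomputable def halfCount (N : List ℕ) (ℓ : ℕ) : ℕ :=
  Nat.card {g : Fin N.sum → Fin N.sum //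
    IsHalfMatching (fun i j : Fin N.sum => SameBlock N i j) g ∧ Nat.card {i // g i = i} = ℓ}

lemma card_claspedBasis_append_eq_sum_halfCount (J K : List ℕ) {m : ℕ} (hm : J.sum ≤ m) :
    Nat.card {f : Fin (J ++ K).sum → Fin (J ++ K).sum // InClaspedBasis (J ++ K) f} =
      ∑ ℓ ∈ Finset.range (m + 1), halfCount J ℓ * halfCount K ℓ := by
  let e : Fin J.sum ⊕ Fin K.sum ≃ Fin (J ++ K).sum :=
    finSumFinEquiv.trans (finCongr List.sum_append.symm)
  have hl (a : Fin J.sum) : (e (.inl a) : ℕ) = a := by simp [e]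
  have hr (b : Fin K.sum) : (e (.inr b) : ℕ) = J.sum + b := by simp [e]
  have hlt (x y) : e x < e y ↔ Sum.Lex (· < ·) (· < ·) x y := by
    rw [Fin.lt_def]
    rcases x with a | b <;> rcases y with c | d <;> simp only [hl, hr] <;> simp <;> omega
  have hrel (x y) : SameBlock (J ++ K) (e x) (e y) ↔
      Sum.LiftRel (fun i j : Fin J.sum => SameBlock J i j)
        (fun i j : Fin K.sum => SameBlock K i j) x y := by
    rcases x with a | b <;> rcases y with c | d <;> simp only [hl, hr]
    · simp [sameBlock_append_left J K a.2]
    · rw [sameBlock_append_left J K a.2]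
      simp only [Sum.not_liftRel_inl_inr, iff_false]
      intro h
      have := h.lt_sum
      omega
    · rw [SameBlock.comm, sameBlock_append_left J K c.2]
      simp only [Sum.not_liftRel_inr_inl, iff_false]
      intro h
      have := h.lt_sum
      omega
    · simp [sameBlock_append_right]
  have h1 := Nat.card_congr ((e.arrowCongr e).subtypeEquiv fun f =>
    ((inClaspedBasis_iff (J ++ K) _).trans
      (isCrossinglessMatchingOn_arrowCongr e hlt hrel f)).symm)
  rw [← h1, card_isCrossinglessMatchingOn_sum, Finset.sum_range]
  simp only [halfCount, ← Nat.card_prod]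
  rw [← Nat.card_sigma]
  refine Nat.card_congr
    { toFun := fun p => ⟨⟨Nat.card {a // p.1.1 a = a}, ?_⟩,
        ⟨p.1.1, p.2.1.1, rfl⟩, ⟨p.1.2, p.2.1.2, p.2.2.symm⟩⟩
      invFun := fun q => ⟨(q.2.1.1, q.2.2.1), ⟨q.2.1.2.1, q.2.2.2.1⟩,
        q.2.1.2.2.trans q.2.2.2.2.symm⟩
      left_inv := fun p => rfl
      right_inv := ?_ }
  · have := Finite.card_subtype_le (fun a => p.1.1 a = a)
    rw [Nat.card_fin] at this
    omega
  · rintro ⟨⟨ℓ, hℓ⟩, ⟨g, hg, hg'⟩, h, hh, hh'⟩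
    obtain rfl : ℓ = _ := hg'.symm
    rfl

lemma halfCount_singleton (n ℓ : ℕ) : halfCount [n] ℓ = if ℓ = n then 1 else 0 := by
  have hblock (i j : Fin [n].sum) : SameBlock [n] i j := ⟨0, by simp, i.2, by simp, j.2⟩
  have hid (g : Fin [n].sum → Fin [n].sum)
      (hg : IsHalfMatching (fun i j : Fin [n].sum => SameBlock [n] i j) g) : g = id :=
    funext fun i => by_contra fun h => hg.not_rel i h (hblock _ _)
  have hcard : Nat.card {i : Fin [n].sum // id i = i} = n := by
    simp
  split_ifs with h
  · refine Nat.card_eq_one_iff_exists.2 ⟨⟨id, ⟨fun _ => rfl, ?_, ?_, ?_⟩, hcard.trans h.symm⟩,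
      fun g => Subtype.ext (hid _ g.2.1)⟩
    · rintro a b c d hab hbc - rfl -
      exact (hab.trans hbc).false
    · rintro a b c hab hbc rfl -
      exact (hab.trans hbc).false
    · exact fun i hi => absurd rfl hi
  · have : IsEmpty {g : Fin [n].sum → Fin [n].sum //
        IsHalfMatching (fun i j : Fin [n].sum => SameBlock [n] i j) g ∧
          Nat.card {i // g i = i} = ℓ} := by
      refine ⟨fun ⟨g, hg, hc⟩ => h ?_⟩
      rw [hid g hg, hcard] at hc
      exact hc.symm
    exact Nat.card_of_isEmpty

theorem card_claspedBasis_append (J K : List ℕ) :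
    Nat.card {f : Fin (J ++ K).sum → Fin (J ++ K).sum // InClaspedBasis (J ++ K) f} =
      ∑ ℓ ∈ Finset.range ((J ++ K).sum + 1),
        Nat.card {f : Fin (J ++ [ℓ]).sum → Fin (J ++ [ℓ]).sum // InClaspedBasis (J ++ [ℓ]) f} *
        Nat.card {f : Fin ([ℓ] ++ K).sum → Fin ([ℓ] ++ K).sum // InClaspedBasis ([ℓ] ++ K) f} := by
  have hJ : J.sum ≤ (J ++ K).sum := by simp
  rw [card_claspedBasis_append_eq_sum_halfCount J K hJ]
  refine Finset.sum_congr rfl fun ℓ hℓ => ?_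
  have hℓ' : [ℓ].sum ≤ (J ++ K).sum := by
    simpa [Nat.lt_succ_iff] using hℓ
  rw [card_claspedBasis_append_eq_sum_halfCount J [ℓ] hJ,
    card_claspedBasis_append_eq_sum_halfCount [ℓ] K hℓ']
  simp only [halfCount_singleton, mul_ite, mul_one, mul_zero, ite_mul, one_mul, zero_mul,
    Finset.sum_ite_eq', hℓ, if_true]
end

section
/- For natural numbers i, j, k, the clasped basis set B(i, j, k) (for the list with the three entries i, j, k) has exactly one element if i ≤ j + k, j ≤ i + k, k ≤ i + j and i + j + k is even, and is empty otherwise. -/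
/-- A function on natural numbers that restricts to a crossingless matching of
`0, …, i + j + k - 1` matching no two points of the same block, for the consecutive blocks of
sizes `i`, `j` and `k`. -/
structure IsThreeClasp (i j k : ℕ) (g : ℕ → ℕ) : Prop where
  lt : ∀ x < i + j + k, g x < i + j + k
  invol : ∀ x < i + j + k, g (g x) = x
  ne : ∀ x < i + j + k, g x ≠ x
  noncross : ∀ a b, a < b → b < g a → g a < g b → g b < i + j + k → False
  left : ∀ x < i, i ≤ g x
  middle : ∀ x, i ≤ x → x < i + j → g x < i ∨ i + j ≤ g x
  right : ∀ x, i + j ≤ x → x < i + j + k → g x < i + j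

/-- The candidate matching with `c` arcs between the first and the last block. -/
def threeClaspMatching (i j k c x : ℕ) : ℕ :=
  if x < c then i + j + k - 1 - x
  else if x < 2 * i - c then 2 * i - 1 - x
  else if x < i + j + k - c then 2 * (i + j) - 1 - x
  else i + j + k - 1 - x

lemma isThreeClasp_threeClaspMatching {i j k c : ℕ} (hci : c ≤ i) (hij : i ≤ j + c)
    (hc : 2 * c + j = i + k) : IsThreeClasp i j k (threeClaspMatching i j k c) := by
  constructor
  case noncross =>
    intro a b
    unfold threeClaspMatching
    split_ifs <;> omega
  all_goals
    intro x
    unfold threeClaspMatching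
    split_ifs <;> omega

namespace IsThreeClasp

variable {i j k : ℕ} {g : ℕ → ℕ}

lemma mem_arc (h : IsThreeClasp i j k g) {x y : ℕ} (hx : x < i + j + k) (hxy : x < y)
    (hy : y < g x) : x < g y ∧ g y < g x := by
  have hgx := h.lt x hx
  have hym : y < i + j + k := hy.trans hgx
  have e1 := h.invol x hx
  have e2 := h.invol y hym
  have hgy := h.lt y hym
  have n1 : g y ≠ x := by
    intro e
    rw [e] at e2
    omega
  have n2 : g y ≠ g x := by
    intro e
    rw [e] at e2
    omega
  constructor
  · by_contra hcon
    have hcross := h.noncross (g y) x (by omega)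
    rw [e2] at hcross
    exact hcross hxy hy hgx
  · by_contra hcon
    exact h.noncross x y hxy hy (by omega) hgy

lemma not_mem_arc (h : IsThreeClasp i j k g) {x y : ℕ} (hx : x < i + j + k)
    (hy : y < i + j + k) (hxy : y < x ∨ g x < y) (hlt : x < g x) : g y < x ∨ g x < g y := by
  by_contra hcon
  have e1 := h.invol x hx
  have e2 := h.invol y hy
  have n1 : g y ≠ x := by
    intro e
    rw [e] at e2
    omega
  have n2 : g y ≠ g x := by
    intro e
    rw [e] at e2
    omega
  have := h.mem_arc hx (y := g y) (by omega) (by omega)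
  omega

lemma card_eq (h : IsThreeClasp i j k g) {S T : Finset ℕ} (hS : ∀ x ∈ S, x < i + j + k)
    (hT : ∀ x ∈ T, x < i + j + k) (hST : ∀ x ∈ S, g x ∈ T) (hTS : ∀ x ∈ T, g x ∈ S) :
    S.card = T.card :=
  Finset.card_nbij' g g hST hTS (fun x hx ↦ h.invol x (hS x hx)) (fun x hx ↦ h.invol x (hT x hx))

lemma add_eq_left_middle (h : IsThreeClasp i j k g) {x : ℕ} (hx : x < i) (hgx : g x < i + j) :
    x + g x = 2 * i - 1 := by
  have hl := h.left x hx
  have key := h.card_eq (S := Finset.Ioo x i) (T := Finset.Ico i (g x))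
    (by simp only [Finset.mem_Ioo]; omega) (by simp only [Finset.mem_Ico]; omega)
    (by
      simp only [Finset.mem_Ioo, Finset.mem_Ico]
      intro y hy
      have := h.mem_arc (x := x) (y := y) (by omega) (by omega) (by omega)
      have := h.left y hy.2
      omega)
    (by
      simp only [Finset.mem_Ioo, Finset.mem_Ico]
      intro y hy
      have := h.mem_arc (x := x) (y := y) (by omega) (by omega) (by omega)
      have := h.middle y hy.1 (by omega)
      omega)
  simp only [Nat.card_Ioo, Nat.card_Ico] at key
  omega

lemma add_eq_middle_right (h : IsThreeClasp i j k g) {x : ℕ} (hix : i ≤ x) (hx : x < i + j)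
    (hgx : i + j ≤ g x) : x + g x = 2 * (i + j) - 1 := by
  have hl := h.lt x (by omega)
  have key := h.card_eq (S := Finset.Ioo x (i + j)) (T := Finset.Ico (i + j) (g x))
    (by simp only [Finset.mem_Ioo]; omega) (by simp only [Finset.mem_Ico]; omega)
    (by
      simp only [Finset.mem_Ioo, Finset.mem_Ico]
      intro y hy
      have := h.mem_arc (x := x) (y := y) (by omega) (by omega) (by omega)
      have := h.middle y (by omega) hy.2
      omega)
    (by
      simp only [Finset.mem_Ioo, Finset.mem_Ico]
      intro y hy
      have := h.mem_arc (x := x) (y := y) (by omega) (by omega) (by omega)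
      have := h.right y hy.1 (by omega)
      omega)
  simp only [Nat.card_Ioo, Nat.card_Ico] at key
  omega

lemma add_eq_left_right (h : IsThreeClasp i j k g) {x : ℕ} (hx : x < i) (hgx : i + j ≤ g x) :
    x + g x = i + j + k - 1 := by
  have hl := h.lt x (by omega)
  have key := h.card_eq (S := Finset.range x) (T := Finset.Ioo (g x) (i + j + k))
    (by simp only [Finset.mem_range]; omega) (by simp only [Finset.mem_Ioo]; omega)
    (by
      simp only [Finset.mem_range, Finset.mem_Ioo]
      intro y hy
      have := h.not_mem_arc (x := x) (y := y) (by omega) (by omega) (by omega) (by omega)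
      have := h.left y (by omega)
      have := h.lt y (by omega)
      omega)
    (by
      simp only [Finset.mem_range, Finset.mem_Ioo]
      intro y hy
      have := h.not_mem_arc (x := x) (y := y) (by omega) (by omega) (by omega) (by omega)
      have := h.right y (by omega) (by omega)
      omega)
  simp only [Nat.card_Ioo, Finset.card_range] at key
  omega

lemma exists_threshold (h : IsThreeClasp i j k g) :
    ∃ c ≤ i, (∀ x < c, i + j ≤ g x) ∧ ∀ x, c ≤ x → x < i → g x < i + j := by
  classical
  have hex : ∃ n, i ≤ n ∨ g n < i + j := ⟨i, Or.inl le_rfl⟩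
  refine ⟨Nat.find hex, Nat.find_min' hex (Or.inl le_rfl), fun x hx ↦ ?_, fun x hcx hx ↦ ?_⟩
  · have := Nat.find_min hex hx
    omega
  · have hs := Nat.find_spec hex
    rcases hcx.eq_or_lt with e | hlt
    · rw [e] at hs
      omega
    · by_contra hcon
      have h1 := h.left (Nat.find hex) (by omega)
      exact h.noncross (Nat.find hex) x hlt (by omega) (by omega) (h.lt x (by omega))

/-- Every three-block matching is the candidate one. -/
lemma exists_eq_threeClaspMatching (h : IsThreeClasp i j k g) :
    ∃ c ≤ i, i ≤ j + c ∧ 2 * c + j = i + k ∧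
      ∀ x < i + j + k, g x = threeClaspMatching i j k c x := by
  obtain ⟨c, hci, hlow, hhigh⟩ := h.exists_threshold
  have hA : ∀ x < c, g x = i + j + k - 1 - x := fun x hx ↦ by
    have := h.add_eq_left_right (x := x) (by omega) (hlow x hx)
    omega
  have hB : ∀ x, c ≤ x → x < i → g x = 2 * i - 1 - x := fun x hcx hx ↦ by
    have := h.add_eq_left_middle hx (hhigh x hcx hx)
    omega
  have hij : i ≤ j + c := by
    by_contra hcon
    have h1 := hB c le_rfl (by omega)
    have h2 := hhigh c le_rfl (by omega)
    omega
  have hck : c ≤ k := by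
    by_contra hcon
    have h1 := hA (c - 1) (by omega)
    have h2 := hlow (c - 1) (by omega)
    omega
  have hB' : ∀ x, i ≤ x → x < 2 * i - c → g x = 2 * i - 1 - x := fun x hix hx ↦ by
    have h1 := hB (2 * i - 1 - x) (by omega) (by omega)
    have h2 := h.invol (2 * i - 1 - x) (by omega)
    rwa [h1, show 2 * i - 1 - (2 * i - 1 - x) = x by omega] at h2
  have hA' : ∀ x, i + j + k - c ≤ x → x < i + j + k → g x = i + j + k - 1 - x :=
    fun x hix hx ↦ by
    have h1 := hA (i + j + k - 1 - x) (by omega)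
    have h2 := h.invol (i + j + k - 1 - x) (by omega)
    rwa [h1, show i + j + k - 1 - (i + j + k - 1 - x) = x by omega] at h2
  have hM : ∀ x, 2 * i - c ≤ x → x < i + j → i + j ≤ g x ∧ g x = 2 * (i + j) - 1 - x :=
    fun x hix hx ↦ by
    have hr : i + j ≤ g x := by
      by_contra hcon
      have hgi : g x < i := by
        have := h.middle x (by omega) hx
        omega
      have e := h.invol x (by omega)
      rcases lt_or_ge (g x) c with hlt | hge
      · have := hlow _ hlt
        omega
      · have := hB _ hge hgi
        omega
    have := h.add_eq_middle_right (by omega) hx hr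
    exact ⟨hr, by omega⟩
  have hC : ∀ x, i + j ≤ x → x < i + j + k - c → 2 * i - c ≤ g x ∧ x + g x = 2 * (i + j) - 1 :=
    fun x hix hx ↦ by
    have hr := h.right x hix (by omega)
    have e := h.invol x (by omega)
    have hge : 2 * i - c ≤ g x := by
      by_contra hcon
      rcases lt_or_ge (g x) c with hlt | hge
      · have := hA _ hlt
        omega
      · rcases lt_or_ge (g x) i with hi | hi
        · have := hhigh _ hge hi
          omega
        · have := hB' _ hi (by omega)
          omega
    have := (hM (g x) hge hr).2
    exact ⟨hge, by omega⟩
  have hc : 2 * c + j = i + k := by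
    rcases lt_trichotomy (2 * c + j) (i + k) with hlt | heq | hgt
    · have h1 := hC (i + j + k - c - 1) (by omega) (by omega)
      have h2 := h.right (i + j + k - c - 1) (by omega) (by omega)
      omega
    · exact heq
    · have h1 := hM (2 * i - c) le_rfl (by omega)
      have h2 := h.invol (2 * i - c) (by omega)
      have h3 := h.lt (2 * i - c) (by omega)
      have h4 := hA' (g (2 * i - c)) (by omega) h3
      omega
  refine ⟨c, hci, hij, hc, fun x hx ↦ ?_⟩
  unfold threeClaspMatching
  split_ifs with h1 h2 h3
  · exact hA x h1
  · rcases lt_or_ge x i with hi | hi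
    · exact hB x (by omega) hi
    · exact hB' x hi h2
  · rcases lt_or_ge x (i + j) with hi | hi
    · exact (hM x (by omega) hi).2
    · have := (hC x hi h3).2
      omega
  · exact hA' x (by omega) hx

end IsThreeClasp

lemma InClaspedBasis.isThreeClasp {i j k : ℕ} {f : Fin [i, j, k].sum → Fin [i, j, k].sum}
    (hf : InClaspedBasis [i, j, k] f) :
    IsThreeClasp i j k (fun x ↦ if hx : x < [i, j, k].sum then (f ⟨x, hx⟩ : ℕ) else x) := by
  have hs : [i, j, k].sum = i + j + k := by simp [add_assoc]
  obtain ⟨⟨hinv, hne, hcr⟩, hbl⟩ := hf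
  have hval : ∀ x (hx : x < [i, j, k].sum),
      (if hx : x < [i, j, k].sum then (f ⟨x, hx⟩ : ℕ) else x) = f ⟨x, hx⟩ :=
    fun x hx ↦ dif_pos hx
  constructor
  · intro x hx
    rw [← hs] at hx ⊢
    rw [hval x hx]
    exact (f _).2
  · intro x hx
    rw [← hs] at hx
    simp only [hval x hx]
    rw [hval _ (f ⟨x, hx⟩).2, Fin.eta, hinv]
  · intro x hx e
    rw [← hs] at hx
    simp only [hval x hx] at e
    exact hne ⟨x, hx⟩ (Fin.ext e)
  · intro a b hab hba hgab hgb
    rw [← hs] at hgb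
    by_cases hb : b < [i, j, k].sum
    · have ha : a < [i, j, k].sum := hab.trans hb
      simp only [hval a ha, hval b hb] at hba hgab
      exact hcr ⟨a, ha⟩ ⟨b, hb⟩ _ _ hab hba hgab rfl rfl
    · simp only [dif_neg hb] at hgab hgb
      omega
  · intro x hx
    have hx' : x < [i, j, k].sum := by omega
    have := hbl ⟨x, hx'⟩ 0
    simp only [hval x hx']
    generalize (f ⟨x, hx'⟩ : ℕ) = y at this ⊢
    simp at this
    omega
  · intro x hix hx
    have hx' : x < [i, j, k].sum := by omega
    have := hbl ⟨x, hx'⟩ 1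
    simp only [hval x hx']
    generalize (f ⟨x, hx'⟩ : ℕ) = y at this ⊢
    simp at this
    omega
  · intro x hix hx
    have hx' : x < [i, j, k].sum := by omega
    have := hbl ⟨x, hx'⟩ 2
    have hlt := (f ⟨x, hx'⟩).2
    simp only [hval x hx']
    generalize (f ⟨x, hx'⟩ : ℕ) = y at this hlt ⊢
    simp at this
    omega

lemma IsThreeClasp.inClaspedBasis {i j k : ℕ} {g : ℕ → ℕ} (h : IsThreeClasp i j k g)
    {f : Fin [i, j, k].sum → Fin [i, j, k].sum} (hfg : ∀ x, (f x : ℕ) = g x) :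
    InClaspedBasis [i, j, k] f := by
  have hs : [i, j, k].sum = i + j + k := by simp [add_assoc]
  have hlt : ∀ x : Fin [i, j, k].sum, (x : ℕ) < i + j + k := fun x ↦ hs ▸ x.2
  refine ⟨⟨fun x ↦ Fin.ext ?_, fun x e ↦ ?_, ?_⟩, ?_⟩
  · rw [hfg, hfg, h.invol x (hlt x)]
  · exact h.ne x (hlt x) (by rw [← hfg, e])
  · rintro a b c d hab hbc hcd rfl rfl
    have := h.noncross a b hab
    rw [← hfg, ← hfg] at this
    exact this hbc hcd (hlt _)
  · intro x b h1 h2 h3 h4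
    rw [hfg] at h3 h4
    have hx := hlt x
    match b with
    | 0 =>
      have := h.left x
      simp at h1 h2 h3 h4
      omega
    | 1 =>
      have := h.middle x
      simp at h1 h2 h3 h4
      omega
    | 2 =>
      have := h.right x
      simp at h1 h2 h3 h4
      omega
    | b + 3 =>
      simp at h1 h2 h3 h4
      omega

theorem claspedBasis_three_clasps (i j k : ℕ) :
    ((i ≤ j + k ∧ j ≤ i + k ∧ k ≤ i + j ∧ Even (i + j + k)) →
      ∃! f : Fin ([i, j, k].sum) → Fin ([i, j, k].sum), InClaspedBasis [i, j, k] f) ∧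
    (¬(i ≤ j + k ∧ j ≤ i + k ∧ k ≤ i + j ∧ Even (i + j + k)) →
      ∀ f : Fin ([i, j, k].sum) → Fin ([i, j, k].sum), ¬ InClaspedBasis [i, j, k] f) := by
  have hs : [i, j, k].sum = i + j + k := by simp [add_assoc]
  constructor
  · rintro ⟨h1, h2, h3, n, hn⟩
    obtain ⟨c, hc⟩ : ∃ c, 2 * c + j = i + k := ⟨n - j, by omega⟩
    have hg := isThreeClasp_threeClaspMatching (i := i) (j := j) (k := k) (c := c)
      (by omega) (by omega) hc
    refine ⟨fun x ↦ ⟨threeClaspMatching i j k c x, (hg.lt x (x.2.trans_eq hs)).trans_eq hs.symm⟩,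
      hg.inClaspedBasis fun _ ↦ rfl, fun f hf ↦ ?_⟩
    obtain ⟨c', -, -, hc', heq⟩ := hf.isThreeClasp.exists_eq_threeClaspMatching
    obtain rfl : c' = c := by omega
    funext x
    have := heq x (hs ▸ x.2)
    rw [dif_pos x.2] at this
    exact Fin.ext this
  · intro hn f hf
    obtain ⟨c, h1, h2, h3, -⟩ := hf.isThreeClasp.exists_eq_threeClaspMatching
    exact hn ⟨by omega, by omega, by omega, c + j, by omega⟩
end

section
/- Let F be a field, δ ∈ F, and n a natural number. Let TL_n(δ) be the quotient of the free unital associative F-algebra on generators e₁, …, e_{n−1} by the two-sided ideal generated by the relations e_i e_j − e_j e_i for all i, j with |i − j| ≥ 2, e_i e_{i+1} e_i − e_i and e_{i+1} e_i e_{i+1} − e_{i+1} for 1 ≤ i ≤ n−2, and e_i² − δ e_i for 1 ≤ i ≤ n−1. Then TL_n(δ) is a finite-dimensional F-vector space of dimension equal to the n-th Catalan number. -/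
/-- The defining relations of the Temperley–Lieb algebra `TL_n(δ)` on the generators
`e₁, …, e_{n-1}` (indexed here by `Fin (n-1)`):
`eᵢ eⱼ = eⱼ eᵢ` for `|i - j| ≥ 2`, `eᵢ eᵢ₊₁ eᵢ = eᵢ`, `eᵢ₊₁ eᵢ eᵢ₊₁ = eᵢ₊₁`,
and `eᵢ² = δ eᵢ`. -/
inductive TLRel (F : Type) [Field F] (δ : F) (n : ℕ) :
    FreeAlgebra F (Fin (n - 1)) → FreeAlgebra F (Fin (n - 1)) → Prop
  | comm (i j : Fin (n - 1)) (h : (i : ℕ) + 2 ≤ (j : ℕ) ∨ (j : ℕ) + 2 ≤ (i : ℕ)) :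
      TLRel F δ n (FreeAlgebra.ι F i * FreeAlgebra.ι F j)
        (FreeAlgebra.ι F j * FreeAlgebra.ι F i)
  | braid_lo (i j : Fin (n - 1)) (h : (j : ℕ) = (i : ℕ) + 1) :
      TLRel F δ n (FreeAlgebra.ι F i * FreeAlgebra.ι F j * FreeAlgebra.ι F i)
        (FreeAlgebra.ι F i)
  | braid_hi (i j : Fin (n - 1)) (h : (j : ℕ) = (i : ℕ) + 1) :
      TLRel F δ n (FreeAlgebra.ι F j * FreeAlgebra.ι F i * FreeAlgebra.ι F j)
        (FreeAlgebra.ι F j)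
  | idem (i : Fin (n - 1)) :
      TLRel F δ n (FreeAlgebra.ι F i * FreeAlgebra.ι F i) (δ • FreeAlgebra.ι F i)

/-- The Temperley–Lieb algebra `TL_n(δ)`: the quotient of the free unital associative
`F`-algebra on `e₁, …, e_{n-1}` by the two-sided ideal generated by the
Temperley–Lieb relations. -/
def TemperleyLieb (F : Type) [Field F] (δ : F) (n : ℕ) : Type :=
  RingQuot (TLRel F δ n)

noncomputable instance (F : Type) [Field F] (δ : F) (n : ℕ) : Ring (TemperleyLieb F δ n) :=
  inferInstanceAs (Ring (RingQuot (TLRel F δ n)))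

noncomputable instance (F : Type) [Field F] (δ : F) (n : ℕ) :
    Algebra F (TemperleyLieb F δ n) :=
  inferInstanceAs (Algebra F (RingQuot (TLRel F δ n)))

/-- The ballot triangle, in the form in which it counts Temperley–Lieb normal words: `ballot m k`
is the number of normal words in `m` generators all of whose descending runs end below `k`. -/
def ballot : ℕ → ℕ → ℕ
  | 0, _ => 1
  | m + 1, k => ballot m k + ∑ l ∈ Finset.range (min k (m + 1)), ballot m l

theorem ballot_zero_right (m : ℕ) : ballot m 0 = 1 := by
  induction m with
  | zero => rfl
  | succ m ih => simp [ballot, ih]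

theorem ballot_of_le {m k : ℕ} (h : m ≤ k) : ballot m k = ballot m m := by
  induction m generalizing k with
  | zero => rfl
  | succ m ih => simp [ballot, ih (by omega : m ≤ k), ih (by omega : m ≤ m + 1), h]

theorem ballot_succ_succ {m k : ℕ} (h : k ≤ m) :
    ballot (m + 1) (k + 1) = ballot (m + 1) k + ballot m (k + 1) := by
  have h₁ : min (k + 1) (m + 1) = k + 1 := by omega
  have h₂ : min k (m + 1) = k := by omega
  simp only [ballot, h₁, h₂, Finset.sum_range_succ]
  omega

theorem ballot_add_choose {m k : ℕ} (h : k ≤ m) :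
    ballot m (k + 1) + (m + k + 2).choose k = (m + k + 2).choose (k + 1) := by
  induction m generalizing k with
  | zero => obtain rfl : k = 0 := by omega
            simp [ballot]
  | succ m ih =>
    have key : ∀ k ≤ m, ballot (m + 1) (k + 1) + (m + 1 + k + 2).choose k =
        (m + 1 + k + 2).choose (k + 1) := by
      intro k hk
      induction k with
      | zero =>
        have := ih (k := 0) (by omega)
        rw [ballot_succ_succ hk, ballot_zero_right]
        simp at this ⊢
        omega
      | succ k ihk =>
        have h₁ := ihk (by omega)
        have h₂ := ih hk
        rw [ballot_succ_succ hk]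
        have e₁ : (m + 1 + (k + 1) + 2).choose (k + 1) =
          (m + 1 + k + 2).choose k + (m + 1 + k + 2).choose (k + 1) := Nat.choose_succ_succ _ _
        have e₂ : (m + 1 + (k + 1) + 2).choose (k + 1 + 1) =
          (m + 1 + k + 2).choose (k + 1) + (m + 1 + k + 2).choose (k + 1 + 1) :=
          Nat.choose_succ_succ _ _
        rw [show m + (k + 1) + 2 = m + 1 + k + 2 by omega] at h₂
        omega
    rcases Nat.lt_or_ge m k with hk | hk
    · obtain rfl : k = m + 1 := by omega
      have h₁ := key m le_rfl
      rw [ballot_of_le (by omega : m + 1 ≤ m + 1 + 1)]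
      have e₁ : (m + 1 + (m + 1) + 2).choose (m + 1) =
        (m + 1 + m + 2).choose m + (m + 1 + m + 2).choose (m + 1) := Nat.choose_succ_succ _ _
      have e₂ : (m + 1 + (m + 1) + 2).choose (m + 1 + 1) =
        (m + 1 + m + 2).choose (m + 1) + (m + 1 + m + 2).choose (m + 1 + 1) :=
        Nat.choose_succ_succ _ _
      have e₃ : (m + 1 + m + 2).choose (m + 1 + 1) = (m + 1 + m + 2).choose (m + 1) :=
        Nat.choose_symm_of_eq_add (by omega)
      omega
    · exact key k hk

theorem ballot_self (m : ℕ) : ballot m m = catalan (m + 1) := by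
  have h₁ := ballot_add_choose (le_refl m)
  rw [ballot_of_le (by omega : m ≤ m + 1)] at h₁
  have h₂ := succ_mul_catalan_eq_centralBinom (m + 1)
  have h₃ := Nat.choose_succ_right_eq (m + m + 2) m
  rw [Nat.centralBinom, show 2 * (m + 1) = m + m + 2 by omega] at h₂
  rw [show m + m + 2 - m = m + 2 by omega] at h₃
  refine Nat.eq_of_mul_eq_mul_left (show 0 < m + 2 by omega) ?_
  zify at h₁ h₂ h₃ ⊢
  linear_combination (m + 2 : ℤ) * h₁ - h₂ + h₃

/-- The elements `e 0, …, e (N - 1)` satisfy the Temperley–Lieb relations with parameter `δ`. -/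
structure IsTLFamily {F A : Type*} [Field F] [Ring A] [Algebra F A] (δ : F) (N : ℕ)
    (e : ℕ → A) : Prop where
  comm : ∀ i j, i + 2 ≤ j → j < N → e i * e j = e j * e i
  up : ∀ i, i + 1 < N → e i * e (i + 1) * e i = e i
  down : ∀ i, i + 1 < N → e (i + 1) * e i * e (i + 1) = e (i + 1)
  idem : ∀ i < N, e i * e i = δ • e i

/-- The descending product `e (m - 1) * ⋯ * e (l + 1) * e l`. -/
def descProd {A : Type*} [Monoid A] (e : ℕ → A) : ℕ → ℕ → A
  | 0, _ => 1
  | m + 1, l => if l ≤ m then e m * descProd e m l else 1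

/-- Normal words in `e 0, …, e (m - 1)` all of whose descending runs end below `k`. -/
noncomputable def normalWords {A : Type*} [Monoid A] (e : ℕ → A) : ℕ → ℕ → Set A
  | 0, _ => {1}
  | m + 1, k => normalWords e m k ∪
      ⋃ l ∈ Finset.range (min k (m + 1)), (· * descProd e (m + 1) l) '' normalWords e m l

section Monoid

variable {A : Type*} [Monoid A] (e : ℕ → A)

theorem descProd_of_le {m l : ℕ} (h : m ≤ l) : descProd e m l = 1 := by
  cases m with
  | zero => rfl
  | succ m => simp [descProd, show ¬ l ≤ m by omega]

theorem descProd_succ {m l : ℕ} (h : l ≤ m) : descProd e (m + 1) l = e m * descProd e m l := by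
  simp [descProd, h]

theorem descProd_mul_descProd {m i l : ℕ} (h₁ : l ≤ i) (h₂ : i ≤ m) :
    descProd e m i * descProd e i l = descProd e m l := by
  induction m, h₂ using Nat.le_induction with
  | base => simp [descProd_of_le e le_rfl]
  | succ m hm ih => rw [descProd_succ e hm, descProd_succ e (by omega), mul_assoc, ih]

theorem descProd_self_succ (l : ℕ) : descProd e (l + 1) l = e l := by
  rw [descProd_succ e le_rfl, descProd_of_le e le_rfl, mul_one]

theorem descProd_mul {m l : ℕ} (h : l < m) :
    descProd e m (l + 1) * e l = descProd e m l := by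
  rw [← descProd_mul_descProd e (Nat.le_succ l) h, descProd_self_succ]

theorem mem_normalWords_succ {m k : ℕ} {a : A} : a ∈ normalWords e (m + 1) k ↔
    a ∈ normalWords e m k ∨
      ∃ l, (l < k ∧ l ≤ m) ∧ ∃ b ∈ normalWords e m l, b * descProd e (m + 1) l = a := by
  simp [normalWords]

theorem normalWords_mono {m k l : ℕ} (h : k ≤ l) : normalWords e m k ⊆ normalWords e m l := by
  induction m with
  | zero => simp [normalWords]
  | succ m ih =>
    intro a ha
    rw [mem_normalWords_succ] at ha ⊢
    rcases ha with ha | ⟨p, hp, hb⟩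
    · exact Or.inl (ih ha)
    · exact Or.inr ⟨p, by omega, hb⟩

theorem mem_normalWords_or {m k : ℕ} {a : A} (ha : a ∈ normalWords e m k) (l : ℕ) :
    a ∈ normalWords e m l ∨ ∃ j p, l ≤ p ∧ p ≤ j ∧ j < m ∧
      ∃ b ∈ normalWords e j p, b * descProd e (j + 1) p = a := by
  induction m with
  | zero => exact Or.inl ha
  | succ m ih =>
    rw [mem_normalWords_succ] at ha
    rcases ha with ha | ⟨p, hp, hb⟩
    · rcases ih ha with h | ⟨j, p, h₁, h₂, h₃, h⟩
      · exact Or.inl ((mem_normalWords_succ e).2 (Or.inl h))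
      · exact Or.inr ⟨j, p, h₁, h₂, by omega, h⟩
    · rcases lt_or_ge p l with h | h
      · exact Or.inl ((mem_normalWords_succ e).2 (Or.inr ⟨p, by omega, hb⟩))
      · exact Or.inr ⟨m, p, h, hp.2, by omega, hb⟩

theorem finite_normalWords_and_ncard_le (m k : ℕ) :
    (normalWords e m k).Finite ∧ (normalWords e m k).ncard ≤ ballot m k := by
  induction m generalizing k with
  | zero => simp [normalWords, ballot]
  | succ m ih =>
    refine ⟨(ih k).1.union (Set.Finite.biUnion (Finset.finite_toSet _)
      fun l _ => (ih l).1.image _), (Set.ncard_union_le _ _).trans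
      (add_le_add (ih k).2 ((Finset.set_ncard_biUnion_le _ _).trans
        (Finset.sum_le_sum fun l _ => (Set.ncard_image_le (ih l).1).trans (ih l).2)))⟩

end Monoid

namespace IsTLFamily

variable {F A : Type*} [Field F] [Ring A] [Algebra F A] {δ : F} {N : ℕ} {e : ℕ → A}

theorem commute_descProd (he : IsTLFamily δ N e) {m l i : ℕ} (hm : m ≤ N) (h : i + 2 ≤ l) :
    Commute (e i) (descProd e m l) := by
  induction m with
  | zero => exact Commute.one_right _
  | succ m ih =>
    rcases Nat.lt_or_ge m l with hl | hl
    · rw [descProd_of_le e hl]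
      exact Commute.one_right _
    · rw [descProd_succ e hl]
      exact Commute.mul_right (he.comm i m (by omega) hm) (ih (by omega))

theorem descProd_commute (he : IsTLFamily δ N e) {m l j p : ℕ} (hm : m ≤ N) (h : j < l) :
    Commute (descProd e j p) (descProd e m l) := by
  induction j with
  | zero => exact Commute.one_left _
  | succ j ih =>
    rcases Nat.lt_or_ge j p with hl | hl
    · rw [descProd_of_le e hl]
      exact Commute.one_left _
    · rw [descProd_succ e hl]
      exact Commute.mul_left (he.commute_descProd hm h) (ih (by omega))

theorem descProd_mul_self (he : IsTLFamily δ N e) {m l : ℕ} (hm : m ≤ N) (h : l < m) :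
    descProd e m l * e l = δ • descProd e m l := by
  rw [← descProd_mul e h, mul_assoc, he.idem l (by omega), mul_smul_comm]

theorem descProd_mul_of_lt (he : IsTLFamily δ N e) {m l i : ℕ} (hm : m ≤ N) (h : l ≤ i)
    (hi : i + 1 < m) :
    descProd e m l * e (i + 1) = descProd e i l * descProd e m (i + 1) := by
  have hc : Commute (descProd e i l) (e (i + 1)) := by
    have := he.descProd_commute (m := i + 2) (l := i + 1) (j := i) (p := l) (by omega) (by omega)
    rwa [descProd_self_succ] at this
  calc descProd e m l * e (i + 1)
      = descProd e m (i + 2) * (e (i + 1) * e i * (descProd e i l * e (i + 1))) := by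
        rw [← descProd_mul_descProd e (show l ≤ i + 2 by omega) (show i + 2 ≤ m by omega),
          descProd_succ e (show l ≤ i + 1 by omega), descProd_succ e h]
        simp only [mul_assoc]
    _ = descProd e m (i + 2) * (e (i + 1) * e i * e (i + 1)) * descProd e i l := by
        rw [hc.eq]
        simp only [mul_assoc]
    _ = descProd e i l * descProd e m (i + 1) := by
        rw [he.down i (by omega), descProd_mul e hi,
          (he.descProd_commute hm (Nat.lt_succ_self i)).eq]

theorem descProd_mul_descProd_of_lt (he : IsTLFamily δ N e) {m j l p : ℕ} (hm : m ≤ N)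
    (hl : l ≤ p) (hp : p < j) (hj : j < m) :
    descProd e j p * descProd e m l = descProd e j l * descProd e m (p + 2) := by
  have key : descProd e j p * descProd e m p = descProd e j p * descProd e m (p + 2) := by
    induction j, hp using Nat.le_induction with
    | base =>
      rw [Nat.succ_eq_add_one, descProd_self_succ, ← descProd_mul e (show p < m by omega),
        ← descProd_mul e (show p + 1 < m by omega), ← mul_assoc, ← mul_assoc,
        (he.commute_descProd hm (le_refl (p + 2))).eq, mul_assoc, mul_assoc,
        ← mul_assoc (e p), he.up p (by omega)]
    | succ j hpj ih =>
      rw [descProd_succ e (show p ≤ j by omega), mul_assoc, mul_assoc, ih (by omega)]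
  rw [← descProd_mul_descProd e hl (show p ≤ m by omega), ← mul_assoc, key, mul_assoc,
    ← (he.descProd_commute hm (show p < p + 2 by omega)).eq, ← mul_assoc,
    descProd_mul_descProd e hl hp.le]

end IsTLFamily

section Algebra

variable {F A : Type*} [Field F] [Ring A] [Algebra F A]

theorem Algebra.adjoin_le_of_mul_mem {s : Set A} {Q : Submodule F A} (h_one : 1 ∈ Q)
    (h_mul : ∀ q ∈ Q, ∀ x ∈ s, q * x ∈ Q) : (Algebra.adjoin F s).toSubmodule ≤ Q := by
  intro x hx
  have key : ∀ q ∈ Q, q * x ∈ Q := by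
    induction hx using Algebra.adjoin_induction with
    | mem x hx => exact fun q hq => h_mul q hq x hx
    | algebraMap r =>
      intro q hq
      rw [← Algebra.commutes, ← Algebra.smul_def]
      exact Q.smul_mem r hq
    | add x y _ _ hx hy =>
      intro q hq
      rw [mul_add]
      exact Q.add_mem (hx q hq) (hy q hq)
    | mul x y _ _ hx hy =>
      intro q hq
      rw [← mul_assoc]
      exact hy _ (hx q hq)
  simpa using key 1 h_one

/-- The subalgebra generated by `e 0, …, e (m - 1)`. -/
def adjoinBelow (F : Type*) {A : Type*} [Field F] [Ring A] [Algebra F A] (e : ℕ → A) (m : ℕ) :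
    Subalgebra F A :=
  Algebra.adjoin F (e '' Set.Iio m)

variable {e : ℕ → A}

theorem mem_adjoinBelow {m i : ℕ} (h : i < m) : e i ∈ adjoinBelow F e m :=
  Algebra.subset_adjoin ⟨i, h, rfl⟩

theorem adjoinBelow_mono {m n : ℕ} (h : m ≤ n) : adjoinBelow F e m ≤ adjoinBelow F e n :=
  Algebra.adjoin_mono (Set.image_mono (Set.Iio_subset_Iio h))

theorem descProd_mem_adjoinBelow (m l : ℕ) : descProd e m l ∈ adjoinBelow F e m := by
  induction m with
  | zero => exact one_mem _
  | succ m ih =>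
    rcases Nat.lt_or_ge m l with hl | hl
    · rw [descProd_of_le e hl]
      exact one_mem _
    · rw [descProd_succ e hl]
      exact mul_mem (mem_adjoinBelow m.lt_succ_self) (adjoinBelow_mono m.le_succ ih)

theorem normalWords_subset_adjoinBelow (m k : ℕ) :
    normalWords e m k ⊆ adjoinBelow F e m := by
  induction m generalizing k with
  | zero =>
    rintro _ rfl
    exact one_mem _
  | succ m ih =>
    intro a ha
    rcases (mem_normalWords_succ e).1 ha with ha | ⟨l, _, b, hb, rfl⟩
    · exact adjoinBelow_mono m.le_succ (ih k ha)
    · exact mul_mem (adjoinBelow_mono m.le_succ (ih l hb)) (descProd_mem_adjoinBelow _ _)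

end Algebra

namespace IsTLFamily

variable {F A : Type*} [Field F] [Ring A] [Algebra F A] {δ : F} {N : ℕ} {e : ℕ → A}

theorem adjoinBelow_succ_le (he : IsTLFamily δ N e) {m : ℕ} (hm : m < N) :
    (adjoinBelow F e (m + 1)).toSubmodule ≤
      Submodule.span F {x | ∃ a ∈ adjoinBelow F e m, ∃ l, a * descProd e (m + 1) l = x} := by
  refine Algebra.adjoin_le_of_mul_mem (Submodule.subset_span ⟨1, one_mem _, m + 1, ?_⟩) ?_
  · rw [descProd_of_le e le_rfl, mul_one]
  intro q hq x hx
  obtain ⟨i, hi, rfl⟩ := hx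
  replace hi : i < m + 1 := hi
  induction hq using Submodule.span_induction with
  | zero => simp
  | add x y _ _ hx hy =>
    rw [add_mul]
    exact Submodule.add_mem _ hx hy
  | smul r x _ hx =>
    rw [smul_mul_assoc]
    exact Submodule.smul_mem _ r hx
  | mem x hx =>
    obtain ⟨a, ha, l, rfl⟩ := hx
    wlog hl : l ≤ m + 1 generalizing l
    · have := this (m + 1) le_rfl
      rwa [descProd_of_le e le_rfl, ← descProd_of_le e (show m + 1 ≤ l by omega)] at this
    rw [mul_assoc]
    rcases (by omega : i + 1 = l ∨ i = l ∨ i + 2 ≤ l ∨ l < i) with h | rfl | h | h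
    · subst h
      rw [descProd_mul e hi]
      exact Submodule.subset_span ⟨a, ha, i, rfl⟩
    · rw [he.descProd_mul_self hm hi, mul_smul_comm]
      exact Submodule.smul_mem _ _ (Submodule.subset_span ⟨a, ha, i, rfl⟩)
    · rw [← (he.commute_descProd hm h).eq, ← mul_assoc]
      exact Submodule.subset_span ⟨_, mul_mem ha (mem_adjoinBelow (by omega)), l, rfl⟩
    · obtain ⟨i, rfl⟩ : ∃ j, i = j + 1 := ⟨i - 1, by omega⟩
      rw [he.descProd_mul_of_lt hm (by omega) hi, ← mul_assoc]
      exact Submodule.subset_span ⟨_, mul_mem ha (adjoinBelow_mono (by omega)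
        (descProd_mem_adjoinBelow _ _)), i + 1, rfl⟩

theorem adjoinBelow_le_span (he : IsTLFamily δ N e) {m : ℕ} (hm : m ≤ N) :
    (adjoinBelow F e m).toSubmodule ≤ Submodule.span F (normalWords e m m) := by
  induction m with
  | zero =>
    refine Algebra.adjoin_le_of_mul_mem (Submodule.subset_span rfl) ?_
    rintro q - x ⟨i, hi, -⟩
    exact absurd hi (Nat.not_lt_zero i)
  | succ m ih =>
    refine (he.adjoinBelow_succ_le hm).trans (Submodule.span_le.2 ?_)
    rintro _ ⟨a, ha, l, rfl⟩
    induction hd : m + 1 - l using Nat.strong_induction_on generalizing a l with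
    | _ d IH =>
    replace ha := ih (by omega) ha
    induction ha using Submodule.span_induction with
    | zero => simp
    | add x y _ _ hx hy =>
      rw [add_mul]
      exact Submodule.add_mem _ hx hy
    | smul r x _ hx =>
      rw [smul_mul_assoc]
      exact Submodule.smul_mem _ r hx
    | mem a ha =>
      rcases Nat.lt_or_ge m l with hl | hl
      · rw [descProd_of_le e hl, mul_one]
        exact Submodule.subset_span
          ((mem_normalWords_succ e).2 (Or.inl (normalWords_mono e m.le_succ ha)))
      rcases mem_normalWords_or e ha l with h | ⟨j, p, hlp, hpj, hjm, b, hb, rfl⟩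
      · exact Submodule.subset_span
          ((mem_normalWords_succ e).2 (Or.inr ⟨l, by omega, a, h, rfl⟩))
      · rw [mul_assoc, he.descProd_mul_descProd_of_lt hm hlp (by omega) (by omega), ← mul_assoc]
        exact IH _ (by omega) _ (mul_mem (adjoinBelow_mono hjm.le
          (normalWords_subset_adjoinBelow j p hb))
          (adjoinBelow_mono hjm (descProd_mem_adjoinBelow _ _))) _ rfl

theorem finrank_le_ballot (he : IsTLFamily δ N e) (h_top : adjoinBelow F e N = ⊤) :
    FiniteDimensional F A ∧ Module.finrank F A ≤ ballot N N := by
  have h_span : Submodule.span F (normalWords e N N) = ⊤ := by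
    rw [eq_top_iff, ← Algebra.top_toSubmodule, ← h_top]
    exact he.adjoinBelow_le_span le_rfl
  obtain ⟨h_fin, h_card⟩ := finite_normalWords_and_ncard_le e N N
  refine ⟨Module.finite_def.2 (Submodule.fg_def.2 ⟨_, h_fin, h_span⟩), ?_⟩
  have := h_fin.fintype
  rw [← finrank_top, ← h_span]
  refine (finrank_span_le_card _).trans ?_
  rwa [← Set.ncard_eq_toFinset_card']

end IsTLFamily

/-- Perfect matchings of the integers, as fixed-point-free involutions. -/
@[ext] structure IntMatching where
  /-- The partner of a point. -/
  toFun : ℤ → ℤ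
  invol : ∀ x, toFun (toFun x) = x
  ne_self : ∀ x, toFun x ≠ x

namespace IntMatching

instance : CoeFun IntMatching fun _ => ℤ → ℤ := ⟨toFun⟩

attribute [simp] invol ne_self

/-- The matching of `x` with `-1 - x`, i.e. the identity Temperley–Lieb diagram. -/
def base : IntMatching where
  toFun x := -1 - x
  invol x := by omega
  ne_self x := by omega

/-- Place a cup on `i, i + 1` and join the former partners of these two points. -/
def cup (i : ℤ) (f : IntMatching) : IntMatching where
  toFun x := if x = i then i + 1 else if x = i + 1 then i else
    if x = f i then f (i + 1) else if x = f (i + 1) then f i else f x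
  invol x := by have := f.invol; have := f.ne_self; grind
  ne_self x := by have := f.invol; have := f.ne_self; grind

theorem cup_apply (i : ℤ) (f : IntMatching) (x : ℤ) :
    cup i f x = if x = i then i + 1 else if x = i + 1 then i else
      if x = f i then f (i + 1) else if x = f (i + 1) then f i else f x := rfl

theorem cup_of_apply_eq {i : ℤ} {f : IntMatching} (h : f i = i + 1) : cup i f = f := by
  ext x
  have := f.invol
  rw [cup_apply]; grind

theorem cup_cup (i : ℤ) (f : IntMatching) : cup i (cup i f) = cup i f :=
  cup_of_apply_eq (by simp [cup_apply])

theorem cup_up (i : ℤ) (f : IntMatching) : cup i (cup (i+1) (cup i f)) = cup i f := by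
  ext x
  have := f.invol; have := f.ne_self
  simp only [cup_apply]; grind

theorem cup_down (i : ℤ) (f : IntMatching) : cup (i+1) (cup i (cup (i+1) f)) = cup (i+1) f := by
  ext x
  have := f.invol; have := f.ne_self
  simp only [cup_apply]; grind

theorem cup_comm {i j : ℤ} (h : i + 2 ≤ j) (f : IntMatching) :
    cup i (cup j f) = cup j (cup i f) := by
  ext x
  have := f.invol; have := f.ne_self
  simp only [cup_apply]; grind (splits := 24)

section Weight

variable {F : Type*} [Field F] (δ : F)

/-- The scalar produced when a cap on `i, i + 1` meets the matching `f`. -/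
def weight (i : ℤ) (f : IntMatching) : F := if f i = i + 1 then δ else 1

theorem weight_of_ne {i : ℤ} {f : IntMatching} (h : f i ≠ i + 1) : weight δ i f = 1 := if_neg h

theorem weight_cup_self (i : ℤ) (f : IntMatching) : weight δ i (cup i f) = δ :=
  if_pos (by simp [cup_apply])

theorem weight_cup_succ (i : ℤ) (f : IntMatching) : weight δ i (cup (i + 1) f) = 1 := by
  refine weight_of_ne δ fun h => ?_
  have h₁ := (cup (i + 1) f).invol i
  rw [h, show cup (i + 1) f (i + 1) = i + 1 + 1 by simp [cup_apply]] at h₁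
  omega

theorem weight_succ_cup (i : ℤ) (f : IntMatching) : weight δ (i + 1) (cup i f) = 1 := by
  refine weight_of_ne δ ?_
  simp only [cup_apply]
  grind

theorem weight_mul_weight_cup {i j : ℤ} (h : i + 2 ≤ j) (f : IntMatching) :
    weight δ j f * weight δ i (cup j f) = weight δ i f * weight δ j (cup i f) := by
  have := f.invol; have := f.ne_self
  simp only [weight, cup_apply]
  grind (splits := 24)

/-- The action of a Temperley–Lieb generator on the free module on matchings. -/
noncomputable def cupHom (i : ℤ) : Module.End F (IntMatching →₀ F) :=
  Finsupp.linearCombination F fun f => Finsupp.single (cup i f) (weight δ i f)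

theorem cupHom_single (i : ℤ) (f : IntMatching) (a : F) :
    cupHom δ i (Finsupp.single f a) = Finsupp.single (cup i f) (a * weight δ i f) := by
  simp [cupHom]

theorem isTLFamily_cupHom (N : ℕ) : IsTLFamily δ N fun i : ℕ => cupHom δ (i : ℤ) where
  comm i j h _ := by
    refine Finsupp.lhom_ext fun f a => ?_
    simp only [Module.End.mul_apply, cupHom_single, mul_assoc]
    rw [weight_mul_weight_cup δ (by omega), cup_comm (by omega)]
  up i _ := by
    refine Finsupp.lhom_ext fun f a => ?_
    push_cast
    simp only [Module.End.mul_apply, cupHom_single, weight_cup_succ, weight_succ_cup, cup_up,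
      mul_one]
  down i _ := by
    refine Finsupp.lhom_ext fun f a => ?_
    push_cast
    simp only [Module.End.mul_apply, cupHom_single, weight_cup_succ, weight_succ_cup, cup_down,
      mul_one]
  idem i _ := by
    refine Finsupp.lhom_ext fun f a => ?_
    simp only [Module.End.mul_apply, LinearMap.smul_apply, cupHom_single, weight_cup_self, cup_cup,
      Finsupp.smul_single, smul_eq_mul, mul_comm δ]

end Weight

/-- Points beyond `m` are joined as in the identity diagram. -/
def TrivialBeyond (m : ℕ) (f : IntMatching) : Prop := ∀ j : ℤ, m < j → f j = -1 - j

/-- All cups at nonnegative positions start below `k`. -/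
def CupsBelow (k : ℕ) (f : IntMatching) : Prop := ∀ j : ℤ, k ≤ j → f j ≠ j + 1

/-- Place cups successively on `l + t - 1, …, l + 1, l`. -/
def cupRun : ℕ → ℕ → IntMatching → IntMatching
  | _, 0, f => f
  | l, t + 1, f => cup l (cupRun (l + 1) t f)

theorem cupRun_succ_apply (l t : ℕ) (f : IntMatching) : cupRun l (t + 1) f l = l + 1 := by
  simp [cupRun, cup_apply]

theorem cup_injOn (m : ℕ) : Set.InjOn (cup m) {f | TrivialBeyond m f} := by
  intro f hf g hg h
  replace hf : f (m + 1) = -1 - (m + 1) := hf _ (by omega)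
  replace hg : g (m + 1) = -1 - (m + 1) := hg _ (by omega)
  have hv : ∀ x, cup m f x = cup m g x := fun x => by rw [h]
  have := f.invol; have := f.ne_self; have := g.invol; have := g.ne_self
  have h₁ : f m = g m := by
    have := hv (-1 - (m + 1))
    simp only [cup_apply] at this
    grind
  ext x
  have := hv x
  simp only [cup_apply] at this
  grind (splits := 20)

theorem cupRun_injOn (l t : ℕ) :
    Set.InjOn (cupRun l (t + 1)) {f | TrivialBeyond (l + t) f} := by
  induction t generalizing l with
  | zero => exact cup_injOn l
  | succ t ih =>
    intro f hf g hg h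
    rw [show l + (t + 1) = l + 1 + t by omega] at hf hg
    refine ih (l + 1) hf hg ?_
    have key : ∀ f, cup (l + 1) (cupRun l (t + 1 + 1) f) = cupRun (l + 1) (t + 1) f := fun f => by
      have := cup_down l (cupRun (l + 1 + 1) t f)
      simpa [cupRun] using this
    rw [← key f, ← key g, h]

theorem cupRun_spec {l₀ l t : ℕ} (hl : l₀ ≤ l) {f : IntMatching} (hf : TrivialBeyond (l + t) f)
    (hc : CupsBelow l₀ f) :
    TrivialBeyond (l + t + 1) (cupRun l (t + 1) f) ∧
    CupsBelow (l + 1) (cupRun l (t + 1) f) ∧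
    (∀ j : ℤ, l₀ ≤ j → j + 2 ≤ l → cupRun l (t + 1) f j ≠ j + 1) ∧
    (l₀ < l → cupRun l (t + 1) f (l - 1) ≠ l + 2) ∧
    (0 < t → cupRun l (t + 1) f (-2 - (l + t)) ≠ l + t + 1) ∧
    (t = 0 → l₀ < l → cupRun l (t + 1) f (-2 - (l + t)) ≠ l - 1) := by
  induction t generalizing l with
  | zero =>
    simp only [cupRun, TrivialBeyond, CupsBelow] at *
    have := f.invol; have := f.ne_self
    have h₁ := hf (l + 1) (by omega)
    have h₂ := this (l + 1)
    refine ⟨?_, ?_, ?_, ?_, ?_, ?_⟩ <;> simp only [cup_apply]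
    · grind
    · grind
    · grind
    · grind
    · grind
    · grind
  | succ t ih =>
    obtain ⟨h₁, h₂, h₃, h₄, h₅, h₆⟩ := ih (l := l + 1) (by omega)
      (by rwa [show l + 1 + t = l + (t + 1) by omega])
    have hs := cupRun_succ_apply (l + 1) t f
    rw [cupRun]
    generalize cupRun (l + 1) (t + 1) f = g at *
    have := g.invol; have := g.ne_self
    simp only [TrivialBeyond, CupsBelow] at *
    push_cast at *
    refine ⟨?_, ?_, ?_, ?_, ?_, ?_⟩ <;> simp only [cup_apply]
    · grind
    · grind
    · grind
    · grind
    · grind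
    · grind

open Classical in
/-- The matchings obtained from `base` by the normal words in `m` generators all of whose runs end
below `k`. -/
noncomputable def normalMatchings : ℕ → ℕ → Finset IntMatching
  | 0, _ => {base}
  | m + 1, k => normalMatchings m k ∪
      (Finset.range (min k (m + 1))).biUnion fun l =>
        (normalMatchings m l).image (cupRun l (m - l + 1))

theorem mem_normalMatchings_succ {m k : ℕ} {f : IntMatching} : f ∈ normalMatchings (m + 1) k ↔
    f ∈ normalMatchings m k ∨
      ∃ l, (l < k ∧ l < m + 1) ∧ ∃ g ∈ normalMatchings m l, cupRun l (m - l + 1) g = f := by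
  simp [normalMatchings]

theorem normalMatchings_spec {m k : ℕ} {f : IntMatching} (hf : f ∈ normalMatchings m k) :
    TrivialBeyond m f ∧ CupsBelow k f := by
  induction m generalizing k f with
  | zero =>
    obtain rfl : f = base := by simpa [normalMatchings] using hf
    refine ⟨fun j _ => rfl, fun j hj => ?_⟩
    change -1 - j ≠ j + 1
    omega
  | succ m ih =>
    rcases mem_normalMatchings_succ.1 hf with hf | ⟨l, hl, g, hg, rfl⟩
    · exact ⟨fun j hj => (ih hf).1 j (by push_cast at hj; omega), (ih hf).2⟩
    · have hm : l + (m - l) = m := by omega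
      have := cupRun_spec (t := m - l) le_rfl (by rw [hm]; exact (ih hg).1) (ih hg).2
      rw [hm] at this
      exact ⟨this.1, fun j hj => this.2.1 j (by push_cast; omega)⟩

theorem cupRun_ne {m k l : ℕ} (hl : l ≤ m) {f g : IntMatching} (hf : f ∈ normalMatchings m k)
    (hg : g ∈ normalMatchings m l) : cupRun l (m - l + 1) g ≠ f := by
  obtain ⟨t, rfl⟩ := Nat.exists_eq_add_of_le hl
  rw [Nat.add_sub_cancel_left]
  rintro rfl
  have hs := cupRun_succ_apply l t g
  obtain ⟨-, -, -, -, h₅, -⟩ :=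
    cupRun_spec le_rfl (normalMatchings_spec hg).1 (normalMatchings_spec hg).2
  have h := (normalMatchings_spec hf).1 (l + t + 1) (by push_cast; omega)
  generalize cupRun l (t + 1) g = f at *
  rcases Nat.eq_zero_or_pos t with rfl | ht
  · have := f.invol l
    rw [hs] at this
    simp at h
    omega
  · apply h₅ ht
    rw [← f.invol (l + t + 1), h]
    congr 1
    omega

theorem card_normalMatchings (m k : ℕ) : (normalMatchings m k).card = ballot m k := by
  classical
  induction m generalizing k with
  | zero => rfl
  | succ m ih =>
    rw [normalMatchings, Finset.card_union_of_disjoint, Finset.card_biUnion, ballot, ih]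
    · congr 1
      refine Finset.sum_congr rfl fun l hl => ?_
      rw [Finset.card_image_of_injOn, ih]
      have hm : l + (m - l) = m := by
        have := Finset.mem_range.1 hl
        omega
      refine (cupRun_injOn l (m - l)).mono fun f hf => ?_
      rw [hm]
      exact (normalMatchings_spec hf).1
    · intro l hl l' hl' hne
      refine Finset.disjoint_left.2 fun f hf hf' => ?_
      obtain ⟨g, hg, rfl⟩ := Finset.mem_image.1 hf
      obtain ⟨g', hg', h⟩ := Finset.mem_image.1 hf'
      rw [SetLike.mem_coe, Finset.mem_range] at hl hl'
      have cups_below : ∀ {l g}, l < min k (m + 1) → g ∈ normalMatchings m l →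
          CupsBelow (l + 1) (cupRun l (m - l + 1) g) := fun hl hg =>
        (normalMatchings_spec (mem_normalMatchings_succ.2
          (Or.inr ⟨_, ⟨Nat.lt_succ_self _, by omega⟩, _, hg, rfl⟩))).2
      rcases Nat.lt_or_gt_of_ne hne with hlt | hlt
      · refine cups_below hl hg l' (by exact_mod_cast hlt) ?_
        rw [← h]
        exact cupRun_succ_apply _ _ _
      · refine cups_below hl' hg' l (by exact_mod_cast hlt) ?_
        rw [h]
        exact cupRun_succ_apply _ _ _
    · refine Finset.disjoint_left.2 fun f hf hf' => ?_
      obtain ⟨l, hl, hf'⟩ := Finset.mem_biUnion.1 hf'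
      obtain ⟨g, hg, h⟩ := Finset.mem_image.1 hf'
      have := Finset.mem_range.1 hl
      exact cupRun_ne (by omega) hf hg h

section Reachable

variable {F : Type*} [Field F] {δ : F} {N : ℕ} {V : Submodule F (IntMatching →₀ F)}

theorem single_cupRun_mem (hV : ∀ i < N, ∀ v ∈ V, cupHom δ (i : ℕ) v ∈ V) {l t : ℕ}
    (h : l + t < N) {f : IntMatching} (hf : TrivialBeyond (l + t) f)
    (hfV : Finsupp.single f 1 ∈ V) : Finsupp.single (cupRun l (t + 1) f) 1 ∈ V := by
  induction t generalizing l with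
  | zero =>
    have := hV l h _ hfV
    rw [cupHom_single, weight_of_ne, mul_one] at this
    · exact this
    · intro h
      have h₁ := hf (l + 1) (by simp)
      have h₂ := f.invol l
      rw [h] at h₂
      omega
  | succ t ih =>
    have := hV l (by omega) _ (ih (l := l + 1) (by omega)
      (by rwa [show l + 1 + t = l + (t + 1) by omega]))
    rw [cupHom_single, weight_of_ne, mul_one] at this
    · exact this
    · intro h
      have h₁ := cupRun_succ_apply (l + 1) t f
      have h₂ := (cupRun (l + 1) (t + 1) f).invol l
      rw [h] at h₂
      push_cast at h₁
      omega

theorem single_mem_of_mem_normalMatchings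
    (hV : ∀ i < N, ∀ v ∈ V, cupHom δ (i : ℕ) v ∈ V) (h_base : Finsupp.single base 1 ∈ V)
    {m k : ℕ} (hm : m ≤ N) {f : IntMatching} (hf : f ∈ normalMatchings m k) :
    Finsupp.single f 1 ∈ V := by
  induction m generalizing k f with
  | zero =>
    obtain rfl : f = base := by simpa [normalMatchings] using hf
    exact h_base
  | succ m ih =>
    rcases mem_normalMatchings_succ.1 hf with hf | ⟨l, hl, g, hg, rfl⟩
    · exact ih (by omega) hf
    · refine single_cupRun_mem hV (by omega) ?_ (ih (by omega) hg)
      rw [show l + (m - l) = m by omega]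
      exact (normalMatchings_spec hg).1

theorem ballot_le_finrank [FiniteDimensional F V]
    (hV : ∀ i < N, ∀ v ∈ V, cupHom δ (i : ℕ) v ∈ V) (h_base : Finsupp.single base 1 ∈ V) :
    ballot N N ≤ Module.finrank F V := by
  have h_mem (f : normalMatchings N N) : Finsupp.single f.1 1 ∈ V :=
    single_mem_of_mem_normalMatchings hV h_base le_rfl f.2
  have h_ind : LinearIndependent F fun f : normalMatchings N N =>
      (⟨Finsupp.single f.1 1, h_mem f⟩ : V) := by
    refine LinearIndependent.of_comp V.subtype ?_
    exact (Finsupp.linearIndependent_single_one F IntMatching).comp _ Subtype.val_injective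
  simpa [card_normalMatchings] using h_ind.fintype_card_le_finrank

end Reachable

end IntMatching

namespace TemperleyLieb

variable {F : Type} [Field F] {δ : F} {n : ℕ}

/-- The quotient map onto the Temperley–Lieb algebra. -/
noncomputable def mk (F : Type) [Field F] (δ : F) (n : ℕ) :
    FreeAlgebra F (Fin (n - 1)) →ₐ[F] TemperleyLieb F δ n :=
  RingQuot.mkAlgHom F (TLRel F δ n)

theorem mk_rel {x y : FreeAlgebra F (Fin (n - 1))} (h : TLRel F δ n x y) :
    mk F δ n x = mk F δ n y :=
  RingQuot.mkAlgHom_rel F h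

theorem mk_surjective : Function.Surjective (mk F δ n) :=
  RingQuot.mkAlgHom_surjective F _

/-- The generator `e i` of the Temperley–Lieb algebra, with junk value `0` out of range. -/
noncomputable def gen (F : Type) [Field F] (δ : F) (n i : ℕ) : TemperleyLieb F δ n :=
  if h : i < n - 1 then mk F δ n (FreeAlgebra.ι F ⟨i, h⟩) else 0

theorem gen_of_lt {i : ℕ} (h : i < n - 1) :
    gen F δ n i = mk F δ n (FreeAlgebra.ι F ⟨i, h⟩) := dif_pos h

theorem isTLFamily_gen : IsTLFamily δ (n - 1) (gen F δ n) where
  comm i j hij hj := by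
    rw [gen_of_lt hj, gen_of_lt (show i < n - 1 by omega)]
    simpa only [map_mul] using mk_rel
      (TLRel.comm (δ := δ) (⟨i, by omega⟩ : Fin (n - 1)) ⟨j, hj⟩ (Or.inl hij))
  up i hi := by
    rw [gen_of_lt hi, gen_of_lt (show i < n - 1 by omega)]
    simpa only [map_mul] using mk_rel
      (TLRel.braid_lo (δ := δ) (⟨i, by omega⟩ : Fin (n - 1)) ⟨i + 1, hi⟩ rfl)
  down i hi := by
    rw [gen_of_lt hi, gen_of_lt (show i < n - 1 by omega)]
    simpa only [map_mul] using mk_rel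
      (TLRel.braid_hi (δ := δ) (⟨i, by omega⟩ : Fin (n - 1)) ⟨i + 1, hi⟩ rfl)
  idem i hi := by
    rw [gen_of_lt hi]
    simpa only [map_mul, map_smul] using mk_rel
      (TLRel.idem (δ := δ) (⟨i, hi⟩ : Fin (n - 1)))

theorem adjoinBelow_gen : adjoinBelow F (gen F δ n) (n - 1) = ⊤ := by
  have h_range : (gen F δ n '' Set.Iio (n - 1)) =
      mk F δ n '' Set.range (FreeAlgebra.ι F) := by
    ext x
    constructor
    · rintro ⟨i, hi, rfl⟩
      exact ⟨_, ⟨⟨i, hi⟩, rfl⟩, (gen_of_lt hi).symm⟩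
    · rintro ⟨_, ⟨i, rfl⟩, rfl⟩
      exact ⟨i, i.2, gen_of_lt i.2⟩
  have h_map := AlgHom.map_adjoin (mk F δ n) (Set.range (FreeAlgebra.ι F))
  rw [FreeAlgebra.adjoin_range_ι, Algebra.map_top,
    (AlgHom.range_eq_top _).2 mk_surjective, ← h_range] at h_map
  exact h_map.symm

/-- The algebra homomorphism out of the Temperley–Lieb algebra given by a family satisfying the
Temperley–Lieb relations. -/
noncomputable def lift {B : Type*} [Ring B] [Algebra F B] {e : ℕ → B}
    (he : IsTLFamily δ (n - 1) e) : TemperleyLieb F δ n →ₐ[F] B :=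
  RingQuot.liftAlgHom F ⟨FreeAlgebra.lift F fun i : Fin (n - 1) => e i, by
    intro x y h
    induction h with
    | comm i j h =>
      simp only [map_mul, FreeAlgebra.lift_ι_apply]
      rcases h with h | h
      · exact he.comm i j h j.2
      · exact (he.comm j i h i.2).symm
    | braid_lo i j h =>
      simp only [map_mul, FreeAlgebra.lift_ι_apply, h]
      exact he.up i (by omega)
    | braid_hi i j h =>
      simp only [map_mul, FreeAlgebra.lift_ι_apply, h]
      exact he.down i (by omega)
    | idem i =>
      simp only [map_mul, map_smul, FreeAlgebra.lift_ι_apply]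
      exact he.idem i i.2⟩

theorem lift_gen {B : Type*} [Ring B] [Algebra F B] {e : ℕ → B}
    (he : IsTLFamily δ (n - 1) e) {i : ℕ} (hi : i < n - 1) : lift he (gen F δ n i) = e i := by
  rw [gen_of_lt hi]
  exact (RingQuot.liftAlgHom_mkAlgHom_apply F _ _ _).trans (FreeAlgebra.lift_ι_apply _ _)

theorem ballot_le_finrank [FiniteDimensional F (TemperleyLieb F δ n)] :
    ballot (n - 1) (n - 1) ≤ Module.finrank F (TemperleyLieb F δ n) := by
  let φ := lift (n := n) (IntMatching.isTLFamily_cupHom δ (n - 1))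
  let orbit : TemperleyLieb F δ n →ₗ[F] IntMatching →₀ F :=
    (LinearMap.applyₗ (Finsupp.single IntMatching.base 1)).comp φ.toLinearMap
  refine (IntMatching.ballot_le_finrank (δ := δ) (V := LinearMap.range orbit) ?_ ?_).trans
    (LinearMap.finrank_range_le orbit)
  · rintro i hi _ ⟨a, rfl⟩
    refine ⟨gen F δ n i * a, ?_⟩
    change φ (gen F δ n i * a) _ = IntMatching.cupHom δ i (φ a _)
    rw [map_mul, lift_gen _ hi]
    rfl
  · refine ⟨1, ?_⟩
    change φ 1 _ = _
    rw [map_one]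
    rfl

end TemperleyLieb

theorem temperleyLieb_finrank_eq_catalan (F : Type) [Field F] (δ : F) (n : ℕ) :
    FiniteDimensional F (TemperleyLieb F δ n) ∧
      Module.finrank F (TemperleyLieb F δ n) = catalan n := by
  obtain ⟨h_fin, h_le⟩ :=
    (TemperleyLieb.isTLFamily_gen (F := F) (δ := δ) (n := n)).finrank_le_ballot
      TemperleyLieb.adjoinBelow_gen
  have h_eq := h_le.antisymm TemperleyLieb.ballot_le_finrank
  refine ⟨h_fin, h_eq.trans ?_⟩
  rcases n with - | n
  · rw [ballot_self]
    simp
  · exact ballot_self n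
end

section
/- Let F be a field, let v ∈ F be nonzero, and suppose that the quantum integers [k] = (v^k − v^{−k})/(v − v^{−1}) are nonzero for all k with 1 ≤ k ≤ n (in particular v² ≠ 1). Set δ = −(v + v^{−1}) and let TL_n(δ) be the Temperley–Lieb algebra as presented below. Then there exists a unique element p ∈ TL_n(δ) such that p ≠ 0, p² = p, and e_i p = p e_i = 0 for all i = 1, …, n−1 (the Jones–Wenzl idempotent). -/
/-- The image of the generator `eᵢ` in the Temperley–Lieb algebra. -/
noncomputable def TLgen (F : Type) [Field F] (δ : F) (n : ℕ) (i : Fin (n - 1)) :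
    TemperleyLieb F δ n :=
  RingQuot.mkAlgHom F (TLRel F δ n) (FreeAlgebra.ι F i)

/-- The quantum integer `[k]`, defined by the recursion
`[0] = 0`, `[1] = 1`, `[k+2] = (v + v⁻¹)[k+1] - [k]`
(equal to `(v^k - v^{-k})/(v - v^{-1})` whenever `v - v⁻¹ ≠ 0`). -/
def qInt {F : Type} [Field F] (v : F) : ℕ → F
  | 0 => 0
  | 1 => 1
  | (k + 2) => (v + v⁻¹) * qInt v (k + 1) - qInt v k

/-- A step in the Jones–Wenzl recursion: `P` is an idempotent killed by `e₀, …, e_{m-1}`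
and commuting with `e_{m+1}, e_{m+2}, …`, while `Q` plays the role of its predecessor, through
which `eₘ P eₘ` is expressed. -/
structure IsJonesWenzlPair {F A : Type*} [Field F] [Ring A] [Algebra F A] (e : ℕ → A) (r : F)
    (m : ℕ) (P Q : A) : Prop where
  idem : P * P = P
  gen_mul : ∀ i < m, e i * P = 0
  mul_gen : ∀ i < m, P * e i = 0
  comm : ∀ j, m + 1 ≤ j → e j * P = P * e j
  pred_mul : Q * P = P
  mul_pred : P * Q = P
  pred_comm : e m * Q = Q * e m
  partial_trace : e m * P * e m = -r • (Q * e m)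

/-- The recursion `P ↦ P + r⁻¹ P eₘ P` produces the next Jones–Wenzl idempotent. -/
theorem IsJonesWenzlPair.step {F A : Type*} [Field F] [Ring A] [Algebra F A] {e : ℕ → A}
    {δ r : F} (hcomm : ∀ i j, i + 2 ≤ j → e j * e i = e i * e j)
    (hbraid : ∀ i, e (i + 1) * e i * e (i + 1) = e (i + 1))
    (hidem : ∀ i, e i * e i = δ • e i) (hr : r ≠ 0) {m : ℕ} {P Q : A}
    (h : IsJonesWenzlPair e r m P Q) :
    IsJonesWenzlPair e (-(δ + r⁻¹)) (m + 1) (P + r⁻¹ • (P * e m * P)) P := by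
  have hPR : P * (P + r⁻¹ • (P * e m * P)) = P + r⁻¹ • (P * e m * P) := by
    rw [mul_add, mul_smul_comm, ← mul_assoc, ← mul_assoc, h.idem]
  have hRP : (P + r⁻¹ • (P * e m * P)) * P = P + r⁻¹ • (P * e m * P) := by
    rw [add_mul, smul_mul_assoc, mul_assoc _ P P, h.idem]
  have hleft : e m * (P + r⁻¹ • (P * e m * P)) = 0 := by
    rw [mul_add, mul_smul_comm, ← mul_assoc, ← mul_assoc, h.partial_trace, ← h.pred_comm,
      smul_mul_assoc, mul_assoc, h.pred_mul, smul_smul, mul_neg, inv_mul_cancel₀ hr, neg_one_smul,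
      add_neg_cancel]
  have hright : (P + r⁻¹ • (P * e m * P)) * e m = 0 := by
    rw [add_mul, smul_mul_assoc, mul_assoc P, mul_assoc P, h.partial_trace, mul_smul_comm,
      ← mul_assoc, h.mul_pred, smul_smul, mul_neg, inv_mul_cancel₀ hr, neg_one_smul,
      add_neg_cancel]
  have hc : e (m + 1) * P = P * e (m + 1) := h.comm _ le_rfl
  refine ⟨?_, fun i hi => ?_, fun i hi => ?_, fun j hj => ?_, hPR, hRP, hc, ?_⟩
  · rw [add_mul, hPR, smul_mul_assoc, mul_assoc (P * e m), hPR, mul_assoc P (e m) (P + _), hleft,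
      mul_zero, smul_zero, add_zero]
  · rcases Nat.lt_succ_iff_lt_or_eq.mp hi with hi | rfl
    · rw [mul_add, mul_smul_comm, ← mul_assoc, ← mul_assoc, h.gen_mul i hi]
      simp
    · exact hleft
  · rcases Nat.lt_succ_iff_lt_or_eq.mp hi with hi | rfl
    · rw [add_mul, smul_mul_assoc, mul_assoc _ P, h.mul_gen i hi]
      simp
    · exact hright
  · have hj' : Commute (e j) P := h.comm j (by lia)
    have hjm : Commute (e j) (e m) := hcomm m j (by lia)
    exact hj'.add_right (((hj'.mul_right hjm).mul_right hj').smul_right _)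
  · have hmid : e (m + 1) * (P * e m * P) * e (m + 1) = P * e (m + 1) := by
      calc e (m + 1) * (P * e m * P) * e (m + 1)
          = (e (m + 1) * P) * e m * (P * e (m + 1)) := by simp only [mul_assoc]
        _ = P * (e (m + 1) * e m * e (m + 1)) * P := by
            rw [← hc]
            nth_rewrite 1 [hc]
            simp only [mul_assoc]
        _ = P * e (m + 1) := by rw [hbraid, mul_assoc, hc, ← mul_assoc, h.idem]
    rw [mul_add, add_mul, mul_smul_comm, smul_mul_assoc, hmid, hc, mul_assoc, hidem,
      mul_smul_comm, neg_neg, add_smul]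

/-- Jones–Wenzl idempotents exist as long as the relevant quantum integers are nonzero, and
every augmentation killing the generators sends them to `1`. -/
theorem exists_isJonesWenzlPair {F : Type} {A : Type*} [Field F] [Ring A] [Algebra F A]
    {e : ℕ → A} {v : F} (hcomm : ∀ i j, i + 2 ≤ j → e j * e i = e i * e j)
    (hbraid : ∀ i, e (i + 1) * e i * e (i + 1) = e (i + 1))
    (hidem : ∀ i, e i * e i = -(v + v⁻¹) • e i) (ε : A →ₐ[F] F) (hε : ∀ i, ε (e i) = 0)
    (m : ℕ) (hq : ∀ k, 1 ≤ k → k ≤ m + 1 → qInt v k ≠ 0) :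
    ∃ P Q, IsJonesWenzlPair e (qInt v (m + 2) / qInt v (m + 1)) m P Q ∧ ε P = 1 := by
  induction m with
  | zero =>
    refine ⟨1, 1, ⟨by simp, by simp, by simp, by simp, by simp, by simp, by simp, ?_⟩, by simp⟩
    simp [qInt, hidem]
  | succ m ih =>
    obtain ⟨P, Q, h, hP⟩ := ih fun k h1 h2 => hq k h1 (by lia)
    have h1 : qInt v (m + 1) ≠ 0 := hq _ (by lia) (by lia)
    have h2 : qInt v (m + 2) ≠ 0 := hq _ (by lia) (by lia)
    have hr : qInt v (m + 1 + 2) / qInt v (m + 1 + 1)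
        = -(-(v + v⁻¹) + (qInt v (m + 2) / qInt v (m + 1))⁻¹) := by
      rw [show qInt v (m + 1 + 2) = (v + v⁻¹) * qInt v (m + 2) - qInt v (m + 1) from rfl,
        sub_div, mul_div_assoc, div_self h2, inv_div]
      ring
    refine ⟨_, P, hr ▸ h.step hcomm hbraid hidem (div_ne_zero h2 h1), ?_⟩
    simp [hP, hε]

namespace TemperleyLieb

variable {F : Type} [Field F] {δ : F} {n : ℕ}

theorem gen_comm (i j : Fin (n - 1)) (h : (i : ℕ) + 2 ≤ j ∨ (j : ℕ) + 2 ≤ i) :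
    TLgen F δ n i * TLgen F δ n j = TLgen F δ n j * TLgen F δ n i := by
  have := RingQuot.mkAlgHom_rel F (TLRel.comm (F := F) (δ := δ) i j h)
  rw [map_mul, map_mul] at this
  exact this

theorem gen_braid (i j : Fin (n - 1)) (h : (j : ℕ) = i + 1) :
    TLgen F δ n j * TLgen F δ n i * TLgen F δ n j = TLgen F δ n j := by
  have := RingQuot.mkAlgHom_rel F (TLRel.braid_hi (F := F) (δ := δ) i j h)
  rw [map_mul, map_mul] at this
  exact this

theorem gen_mul_self (i : Fin (n - 1)) :
    TLgen F δ n i * TLgen F δ n i = δ • TLgen F δ n i := by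
  have := RingQuot.mkAlgHom_rel F (TLRel.idem (F := F) (δ := δ) i)
  rw [map_mul, map_smul] at this
  exact this

variable (F δ n) in
/-- The augmentation of the Temperley–Lieb algebra, killing all generators. -/
noncomputable def augmentation : TemperleyLieb F δ n →ₐ[F] F :=
  RingQuot.liftAlgHom F (s := TLRel F δ n) ⟨FreeAlgebra.lift F fun _ => 0, by
    intro x y h
    cases h <;> simp⟩

@[simp]
theorem augmentation_gen (i : Fin (n - 1)) : augmentation F δ n (TLgen F δ n i) = 0 :=
  (RingQuot.liftAlgHom_mkAlgHom_apply F _ _ _).trans (FreeAlgebra.lift_ι_apply _ _)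

theorem induction_on {C : TemperleyLieb F δ n → Prop}
    (algebraMap : ∀ r : F, C (algebraMap F _ r)) (gen : ∀ i, C (TLgen F δ n i))
    (mul : ∀ x y, C x → C y → C (x * y)) (add : ∀ x y, C x → C y → C (x + y))
    (x : TemperleyLieb F δ n) : C x := by
  obtain ⟨a, rfl⟩ := RingQuot.mkAlgHom_surjective F (TLRel F δ n) x
  induction a using FreeAlgebra.induction with
  | grade0 r => rw [AlgHom.commutes]; exact algebraMap r
  | grade1 i => exact gen i
  | mul x y hx hy => rw [map_mul]; exact mul _ _ hx hy
  | add x y hx hy => rw [map_add]; exact add _ _ hx hy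

theorem mul_eq_augmentation_smul {p : TemperleyLieb F δ n} (hp : ∀ i, TLgen F δ n i * p = 0)
    (x : TemperleyLieb F δ n) : x * p = augmentation F δ n x • p := by
  induction x using induction_on with
  | algebraMap r => rw [AlgHom.commutes, Algebra.smul_def]; rfl
  | gen i => rw [hp, augmentation_gen, zero_smul]
  | mul x y hx hy => rw [mul_assoc, hy, mul_smul_comm, hx, smul_smul, map_mul, mul_comm]
  | add x y hx hy => rw [add_mul, hx, hy, map_add, add_smul]

theorem mul_eq_augmentation_smul' {p : TemperleyLieb F δ n} (hp : ∀ i, p * TLgen F δ n i = 0)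
    (x : TemperleyLieb F δ n) : p * x = augmentation F δ n x • p := by
  induction x using induction_on with
  | algebraMap r => rw [AlgHom.commutes, ← Algebra.commutes, Algebra.smul_def]; rfl
  | gen i => rw [hp, augmentation_gen, zero_smul]
  | mul x y hx hy => rw [← mul_assoc, hx, smul_mul_assoc, hy, smul_smul, map_mul]
  | add x y hx hy => rw [mul_add, hx, hy, map_add, add_smul]

theorem augmentation_eq_one {p : TemperleyLieb F δ n} (h0 : p ≠ 0) (hpp : p * p = p)
    (hp : ∀ i, TLgen F δ n i * p = 0) : augmentation F δ n p = 1 := by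
  have h := mul_eq_augmentation_smul hp p
  rw [hpp] at h
  exact (smul_left_injective F h0 (by simpa using h)).symm

theorem eq_of_gen_mul_eq_zero {p q : TemperleyLieb F δ n}
    (hp0 : p ≠ 0) (hpp : p * p = p) (hp : ∀ i, TLgen F δ n i * p = 0 ∧ p * TLgen F δ n i = 0)
    (hq0 : q ≠ 0) (hqq : q * q = q) (hq : ∀ i, TLgen F δ n i * q = 0 ∧ q * TLgen F δ n i = 0) :
    p = q := by
  have h1 := mul_eq_augmentation_smul (fun i => (hq i).1) p
  have h2 := mul_eq_augmentation_smul' (fun i => (hp i).2) q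
  rw [augmentation_eq_one hp0 hpp fun i => (hp i).1, one_smul] at h1
  rw [augmentation_eq_one hq0 hqq fun i => (hq i).1, one_smul] at h2
  exact h2.symm.trans h1

variable (F δ n) in
/-- The generators of the Temperley–Lieb algebra, extended by zero to all natural indices. -/
noncomputable def genNat (i : ℕ) : TemperleyLieb F δ n :=
  if h : i < n - 1 then TLgen F δ n ⟨i, h⟩ else 0

theorem genNat_val (i : Fin (n - 1)) : genNat F δ n i = TLgen F δ n i := dif_pos i.2

theorem genNat_comm (i j : ℕ) (h : i + 2 ≤ j) :
    genNat F δ n j * genNat F δ n i = genNat F δ n i * genNat F δ n j := by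
  unfold genNat
  split_ifs
  · exact gen_comm _ _ (Or.inr h)
  all_goals simp

theorem genNat_braid (i : ℕ) :
    genNat F δ n (i + 1) * genNat F δ n i * genNat F δ n (i + 1) = genNat F δ n (i + 1) := by
  unfold genNat
  split_ifs
  · exact gen_braid _ _ rfl
  · lia
  all_goals simp

theorem genNat_mul_self (i : ℕ) :
    genNat F δ n i * genNat F δ n i = δ • genNat F δ n i := by
  unfold genNat
  split_ifs
  · exact gen_mul_self _
  · simp

theorem augmentation_genNat (i : ℕ) : augmentation F δ n (genNat F δ n i) = 0 := by
  unfold genNat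
  split_ifs <;> simp

end TemperleyLieb

/-- Existence and uniqueness of the Jones–Wenzl idempotent in `TL_n(-(v + v⁻¹))`,
assuming `v ≠ 0` and the quantum integers `[1], …, [n]` are nonzero. -/
theorem exists_unique_jonesWenzl (F : Type) [Field F] (v : F) (n : ℕ)
    (hv : v ≠ 0) (hq : ∀ k, 1 ≤ k → k ≤ n → qInt v k ≠ 0) :
    ∃! p : TemperleyLieb F (-(v + v⁻¹)) n,
      p ≠ 0 ∧ p * p = p ∧
      ∀ i : Fin (n - 1),
        TLgen F (-(v + v⁻¹)) n i * p = 0 ∧ p * TLgen F (-(v + v⁻¹)) n i = 0 := by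
  obtain ⟨p, q, h, hε⟩ := exists_isJonesWenzlPair (v := v) TemperleyLieb.genNat_comm
    TemperleyLieb.genNat_braid TemperleyLieb.genNat_mul_self
    (TemperleyLieb.augmentation F (-(v + v⁻¹)) n) TemperleyLieb.augmentation_genNat (n - 1)
    fun k h1 h2 => by
      rcases n with _ | n
      · obtain rfl : k = 1 := by lia
        exact one_ne_zero
      · exact hq k h1 h2
  have hp0 : p ≠ 0 := by
    rintro rfl
    simp at hε
  have hp : ∀ i : Fin (n - 1),
      TLgen F (-(v + v⁻¹)) n i * p = 0 ∧ p * TLgen F (-(v + v⁻¹)) n i = 0 := fun i => by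
    rw [← TemperleyLieb.genNat_val]
    exact ⟨h.gen_mul i i.2, h.mul_gen i i.2⟩
  exact ⟨p, ⟨hp0, h.idem, hp⟩, fun q ⟨hq0, hqq, hq'⟩ =>
    TemperleyLieb.eq_of_gen_mul_eq_zero hq0 hqq hq' hp0 h.idem hp⟩
end
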